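/- arXiv:math/0507293 — 3 statements merged into one kernel-verified Lean document; each statement's English description precedes it below -/
import Mathlib

section
/- For every fixed integer d ≥ 1, as n → ∞ one has a_{n,d}/n! = e^{−2}·(1 + 4(d−1)/n) + O(1/n²); that is, the sequence n ↦ a_{n,d}/n! − e^{−2}(1 + 4(d−1)/n) is O(1/n²). -/
open Filter Asymptotics

/-- `a_{n,d}` for `d ≥ 1`: the number of permutations `π` of `{1,…,n}` (here realized as
permutations of `Fin n`) such that `|π(i+d) − π(i)| ≠ d` for all valid indices `i`. -/
noncomputable def A (n d : ℕ) : ℕ :=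
  Set.ncard {π : Equiv.Perm (Fin n) |
    ∀ i : Fin n, ∀ h : (i : ℕ) + d < n,
      (((π ⟨(i : ℕ) + d, h⟩ : Fin n) : ℤ) - ((π i : Fin n) : ℤ)).natAbs ≠ d}

section Probability

open scoped Classical

open Equiv

/-- The probability that a uniformly random permutation of `Fin n` satisfies `P`. -/
noncomputable def permProb {n : ℕ} (P : Perm (Fin n) → Prop) : ℝ :=
  (∑ π : Perm (Fin n), if P π then (1 : ℝ) else 0) / (n.factorial : ℝ)

variable {n : ℕ}

lemma permProb_nonneg (P : Perm (Fin n) → Prop) : 0 ≤ permProb P := by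
  unfold permProb
  refine div_nonneg (Finset.sum_nonneg fun π _ => ?_) (by positivity)
  split_ifs <;> norm_num

lemma permProb_mono {P Q : Perm (Fin n) → Prop} (h : ∀ π, P π → Q π) :
    permProb P ≤ permProb Q := by
  unfold permProb
  refine div_le_div_of_nonneg_right (Finset.sum_le_sum fun π _ => ?_) (by positivity)
  by_cases hP : P π
  · simp [hP, h π hP]
  · simp only [hP, if_false]
    split_ifs <;> norm_num

lemma permProb_congr {P Q : Perm (Fin n) → Prop} (h : ∀ π, P π ↔ Q π) :
    permProb P = permProb Q := by
  rw [funext fun π => propext (h π)]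

lemma permProb_true : permProb (fun _ : Perm (Fin n) => True) = 1 := by
  have : (n.factorial : ℝ) ≠ 0 := by positivity
  simp [permProb, Fintype.card_perm, this]

lemma permProb_le_one (P : Perm (Fin n) → Prop) : permProb P ≤ 1 :=
  permProb_true (n := n) ▸ permProb_mono fun _ _ => trivial

lemma permProb_eq_zero {P : Perm (Fin n) → Prop} (h : ∀ π, ¬ P π) : permProb P = 0 := by
  simp [permProb, h]

lemma permProb_split (P Q : Perm (Fin n) → Prop) :
    permProb P = permProb (fun π => P π ∧ Q π) + permProb (fun π => P π ∧ ¬ Q π) := by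
  unfold permProb
  rw [← add_div, ← Finset.sum_add_distrib]
  congr 1
  refine Finset.sum_congr rfl fun π _ => ?_
  by_cases hP : P π <;> by_cases hQ : Q π <;> simp [hP, hQ]

lemma permProb_eq_sum_fiber {α : Type*} (s : Finset α) (f : Perm (Fin n) → α)
    (P : Perm (Fin n) → Prop) (hs : ∀ π, P π → f π ∈ s) :
    permProb P = ∑ a ∈ s, permProb (fun π => f π = a ∧ P π) := by
  unfold permProb
  rw [← Finset.sum_div, Finset.sum_comm]
  congr 1
  refine Finset.sum_congr rfl fun π _ => ?_
  by_cases hP : P π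
  · simp [hP, hs π hP]
  · simp [hP]

lemma permProb_exists_le {ι : Type*} (I : Finset ι) (Q : ι → Perm (Fin n) → Prop) :
    permProb (fun π => ∃ t ∈ I, Q t π) ≤ ∑ t ∈ I, permProb (Q t) := by
  unfold permProb
  rw [← Finset.sum_div, Finset.sum_comm]
  refine div_le_div_of_nonneg_right (Finset.sum_le_sum fun π _ => ?_) (by positivity)
  have hnn : ∀ t ∈ I, (0 : ℝ) ≤ if Q t π then 1 else 0 := fun t _ => by split_ifs <;> norm_num
  by_cases h : ∃ t ∈ I, Q t π
  · obtain ⟨t, ht, hQ⟩ := h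
    rw [if_pos ⟨t, ht, hQ⟩]
    calc (1 : ℝ) = if Q t π then 1 else 0 := by simp [hQ]
      _ ≤ _ := Finset.single_le_sum hnn ht
  · rw [if_neg h]
    exact Finset.sum_nonneg hnn

lemma permProb_exists_le_card_mul {ι : Type*} (I : Finset ι) (Q : ι → Perm (Fin n) → Prop)
    {c B : ℝ} (hc : (I.card : ℝ) ≤ c) (hB : 0 ≤ B) (h : ∀ t ∈ I, permProb (Q t) ≤ B) :
    permProb (fun π => ∃ t ∈ I, Q t π) ≤ c * B := by
  refine (permProb_exists_le I Q).trans ((Finset.sum_le_card_nsmul I _ B h).trans ?_)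
  rw [nsmul_eq_mul]
  gcongr

lemma permProb_or_le (P Q : Perm (Fin n) → Prop) :
    permProb (fun π => P π ∨ Q π) ≤ permProb P + permProb Q := by
  unfold permProb
  rw [← add_div, ← Finset.sum_add_distrib]
  refine div_le_div_of_nonneg_right (Finset.sum_le_sum fun π _ => ?_) (by positivity)
  by_cases hP : P π <;> by_cases hQ : Q π <;> simp [hP, hQ]

lemma abs_permProb_sub_le {P Q B : Perm (Fin n) → Prop} (h : ∀ π, ¬ (P π ↔ Q π) → B π) :
    |permProb P - permProb Q| ≤ permProb B := by
  unfold permProb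
  rw [← sub_div, ← Finset.sum_sub_distrib, abs_div, abs_of_pos (a := (n.factorial : ℝ))
    (by positivity)]
  refine div_le_div_of_nonneg_right
    ((Finset.abs_sum_le_sum_abs _ _).trans (Finset.sum_le_sum fun π _ => ?_)) (by positivity)
  have := h π
  by_cases hP : P π <;> by_cases hQ : Q π <;> by_cases hB : B π <;> simp_all

lemma permProb_mul_left (τ : Perm (Fin n)) (P : Perm (Fin n) → Prop) :
    permProb (fun π => P (τ * π)) = permProb P := by
  unfold permProb
  exact congrArg (· / _) (Equiv.sum_comp (Equiv.mulLeft τ) fun π => if P π then (1 : ℝ) else 0)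

lemma permProb_mul_right (τ : Perm (Fin n)) (P : Perm (Fin n) → Prop) :
    permProb (fun π => P (π * τ)) = permProb P := by
  unfold permProb
  exact congrArg (· / _) (Equiv.sum_comp (Equiv.mulRight τ) fun π => if P π then (1 : ℝ) else 0)

lemma abs_permProb_exists_sub_sum_le {ι : Type*} [DecidableEq ι] (N : Finset ι)
    (F : Perm (Fin n) → Prop)
    (Q : ι → Perm (Fin n) → Prop) :
    |permProb (fun π => F π ∧ ∃ k ∈ N, Q k π) - ∑ k ∈ N, permProb (fun π => F π ∧ Q k π)| ≤
      ∑ k ∈ N, ∑ l ∈ N.erase k, permProb (fun π => F π ∧ Q k π ∧ Q l π) := by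
  unfold permProb
  simp only [← Finset.sum_div]
  rw [← sub_div, abs_div, abs_of_pos (a := (n.factorial : ℝ)) (by positivity)]
  refine div_le_div_of_nonneg_right ?_ (by positivity)
  rw [Finset.sum_comm (s := N), ← Finset.sum_sub_distrib]
  have hcomm : ∀ f : ι → ι → Perm (Fin n) → ℝ,
      ∑ k ∈ N, ∑ l ∈ N.erase k, ∑ π, f k l π = ∑ π, ∑ k ∈ N, ∑ l ∈ N.erase k, f k l π := by
    intro f
    rw [Finset.sum_comm (s := Finset.univ)]
    exact Finset.sum_congr rfl fun k _ => Finset.sum_comm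
  rw [hcomm]
  refine (Finset.abs_sum_le_sum_abs _ _).trans (Finset.sum_le_sum fun π _ => ?_)
  by_cases hF : F π
  swap
  · simp [hF]
  simp only [hF, true_and]
  set M := N.filter (fun k => Q k π) with hM
  have h1 : ∑ k ∈ N, (if Q k π then (1 : ℝ) else 0) = M.card := by simp [hM]
  have h2 : ∑ k ∈ N, ∑ l ∈ N.erase k, (if Q k π ∧ Q l π then (1 : ℝ) else 0)
      = M.card * (M.card - 1) := by
    rw [← nsmul_eq_mul, ← Finset.sum_const, hM, Finset.sum_filter]
    refine Finset.sum_congr rfl fun k hk => ?_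
    by_cases hQ : Q k π
    · have hkM : k ∈ M := by simp [hM, hk, hQ]
      simp only [hQ, true_and, if_true]
      have : ((M.erase k).card : ℝ) = M.card - 1 := by
        rw [Finset.card_erase_of_mem hkM, Nat.cast_sub (Finset.card_pos.2 ⟨k, hkM⟩)]
        simp
      rw [← hM, ← this, hM, ← Finset.filter_erase]
      simp
    · simp [hQ]
  rw [h1, h2]
  by_cases h : ∃ k ∈ N, Q k π
  · rw [if_pos h]
    obtain ⟨k, hk, hQ⟩ := h
    have h3 : 1 ≤ M.card := Finset.card_pos.2 ⟨k, by simp [hM, hk, hQ]⟩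
    have h4 : (1 : ℝ) ≤ M.card := by exact_mod_cast h3
    rw [abs_of_nonpos (by linarith)]
    nlinarith
  · rw [if_neg h]
    have : M = ∅ := Finset.filter_eq_empty_iff.2 fun k hk hQ => h ⟨k, hk, hQ⟩
    simp [this]

lemma exists_perm_apply_eq {α ι : Type*} [Fintype α] {y y' : ι → α}
    (hy : Function.Injective y) (hy' : Function.Injective y') :
    ∃ τ : Perm α, (∀ i, τ (y i) = y' i) ∧
      ∀ v, v ∉ Set.range y → v ∉ Set.range y' → τ v = v := by
  let U : Set α := Set.range y ∪ Set.range y'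
  let f : ι → U := fun i => ⟨y i, Or.inl ⟨i, rfl⟩⟩
  let g : ι → U := fun i => ⟨y' i, Or.inr ⟨i, rfl⟩⟩
  have hf : Function.Injective f := fun i j h => hy (congrArg Subtype.val h)
  have hg : Function.Injective g := fun i j h => hy' (congrArg Subtype.val h)
  let e : {u // u ∈ Set.range f} ≃ {u // u ∈ Set.range g} :=
    (Equiv.ofInjective f hf).symm.trans (Equiv.ofInjective g hg)
  refine ⟨Equiv.Perm.ofSubtype (e.extendSubtype), fun i => ?_, fun v hv hv' => ?_⟩
  · have h1 : e.extendSubtype (f i) = g i := by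
      rw [Equiv.extendSubtype_apply_of_mem _ _ ⟨i, rfl⟩]
      have : (Equiv.ofInjective f hf).symm ⟨f i, ⟨i, rfl⟩⟩ = i := by
        rw [Equiv.symm_apply_eq]; rfl
      simp [e, this]
    have h2 := Equiv.Perm.ofSubtype_apply_of_mem (e.extendSubtype) (f i).2
    change Equiv.Perm.ofSubtype e.extendSubtype (y i) = _
    rw [h2, Subtype.coe_eta, h1]
  · exact Equiv.Perm.ofSubtype_apply_of_not_mem _ (by simp only [U, Set.mem_union]; tauto)

/-- The permutation `π` sends the points `x` to the points `y`. -/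
def SendsTo {k : ℕ} (x y : Fin k → Fin n) (π : Perm (Fin n)) : Prop :=
  ∀ i, π (x i) = y i

lemma permProb_sendsTo {k : ℕ} {x y : Fin k → Fin n} (hx : Function.Injective x)
    (hy : Function.Injective y) : permProb (SendsTo x y) = 1 / (n.descFactorial k : ℝ) := by
  have key : ∀ z : Fin k ↪ Fin n, permProb (SendsTo x z) = permProb (SendsTo x y) := by
    intro z
    obtain ⟨τ, hτ, -⟩ := exists_perm_apply_eq hy z.injective
    rw [← permProb_mul_left τ]
    refine permProb_congr fun π => forall_congr' fun i => ?_
    rw [Perm.mul_apply, ← hτ i, τ.injective.eq_iff]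
  have hsum := permProb_eq_sum_fiber Finset.univ
    (fun π : Perm (Fin n) => (⟨fun i => π (x i), π.injective.comp hx⟩ : Fin k ↪ Fin n))
    (fun _ => True) (by simp)
  rw [permProb_true, Finset.sum_congr rfl (g := fun _ => permProb (SendsTo x y))] at hsum
  · rw [Finset.sum_const, Finset.card_univ, Fintype.card_embedding_eq, Fintype.card_fin,
      Fintype.card_fin, nsmul_eq_mul] at hsum
    rw [eq_div_iff, mul_comm, ← hsum]
    rintro h
    simp [h] at hsum
  · intro z _
    rw [← key z]
    refine permProb_congr fun π => ?_
    simp only [and_true, SendsTo, DFunLike.ext_iff]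
    rfl

lemma half_pow_le_descFactorial {k : ℕ} (h : 2 * k ≤ n) :
    ((n : ℝ) / 2) ^ k ≤ n.descFactorial k := by
  have h1 : (((n + 1 - k : ℕ) : ℝ)) ^ k ≤ n.descFactorial k := by
    exact_mod_cast Nat.pow_sub_le_descFactorial n k
  refine le_trans ?_ h1
  gcongr
  rw [div_le_iff₀ (by norm_num)]
  have : n ≤ (n + 1 - k) * 2 := by omega
  exact_mod_cast this

lemma permProb_sendsTo_le {k : ℕ} {x : Fin k → Fin n} (hx : Function.Injective x)
    (y : Fin k → Fin n) (h : 2 * k ≤ n) : permProb (SendsTo x y) ≤ (2 / (n : ℝ)) ^ k := by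
  by_cases hy : Function.Injective y
  · rw [permProb_sendsTo hx hy]
    rcases Nat.eq_zero_or_pos k with rfl | hk
    · simp
    have hn : (0 : ℝ) < n := by exact_mod_cast (by omega : 0 < n)
    have := half_pow_le_descFactorial h
    rw [show (2 / (n : ℝ)) ^ k = 1 / ((n : ℝ) / 2) ^ k by rw [← one_div_pow, one_div_div]]
    exact one_div_le_one_div_of_le (by positivity) this
  · rw [permProb_eq_zero]
    · positivity
    · intro π hπ
      exact hy fun i j hij => hx (π.injective (by rw [hπ i, hπ j, hij]))

lemma abs_one_div_descFactorial_sub_le {k : ℕ} (h : 2 * k ≤ n) (hn : 0 < n) :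
    |1 / (n.descFactorial k : ℝ) - 1 / (n : ℝ) ^ k| ≤ (k ^ 2 * 2 ^ k) / (n : ℝ) ^ (k + 1) := by
  have hn' : (0 : ℝ) < n := by exact_mod_cast hn
  have h1 := half_pow_le_descFactorial h
  have h0 : (0 : ℝ) < n.descFactorial k := lt_of_lt_of_le (by positivity) h1
  have h2 : (n.descFactorial k : ℝ) ≤ (n : ℝ) ^ k := by
    exact_mod_cast Nat.descFactorial_le_pow n k
  have h3 : (n : ℝ) ^ k * (1 - k ^ 2 / n) ≤ n.descFactorial k := by
    have h4 : (((n + 1 - k : ℕ) : ℝ)) ^ k ≤ n.descFactorial k := by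
      exact_mod_cast Nat.pow_sub_le_descFactorial n k
    refine le_trans ?_ h4
    have h5 : (n : ℝ) * (1 + (-(k / n : ℝ))) ≤ ((n + 1 - k : ℕ) : ℝ) := by
      rw [Nat.cast_sub (by omega)]
      push_cast
      field_simp
      linarith
    have h7 : (k : ℝ) / n ≤ 1 := by
      rw [div_le_one hn']
      exact_mod_cast (by omega : k ≤ n)
    have h6 := one_add_mul_le_pow (a := -(k / n : ℝ)) (by linarith) k
    calc (n : ℝ) ^ k * (1 - k ^ 2 / n) = (n : ℝ) ^ k * (1 + k * (-(k / n : ℝ))) := by ring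
      _ ≤ (n : ℝ) ^ k * (1 + (-(k / n : ℝ))) ^ k := by gcongr
      _ = ((n : ℝ) * (1 + (-(k / n : ℝ)))) ^ k := by rw [mul_pow]
      _ ≤ _ := pow_le_pow_left₀ (mul_nonneg hn'.le (by linarith)) h5 k
  rw [div_sub_div _ _ h0.ne' (by positivity), abs_of_nonneg (by
    apply div_nonneg _ (by positivity); linarith)]
  rw [div_le_div_iff₀ (by positivity) (by positivity)]
  calc (1 * (n : ℝ) ^ k - n.descFactorial k * 1) * n ^ (k + 1)
      ≤ ((n : ℝ) ^ k * (k ^ 2 / n)) * n ^ (k + 1) := by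
        gcongr
        linarith
    _ = k ^ 2 * 2 ^ k * (((n : ℝ) / 2) ^ k * n ^ k) := by
        rw [div_pow]
        field_simp
        ring
    _ ≤ _ := by gcongr

end Probability

section Steps

open scoped Classical

open Equiv

variable {n : ℕ}

/-- `v` and `w` differ by exactly `d`. -/
def StepAdj (d : ℕ) (v w : Fin n) : Prop := (w : ℕ) = v + d ∨ (v : ℕ) = w + d

lemma StepAdj.symm {d : ℕ} {v w : Fin n} (h : StepAdj d v w) : StepAdj d w v := Or.symm h

lemma StepAdj.ne {d : ℕ} (hd : 1 ≤ d) {v w : Fin n} (h : StepAdj d v w) : v ≠ w := by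
  rintro rfl
  unfold StepAdj at h
  omega

lemma StepAdj.eq_of_ne {d : ℕ} {v a b c : Fin n} (ha : StepAdj d v a) (hb : StepAdj d v b)
    (hc : StepAdj d v c) (hab : a ≠ b) (hac : a ≠ c) : b = c := by
  unfold StepAdj at *
  rw [Ne, Fin.ext_iff] at *
  omega

lemma StepAdj.not_triangle {d : ℕ} (hd : 1 ≤ d) {s r q : Fin n} (h₁ : StepAdj d s r)
    (h₂ : StepAdj d r q) : ¬ StepAdj d s q := by
  unfold StepAdj at *
  omega

/-- The elements of `Fin n` at distance exactly `d` from `v`. -/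
noncomputable def stepNbrs (d : ℕ) (v : Fin n) : Finset (Fin n) :=
  Finset.univ.filter (StepAdj d v)

lemma mem_stepNbrs {d : ℕ} {v w : Fin n} : w ∈ stepNbrs d v ↔ StepAdj d v w := by
  simp [stepNbrs]

lemma card_filter_eq_add_le_one (d : ℕ) (v : Fin n) :
    (Finset.univ.filter fun w : Fin n => (w : ℕ) = v + d).card ≤ 1 :=
  Finset.card_le_one.2 fun a ha b hb => by
    simp only [Finset.mem_filter_univ] at ha hb
    exact Fin.ext (ha.trans hb.symm)

lemma card_filter_add_eq_le_one (d : ℕ) (v : Fin n) :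
    (Finset.univ.filter fun w : Fin n => (v : ℕ) = w + d).card ≤ 1 :=
  Finset.card_le_one.2 fun a ha b hb => by
    simp only [Finset.mem_filter_univ] at ha hb
    exact Fin.ext (by omega)

lemma card_stepNbrs_le (d : ℕ) (v : Fin n) : (stepNbrs d v).card ≤ 2 := by
  have : stepNbrs d v = (Finset.univ.filter fun w : Fin n => (w : ℕ) = v + d) ∪
      Finset.univ.filter fun w : Fin n => (v : ℕ) = w + d := by
    ext w
    simp [mem_stepNbrs, StepAdj]
  rw [this]
  have h₁ := card_filter_eq_add_le_one d v
  have h₂ := card_filter_add_eq_le_one d v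
  exact (Finset.card_union_le _ _).trans (by omega)

/-- A set of pairs of the form `(i, i + d)`. -/
def IsStepSet (d : ℕ) (E : Finset (Fin n × Fin n)) : Prop := ∀ e ∈ E, (e.2 : ℕ) = e.1 + d

lemma IsStepSet.mono {d : ℕ} {E F : Finset (Fin n × Fin n)} (hE : IsStepSet d E) (h : F ⊆ E) :
    IsStepSet d F := fun e he => hE e (h he)

lemma IsStepSet.card_le {d : ℕ} {E : Finset (Fin n × Fin n)} (hE : IsStepSet d E) :
    E.card ≤ n := by
  have : E.card ≤ (Finset.univ : Finset (Fin n)).card := by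
    refine Finset.card_le_card_of_injOn Prod.fst (by simp) fun e he f hf h => ?_
    have h₁ := hE e he
    have h₂ := hE f hf
    exact Prod.ext h (Fin.ext (by rw [h₁, h₂, h]))
  simpa using this

lemma IsStepSet.ne {d : ℕ} (hd : 1 ≤ d) {E : Finset (Fin n × Fin n)} (hE : IsStepSet d E)
    {e : Fin n × Fin n} (he : e ∈ E) : e.1 ≠ e.2 := by
  intro h
  have := hE e he
  rw [h] at this
  omega

/-- No pair of `E` is sent by `π` to a pair at distance exactly `d`. -/
def Avoids (d : ℕ) (E : Finset (Fin n × Fin n)) (π : Perm (Fin n)) : Prop :=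
  ∀ e ∈ E, ¬ StepAdj d (π e.1) (π e.2)

lemma Avoids.mono {d : ℕ} {E F : Finset (Fin n × Fin n)} {π : Perm (Fin n)}
    (hE : Avoids d E π) (h : F ⊆ E) : Avoids d F π := fun e he => hE e (h he)

lemma SendsTo.cons {k : ℕ} {x y : Fin k → Fin n} {π : Perm (Fin n)} (h : SendsTo x y π)
    {u c : Fin n} (hu : π u = c) :
    SendsTo (Fin.cons u x : Fin (k + 1) → Fin n) (Fin.cons c y : Fin (k + 1) → Fin n) π := by
  intro i
  refine Fin.cases ?_ (fun i => ?_) i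
  · simpa using hu
  · simpa using h i

lemma permProb_sendsTo_and_le {k : ℕ} {x : Fin k → Fin n} (hx : Function.Injective x)
    (y : Fin k → Fin n) (h : 2 * (k + 1) ≤ n) {u : Fin n} (hu : u ∉ Set.range x) (c : Fin n) :
    permProb (fun π => SendsTo x y π ∧ π u = c) ≤ (2 / (n : ℝ)) ^ (k + 1) :=
  (permProb_mono fun _ hπ => hπ.1.cons hπ.2).trans
    (permProb_sendsTo_le (Fin.cons_injective_iff.2 ⟨hu, hx⟩) _ h)

lemma permProb_sendsTo_and_and_le {k : ℕ} {x : Fin k → Fin n} (hx : Function.Injective x)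
    (y : Fin k → Fin n) (h : 2 * (k + 2) ≤ n) {u w : Fin n} (hu : u ∉ Set.range x)
    (hw : w ∉ Set.range x) (huw : u ≠ w) (c v : Fin n) :
    permProb (fun π => SendsTo x y π ∧ π u = c ∧ π w = v) ≤ (2 / (n : ℝ)) ^ (k + 2) := by
  refine (permProb_mono fun _ hπ => (hπ.1.cons hπ.2.1).cons hπ.2.2).trans
    (permProb_sendsTo_le (k := k + 1 + 1) (Fin.cons_injective_iff.2
      ⟨?_, Fin.cons_injective_iff.2 ⟨hu, hx⟩⟩) _ h)
  rintro ⟨i, hi⟩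
  revert hi
  refine Fin.cases ?_ (fun i => ?_) i
  · simpa using huw
  · intro hi
    exact hw ⟨i, by simpa using hi⟩

lemma permProb_stepAdj_le {d : ℕ} (hn : 4 ≤ n) {u w : Fin n} (huw : u ≠ w) :
    permProb (fun π => StepAdj d (π u) (π w)) ≤ 8 / (n : ℝ) := by
  have hn' : (0 : ℝ) < n := by exact_mod_cast (by omega : 0 < n)
  have h : permProb (fun π => StepAdj d (π u) (π w)) ≤
      permProb (fun π => ∃ s ∈ (Finset.univ : Finset (Fin n)), ∃ r ∈ stepNbrs d s,
        π u = s ∧ π w = r) :=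
    permProb_mono fun π hπ => ⟨π u, Finset.mem_univ _, π w, mem_stepNbrs.2 hπ, rfl, rfl⟩
  refine h.trans ((permProb_exists_le_card_mul _ _ (c := n) (B := 2 * (2 / (n : ℝ)) ^ 2)
    (by simp) (by positivity) fun s _ => ?_).trans_eq ?_)
  · refine permProb_exists_le_card_mul _ _ (by exact_mod_cast card_stepNbrs_le d s)
      (by positivity) fun r _ => ?_
    refine le_trans (permProb_mono fun π hπ => ?_) (permProb_sendsTo_and_and_le (k := 0)
      (x := Fin.elim0) (fun i => i.elim0) Fin.elim0 (by omega) (by simp) (by simp) huw s r)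
    exact ⟨fun i => i.elim0, hπ⟩
  · field_simp
    norm_num

/-- Moving the images of the points `x` changes the probability of avoiding `E` only by a
relative amount of order `1 / n`, when `E` does not involve `x`. -/
lemma abs_permProb_sendsTo_avoids_sub_le {d k : ℕ} (hd : 1 ≤ d) (hn : 2 * (k + 2) ≤ n)
    {E : Finset (Fin n × Fin n)} (hE : IsStepSet d E) {x y y' : Fin k → Fin n}
    (hx : Function.Injective x) (hy : Function.Injective y) (hy' : Function.Injective y')
    (hEx : ∀ e ∈ E, e.1 ∉ Set.range x ∧ e.2 ∉ Set.range x) :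
    |permProb (fun π => SendsTo x y π ∧ Avoids d E π) -
      permProb (fun π => SendsTo x y' π ∧ Avoids d E π)| ≤
      n * (2 * k * (4 * (2 * (2 / (n : ℝ)) ^ (k + 2)))) := by
  obtain ⟨τ, hτ, hτ'⟩ := exists_perm_apply_eq hy hy'
  rw [← permProb_mul_left τ (fun π => SendsTo x y' π ∧ Avoids d E π)]
  let U : Finset (Fin n) := Finset.univ.image y ∪ Finset.univ.image y'
  have hU : U.card ≤ 2 * k := by
    refine (Finset.card_union_le _ _).trans ?_
    have h₁ := Finset.card_image_le (s := Finset.univ) (f := y)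
    have h₂ := Finset.card_image_le (s := Finset.univ) (f := y')
    simp only [Finset.card_univ, Fintype.card_fin] at h₁ h₂
    omega
  have hτU : ∀ v, v ∉ U → τ v = v := fun v hv => by
    refine hτ' v ?_ ?_ <;>
    · rintro ⟨i, rfl⟩
      simp [U] at hv
  let M : Fin n → Finset (Fin n) := fun c => stepNbrs d c ∪ (stepNbrs d (τ c)).image τ.symm
  have hM : ∀ c, (M c).card ≤ 4 := fun c => by
    refine (Finset.card_union_le _ _).trans ?_
    have h₁ := card_stepNbrs_le d c
    have h₂ := card_stepNbrs_le d (τ c)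
    have h₃ := Finset.card_image_le (s := stepNbrs d (τ c)) (f := τ.symm)
    omega
  have hMmem : ∀ c v, (StepAdj d c v ∨ StepAdj d (τ c) (τ v)) → v ∈ M c := by
    intro c v h
    simp only [M, Finset.mem_union, Finset.mem_image, mem_stepNbrs]
    exact h.imp_right fun h => ⟨τ v, h, by simp⟩
  have hbad : ∀ π, ¬ ((SendsTo x y π ∧ Avoids d E π) ↔
      (SendsTo x y' (τ * π) ∧ Avoids d E (τ * π))) →
      ∃ e ∈ E, ∃ c ∈ U, ∃ v ∈ M c, (SendsTo x y π ∧ π e.1 = c ∧ π e.2 = v) ∨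
        (SendsTo x y π ∧ π e.2 = c ∧ π e.1 = v) := by
    intro π hπ
    have hs : SendsTo x y' (τ * π) ↔ SendsTo x y π := forall_congr' fun i => by
      rw [Perm.mul_apply, ← hτ i, τ.injective.eq_iff]
    rw [hs] at hπ
    have hxy : SendsTo x y π := by tauto
    have : ∃ e ∈ E, ¬ (StepAdj d (π e.1) (π e.2) ↔ StepAdj d (τ (π e.1)) (τ (π e.2))) := by
      by_contra! hcon
      refine hπ (and_congr_right fun _ => forall₂_congr fun e he => ?_)
      rw [hcon e he]
      rfl
    obtain ⟨e, he, hne⟩ := this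
    by_cases h₁ : π e.1 ∈ U
    · exact ⟨e, he, _, h₁, π e.2, hMmem _ _ (by tauto), Or.inl ⟨hxy, rfl, rfl⟩⟩
    by_cases h₂ : π e.2 ∈ U
    · refine ⟨e, he, _, h₂, π e.1, hMmem _ _ ?_, Or.inr ⟨hxy, rfl, rfl⟩⟩
      have := @StepAdj.symm n d (π e.1) (π e.2)
      have := @StepAdj.symm n d (τ (π e.1)) (τ (π e.2))
      tauto
    · rw [hτU _ h₁, hτU _ h₂] at hne
      exact absurd Iff.rfl hne
  refine (abs_permProb_sub_le hbad).trans ?_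
  refine permProb_exists_le_card_mul _ _ (by exact_mod_cast hE.card_le) (by positivity)
    fun e he => ?_
  refine permProb_exists_le_card_mul _ _ (by exact_mod_cast hU) (by positivity) fun c _ => ?_
  refine permProb_exists_le_card_mul _ _ (by exact_mod_cast hM c) (by positivity) fun v _ => ?_
  refine (permProb_or_le _ _).trans ?_
  have h₁ := permProb_sendsTo_and_and_le hx y hn (hEx e he).1 (hEx e he).2 (hE.ne hd he) c v
  have h₂ := permProb_sendsTo_and_and_le hx y hn (hEx e he).2 (hEx e he).1 (hE.ne hd he).symm c v
  linarith

lemma abs_permProb_sendsTo_avoids_sub_div_le {d k : ℕ} (hd : 1 ≤ d) (hn : 2 * (k + 2) ≤ n)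
    {E : Finset (Fin n × Fin n)} (hE : IsStepSet d E) {x y : Fin k → Fin n}
    (hx : Function.Injective x) (hy : Function.Injective y)
    (hEx : ∀ e ∈ E, e.1 ∉ Set.range x ∧ e.2 ∉ Set.range x) :
    |permProb (fun π => SendsTo x y π ∧ Avoids d E π) -
      permProb (Avoids d E) / (n.descFactorial k : ℝ)| ≤
      n * (2 * k * (4 * (2 * (2 / (n : ℝ)) ^ (k + 2)))) := by
  set B : ℝ := n * (2 * k * (4 * (2 * (2 / (n : ℝ)) ^ (k + 2)))) with hB
  have hsum := permProb_eq_sum_fiber Finset.univ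
    (fun π : Perm (Fin n) => (⟨fun i => π (x i), π.injective.comp hx⟩ : Fin k ↪ Fin n))
    (Avoids d E) (by simp)
  have hsum' : permProb (Avoids d E) =
      ∑ z : Fin k ↪ Fin n, permProb (fun π => SendsTo x z π ∧ Avoids d E π) := by
    rw [hsum]
    refine Finset.sum_congr rfl fun z _ => permProb_congr fun π => ?_
    simp only [SendsTo, DFunLike.ext_iff]
    rfl
  have hcard : (Fintype.card (Fin k ↪ Fin n) : ℝ) = n.descFactorial k := by
    rw [Fintype.card_embedding_eq, Fintype.card_fin, Fintype.card_fin]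
  have hpos : (0 : ℝ) < n.descFactorial k := by
    exact_mod_cast Nat.descFactorial_pos.2 (by omega)
  set P : ℝ := permProb (fun π => SendsTo x y π ∧ Avoids d E π)
  have : P * n.descFactorial k - permProb (Avoids d E) = ∑ z : Fin k ↪ Fin n,
      (P - permProb (fun π => SendsTo x z π ∧ Avoids d E π)) := by
    rw [Finset.sum_sub_distrib, ← hsum', Finset.sum_const, Finset.card_univ, nsmul_eq_mul, hcard]
    ring
  have hle : |P * n.descFactorial k - permProb (Avoids d E)| ≤ n.descFactorial k * B := by
    rw [this, ← hcard, ← nsmul_eq_mul, ← Finset.card_univ]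
    exact (Finset.abs_sum_le_sum_abs _ _).trans (Finset.sum_le_card_nsmul _ _ _ fun z _ =>
      abs_permProb_sendsTo_avoids_sub_le hd hn hE hx hy z.injective hEx)
  have h2 : P - permProb (Avoids d E) / n.descFactorial k =
      (P * n.descFactorial k - permProb (Avoids d E)) / n.descFactorial k := by
    field_simp
  rw [h2, abs_div, abs_of_pos hpos, div_le_iff₀ hpos]
  linarith

lemma card_filter_fst_eq_le {d : ℕ} {E : Finset (Fin n × Fin n)} (hE : IsStepSet d E)
    (u : Fin n) : (E.filter fun e => e.1 = u).card ≤ 1 :=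
  Finset.card_le_one.2 fun e he f hf => by
    simp only [Finset.mem_filter] at he hf
    have h₁ := hE e he.1
    have h₂ := hE f hf.1
    exact Prod.ext (he.2.trans hf.2.symm) (Fin.ext (by rw [h₁, h₂, he.2, hf.2]))

lemma card_filter_snd_eq_le {d : ℕ} {E : Finset (Fin n × Fin n)} (hE : IsStepSet d E)
    (u : Fin n) : (E.filter fun e => e.2 = u).card ≤ 1 :=
  Finset.card_le_one.2 fun e he f hf => by
    simp only [Finset.mem_filter] at he hf
    have h₁ := hE e he.1
    have h₂ := hE f hf.1
    rw [he.2] at h₁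
    rw [hf.2] at h₂
    exact Prod.ext (Fin.ext (by omega)) (he.2.trans hf.2.symm)

lemma permProb_exists_touching_le {d k : ℕ} {E : Finset (Fin n × Fin n)} (hE : IsStepSet d E)
    (x : Fin k → Fin n) (Q : Fin k → Fin n × Fin n → Perm (Fin n) → Prop) {B : ℝ} (hB : 0 ≤ B)
    (h : ∀ i, ∀ e ∈ E, e.1 = x i ∨ e.2 = x i → permProb (Q i e) ≤ B) :
    permProb (fun π => ∃ i, ∃ e ∈ E, (e.1 = x i ∨ e.2 = x i) ∧ Q i e π) ≤ k * (2 * B) := by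
  refine le_trans (permProb_mono (Q := fun π => ∃ i ∈ (Finset.univ : Finset (Fin k)),
    ∃ e ∈ (E.filter fun e => e.1 = x i) ∪ (E.filter fun e => e.2 = x i), Q i e π) ?_) ?_
  · rintro π ⟨i, e, he, hx, hQ⟩
    refine ⟨i, Finset.mem_univ _, e, ?_, hQ⟩
    simp only [Finset.mem_union, Finset.mem_filter]
    tauto
  · refine permProb_exists_le_card_mul _ _ (by simp) (by positivity) fun i _ => ?_
    refine permProb_exists_le_card_mul _ _ ?_ hB fun e he => ?_
    · have h₁ := card_filter_fst_eq_le hE (x i)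
      have h₂ := card_filter_snd_eq_le hE (x i)
      have h₃ := Finset.card_union_le (E.filter fun e => e.1 = x i) (E.filter fun e => e.2 = x i)
      exact_mod_cast h₃.trans (by omega)
    · simp only [Finset.mem_union, Finset.mem_filter] at he
      exact h i e (by tauto) (by tauto)

/-- Prescribing the images of boundedly many points is asymptotically independent of avoiding
the pairs of `E₀`; moreover pairs touching the prescribed points may be disregarded. -/
lemma exists_abs_permProb_sendsTo_avoids_sub_le (k : ℕ) : ∃ C : ℝ, 0 ≤ C ∧
    ∀ n d : ℕ, 1 ≤ d → 2 * (k + 2) ≤ n → ∀ E₀ E₁ : Finset (Fin n × Fin n), IsStepSet d E₀ →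
    E₁ ⊆ E₀ → ∀ x y : Fin k → Fin n, Function.Injective x → Function.Injective y →
    (∀ e ∈ E₀, e ∉ E₁ → ∃ i, e.1 = x i ∨ e.2 = x i) →
    (∀ e ∈ E₁, ∀ i j, e.1 = x i → e.2 = x j → ¬ StepAdj d (y i) (y j)) →
    |permProb (fun π => SendsTo x y π ∧ Avoids d E₁ π) - permProb (Avoids d E₀) / (n : ℝ) ^ k|
      ≤ C / (n : ℝ) ^ (k + 1) := by
  refine ⟨4 * k * 2 ^ (k + 1) + 16 * k * 2 ^ (k + 2) + 16 * k * 2 ^ k + k ^ 2 * 2 ^ k,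
    by positivity, ?_⟩
  intro n d hd hn E₀ E₁ hE₀ hE x y hx hy hout hin
  have hn0 : (0 : ℝ) < n := by exact_mod_cast (by omega : 0 < n)
  set E : Finset (Fin n × Fin n) :=
    E₀.filter fun e => e.1 ∉ Set.range x ∧ e.2 ∉ Set.range x with hEdef
  have hEE₀ : E ⊆ E₀ := Finset.filter_subset _ _
  have hEE₁ : E ⊆ E₁ := fun e he => by
    by_contra h
    simp only [hEdef, Finset.mem_filter] at he
    obtain ⟨i, hi | hi⟩ := hout e he.1 h
    · exact he.2.1 ⟨i, hi.symm⟩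
    · exact he.2.2 ⟨i, hi.symm⟩
  have htouch : ∀ e ∈ E₀, e ∉ E → ∃ i, e.1 = x i ∨ e.2 = x i := by
    intro e he h
    by_contra! hcon
    refine h (Finset.mem_filter.2 ⟨he, ?_, ?_⟩)
    · rintro ⟨i, hi⟩
      exact (hcon i).1 hi.symm
    · rintro ⟨i, hi⟩
      exact (hcon i).2 hi.symm
  have hE₁s := hE₀.mono hE
  have s1 : |permProb (fun π => SendsTo x y π ∧ Avoids d E₁ π) -
      permProb (fun π => SendsTo x y π ∧ Avoids d E π)| ≤
      k * (2 * (2 * (2 / (n : ℝ)) ^ (k + 1))) := by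
    refine (abs_permProb_sub_le (B := fun π => ∃ i, ∃ e ∈ E₁, (e.1 = x i ∨ e.2 = x i) ∧
      (SendsTo x y π ∧ StepAdj d (π e.1) (π e.2))) ?_).trans
      (permProb_exists_touching_le hE₁s x _ (by positivity) ?_)
    · intro π hπ
      have hxy : SendsTo x y π := by tauto
      have : ∃ e ∈ E₁, e ∉ E ∧ StepAdj d (π e.1) (π e.2) := by
        by_contra! hcon
        refine hπ (and_congr_right fun _ => ⟨fun h => h.mono hEE₁, fun h e he => ?_⟩)
        by_cases heE : e ∈ E
        · exact h e heE
        · exact hcon e he heE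
      obtain ⟨e, he, heE, hadj⟩ := this
      obtain ⟨i, hi⟩ := htouch e (hE he) heE
      exact ⟨i, e, he, hi, hxy, hadj⟩
    · intro i e he hi
      have hcase : ∀ u w : Fin n, u = x i → (∀ j, w = x j → ¬ StepAdj d (y i) (y j)) →
          permProb (fun π => SendsTo x y π ∧ StepAdj d (π u) (π w)) ≤
            2 * (2 / (n : ℝ)) ^ (k + 1) := by
        intro u w hu hw
        by_cases hwr : w ∈ Set.range x
        · obtain ⟨j, hj⟩ := hwr
          rw [permProb_eq_zero]
          · positivity
          · rintro π ⟨hπ, hadj⟩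
            rw [hu, ← hj, hπ i, hπ j] at hadj
            exact hw j hj.symm hadj
        · refine (permProb_mono (Q := fun π => ∃ v ∈ stepNbrs d (y i),
            (SendsTo x y π ∧ π w = v)) ?_).trans (permProb_exists_le_card_mul _ _
              (by exact_mod_cast card_stepNbrs_le d (y i)) (by positivity)
              fun v _ => permProb_sendsTo_and_le hx y (by omega) hwr v)
          rintro π ⟨hπ, hadj⟩
          rw [hu, hπ i] at hadj
          exact ⟨π w, mem_stepNbrs.2 hadj, hπ, rfl⟩
      rcases hi with hi | hi
      · exact hcase _ _ hi fun j hj => hin e he i j hi hj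
      · refine (permProb_mono fun π hπ => ⟨hπ.1, hπ.2.symm⟩).trans
          (hcase e.2 e.1 hi fun j hj h => hin e he j i hj hi h.symm)
  have s2 := abs_permProb_sendsTo_avoids_sub_div_le hd hn (hE₀.mono hEE₀) hx hy fun e he =>
    (Finset.mem_filter.1 he).2
  have s3 : |permProb (Avoids d E) - permProb (Avoids d E₀)| ≤ k * (2 * (8 / (n : ℝ))) := by
    refine (abs_permProb_sub_le (B := fun π => ∃ i, ∃ e ∈ E₀, (e.1 = x i ∨ e.2 = x i) ∧
      StepAdj d (π e.1) (π e.2)) ?_).trans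
      (permProb_exists_touching_le hE₀ x _ (by positivity) fun i e he _ =>
        permProb_stepAdj_le (by omega) (hE₀.ne hd he))
    intro π hπ
    have : ∃ e ∈ E₀, e ∉ E ∧ StepAdj d (π e.1) (π e.2) := by
      by_contra! hcon
      refine hπ ⟨fun h e he => ?_, fun h => h.mono hEE₀⟩
      by_cases heE : e ∈ E
      · exact h e heE
      · exact hcon e he heE
    obtain ⟨e, he, heE, hadj⟩ := this
    obtain ⟨i, hi⟩ := htouch e he heE
    exact ⟨i, e, he, hi, hadj⟩
  have s4 := abs_one_div_descFactorial_sub_le (n := n) (k := k) (by omega) (by omega)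
  have hD : (1 : ℝ) / n.descFactorial k ≤ 2 ^ k / n ^ k := by
    have := half_pow_le_descFactorial (n := n) (k := k) (by omega)
    calc (1 : ℝ) / n.descFactorial k ≤ 1 / ((n : ℝ) / 2) ^ k :=
          one_div_le_one_div_of_le (by positivity) this
      _ = _ := by rw [div_pow, one_div_div]
  have s3' : |permProb (Avoids d E) / n.descFactorial k - permProb (Avoids d E₀) /
      n.descFactorial k| ≤ 16 * k * 2 ^ k / (n : ℝ) ^ (k + 1) := by
    rw [← sub_div, div_eq_mul_one_div, abs_mul, abs_of_nonneg (a := 1 / (n.descFactorial k : ℝ))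
      (by positivity)]
    calc _ ≤ (k * (2 * (8 / (n : ℝ)))) * (2 ^ k / n ^ k) := by gcongr
      _ = _ := by
        field_simp
        ring
  have s4' : |permProb (Avoids d E₀) / n.descFactorial k - permProb (Avoids d E₀) / (n : ℝ) ^ k|
      ≤ (k ^ 2 * 2 ^ k) / (n : ℝ) ^ (k + 1) := by
    have : permProb (Avoids d E₀) / n.descFactorial k - permProb (Avoids d E₀) / (n : ℝ) ^ k =
      permProb (Avoids d E₀) * (1 / n.descFactorial k - 1 / (n : ℝ) ^ k) := by ring
    rw [this, abs_mul, abs_of_nonneg (permProb_nonneg _)]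
    exact (mul_le_of_le_one_left (abs_nonneg _) (permProb_le_one _)).trans s4
  have e1 : (k : ℝ) * (2 * (2 * (2 / (n : ℝ)) ^ (k + 1))) =
      4 * k * 2 ^ (k + 1) / (n : ℝ) ^ (k + 1) := by
    rw [div_pow]
    ring
  have e2 : (n : ℝ) * (2 * k * (4 * (2 * (2 / (n : ℝ)) ^ (k + 2)))) =
      16 * k * 2 ^ (k + 2) / (n : ℝ) ^ (k + 1) := by
    rw [div_pow]
    field_simp
    ring
  rw [e1] at s1
  rw [e2] at s2
  rw [add_div, add_div, add_div]
  rw [abs_le] at *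
  constructor <;> linarith [s1.1, s1.2, s2.1, s2.2, s3'.1, s3'.2, s4'.1, s4'.2]

end Steps

section Counting

open scoped Classical

open Equiv

variable {n : ℕ}

/-- The partners of `j` in the pairs of `E`. -/
noncomputable def pairNbrs (E : Finset (Fin n × Fin n)) (j : Fin n) : Finset (Fin n) :=
  Finset.univ.filter fun k => (j, k) ∈ E ∨ (k, j) ∈ E

lemma mem_pairNbrs {E : Finset (Fin n × Fin n)} {j k : Fin n} :
    k ∈ pairNbrs E j ↔ (j, k) ∈ E ∨ (k, j) ∈ E := by
  simp [pairNbrs]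

lemma mem_pairNbrs_comm {E : Finset (Fin n × Fin n)} {j k : Fin n} :
    k ∈ pairNbrs E j ↔ j ∈ pairNbrs E k := by
  rw [mem_pairNbrs, mem_pairNbrs, or_comm]

lemma IsStepSet.stepAdj_of_mem_pairNbrs {d : ℕ} {E : Finset (Fin n × Fin n)}
    (hE : IsStepSet d E) {j k : Fin n} (h : k ∈ pairNbrs E j) : StepAdj d j k :=
  (mem_pairNbrs.1 h).imp (fun h => hE _ h) (fun h => hE _ h)

lemma IsStepSet.card_pairNbrs_le {d : ℕ} {E : Finset (Fin n × Fin n)} (hE : IsStepSet d E)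
    (j : Fin n) : (pairNbrs E j).card ≤ 2 :=
  (Finset.card_le_card fun _ hk => mem_stepNbrs.2 (hE.stepAdj_of_mem_pairNbrs hk)).trans
    (card_stepNbrs_le d j)

lemma IsStepSet.sum_card_pairNbrs {d : ℕ} (hd : 1 ≤ d) {E : Finset (Fin n × Fin n)}
    (hE : IsStepSet d E) : ∑ j, (pairNbrs E j).card = 2 * E.card := by
  have h₁ : ∀ j, (pairNbrs E j).card =
      (∑ k, if (j, k) ∈ E then 1 else 0) + ∑ k, if (k, j) ∈ E then 1 else 0 := by
    intro j
    rw [← Finset.card_filter, ← Finset.card_filter, ← Finset.card_union_of_disjoint]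
    · congr 1
      ext k
      simp [mem_pairNbrs]
    · rw [Finset.disjoint_left]
      intro k h h'
      have := hE _ (Finset.mem_filter.1 h).2
      have := hE _ (Finset.mem_filter.1 h').2
      simp only at *
      omega
  have h₂ : ∑ j, ∑ k, (if (j, k) ∈ E then 1 else 0) = E.card := by
    rw [← Fintype.sum_prod_type' (f := fun j k => if (j, k) ∈ E then 1 else 0)]
    simp
  rw [Finset.sum_congr rfl fun j _ => h₁ j, Finset.sum_add_distrib, h₂, Finset.sum_comm, h₂]
  ring

/-- The pairs `(i, i + d)` with `i < m`. -/
noncomputable def stepPairs (n d m : ℕ) : Finset (Fin n × Fin n) :=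
  Finset.univ.filter fun e => (e.2 : ℕ) = e.1 + d ∧ (e.1 : ℕ) < m

lemma mem_stepPairs {d m : ℕ} {e : Fin n × Fin n} :
    e ∈ stepPairs n d m ↔ (e.2 : ℕ) = e.1 + d ∧ (e.1 : ℕ) < m := by
  simp [stepPairs]

lemma isStepSet_stepPairs (n d m : ℕ) : IsStepSet d (stepPairs n d m) :=
  fun _ he => (mem_stepPairs.1 he).1

lemma card_stepPairs {d m : ℕ} (h : m + d ≤ n) : (stepPairs n d m).card = m := by
  have : (stepPairs n d m).card = (Finset.range m).card := by
    refine Finset.card_bij' (fun e _ => (e.1 : ℕ))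
      (fun i hi => (⟨i, by have := Finset.mem_range.1 hi; omega⟩,
        ⟨i + d, by have := Finset.mem_range.1 hi; omega⟩)) ?_ ?_ ?_ ?_
    · intro e he
      exact Finset.mem_range.2 (mem_stepPairs.1 he).2
    · intro i hi
      exact mem_stepPairs.2 ⟨rfl, Finset.mem_range.1 hi⟩
    · intro e he
      exact Prod.ext (Fin.ext rfl) (Fin.ext (mem_stepPairs.1 he).1.symm)
    · intro i hi
      rfl
  simpa using this

lemma pairNbrs_stepPairs {d : ℕ} (j : Fin n) :
    pairNbrs (stepPairs n d (n - d)) j = stepNbrs d j := by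
  ext k
  rw [mem_pairNbrs, mem_stepNbrs, mem_stepPairs, mem_stepPairs, StepAdj]
  simp only
  omega

lemma sum_card_stepNbrs {d : ℕ} (hd : 1 ≤ d) (hn : d ≤ n) :
    ∑ s : Fin n, (stepNbrs d s).card = 2 * (n - d) := by
  rw [← card_stepPairs (n := n) (d := d) (m := n - d) (by omega),
    ← (isStepSet_stepPairs n d (n - d)).sum_card_pairNbrs hd]
  simp only [pairNbrs_stepPairs]

/-- The ordered pairs at distance exactly `d`. -/
noncomputable def adjPairs (n d : ℕ) : Finset (Fin n × Fin n) :=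
  Finset.univ.filter fun z => StepAdj d z.1 z.2

lemma mem_adjPairs {d : ℕ} {z : Fin n × Fin n} : z ∈ adjPairs n d ↔ StepAdj d z.1 z.2 := by
  simp [adjPairs]

lemma card_adjPairs {d : ℕ} (hd : 1 ≤ d) (hn : d ≤ n) :
    (adjPairs n d).card = 2 * (n - d) := by
  rw [adjPairs, Finset.card_filter, Fintype.sum_prod_type, ← sum_card_stepNbrs hd hn]
  exact Finset.sum_congr rfl fun s _ => by rw [stepNbrs, Finset.card_filter]

/-- The paths `s, r, q` with steps of length exactly `d` and `s ≠ q`. -/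
noncomputable def adjTriples (n d : ℕ) : Finset (Fin n × Fin n × Fin n) :=
  Finset.univ.filter fun z => StepAdj d z.2.1 z.1 ∧ StepAdj d z.2.1 z.2.2 ∧ z.1 ≠ z.2.2

lemma mem_adjTriples {d : ℕ} {z : Fin n × Fin n × Fin n} : z ∈ adjTriples n d ↔
    StepAdj d z.2.1 z.1 ∧ StepAdj d z.2.1 z.2.2 ∧ z.1 ≠ z.2.2 := by
  simp [adjTriples]

lemma card_adjTriples {d : ℕ} :
    (adjTriples n d).card = ∑ r : Fin n, (stepNbrs d r).card * ((stepNbrs d r).card - 1) := by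
  rw [Finset.card_eq_sum_card_fiberwise (f := fun z => z.2.1) (t := Finset.univ) (by simp)]
  refine Finset.sum_congr rfl fun r _ => ?_
  rw [Nat.mul_sub_one, ← Finset.offDiag_card]
  refine Finset.card_bij' (fun z _ => (z.1, z.2.2)) (fun z _ => (z.1, r, z.2)) ?_ ?_ ?_ ?_
  · rintro ⟨s, r', q⟩ h
    simp only [Finset.mem_filter, mem_adjTriples] at h
    obtain ⟨⟨h₁, h₂, h₃⟩, rfl⟩ := h
    exact Finset.mem_offDiag.2 ⟨mem_stepNbrs.2 h₁, mem_stepNbrs.2 h₂, h₃⟩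
  · rintro ⟨s, q⟩ h
    obtain ⟨h₁, h₂, h₃⟩ := Finset.mem_offDiag.1 h
    simp only [Finset.mem_filter, mem_adjTriples, and_true]
    exact ⟨mem_stepNbrs.1 h₁, mem_stepNbrs.1 h₂, h₃⟩
  · rintro ⟨s, r', q⟩ h
    simp only [Finset.mem_filter] at h
    simp [h.2]
  · rintro ⟨s, q⟩ _
    rfl

lemma abs_card_adjTriples_sub_le {d : ℕ} (hd : 1 ≤ d) (hn : d ≤ n) :
    |((adjTriples n d).card : ℝ) - 2 * n| ≤ 4 * d := by
  have h₁ : (adjTriples n d).card ≤ 2 * n := by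
    rw [card_adjTriples]
    refine (Finset.sum_le_card_nsmul _ _ 2 fun r _ => ?_).trans (by simp [mul_comm])
    have := card_stepNbrs_le d r
    interval_cases (stepNbrs d r).card <;> simp
  have h₂ : 2 * ∑ s : Fin n, (stepNbrs d s).card ≤ (adjTriples n d).card + 2 * n := by
    rw [card_adjTriples, show 2 * n = ∑ _r : Fin n, 2 by simp [mul_comm],
      ← Finset.sum_add_distrib, Finset.mul_sum]
    refine Finset.sum_le_sum fun r _ => ?_
    have := card_stepNbrs_le d r
    interval_cases (stepNbrs d r).card <;> simp
  rw [sum_card_stepNbrs hd hn] at h₂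
  have h₃ : 2 * n ≤ (adjTriples n d).card + 4 * d := by omega
  have h₄ : (2 * n : ℝ) ≤ (adjTriples n d).card + 4 * d := by exact_mod_cast h₃
  have h₅ : ((adjTriples n d).card : ℝ) ≤ 2 * n := by exact_mod_cast h₁
  have : (0 : ℝ) ≤ d := by positivity
  rw [abs_le]
  constructor <;> linarith

/-- The two pairs of adjacent elements are disjoint, with extremities not adjacent. -/
def GenericPairs (d : ℕ) (z : (Fin n × Fin n) × (Fin n × Fin n)) : Prop :=
  z.2.1 ≠ z.1.1 ∧ z.2.1 ≠ z.1.2 ∧ z.2.2 ≠ z.1.1 ∧ z.2.2 ≠ z.1.2 ∧ ¬ StepAdj d z.1.1 z.2.2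

lemma card_filter_not_genericPairs_le {d : ℕ} :
    ((adjPairs n d ×ˢ adjPairs n d).filter fun z => ¬ GenericPairs d z).card ≤
      (adjPairs n d).card * 12 := by
  have hsub : (adjPairs n d ×ˢ adjPairs n d).filter (fun z => ¬ GenericPairs d z) ⊆
      (adjPairs n d).biUnion fun p =>
        ((({p.1, p.2} : Finset (Fin n)).biUnion fun t => (stepNbrs d t).image fun q => (p, (t, q)))
        ∪ (({p.1, p.2} ∪ stepNbrs d p.1 : Finset (Fin n)).biUnion fun q =>
          (stepNbrs d q).image fun t => (p, (t, q)))) := by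
    rintro ⟨p, t, q⟩ hz
    obtain ⟨hz, h₃⟩ := Finset.mem_filter.1 hz
    obtain ⟨h₁, h₂⟩ := Finset.mem_product.1 hz
    rw [mem_adjPairs] at h₁ h₂
    simp only [GenericPairs] at h₃
    simp only [Finset.mem_biUnion, Finset.mem_union, Finset.mem_image, Finset.mem_insert,
      Finset.mem_singleton, mem_adjPairs, mem_stepNbrs]
    refine ⟨p, h₁, ?_⟩
    by_cases ht : t = p.1 ∨ t = p.2
    · exact Or.inl ⟨t, ht, q, h₂, rfl⟩
    · refine Or.inr ⟨q, ?_, t, h₂.symm, rfl⟩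
      by_contra hc
      exact h₃ ⟨fun h => ht (Or.inl h), fun h => ht (Or.inr h), fun h => hc (Or.inl (Or.inl h)),
        fun h => hc (Or.inl (Or.inr h)), fun h => hc (Or.inr h)⟩
  refine (Finset.card_le_card hsub).trans (Finset.card_biUnion_le_card_mul _ _ _ fun p _ => ?_)
  have hc2 : ({p.1, p.2} : Finset (Fin n)).card ≤ 2 := Finset.card_le_two
  have hc4 : ({p.1, p.2} ∪ stepNbrs d p.1 : Finset (Fin n)).card ≤ 4 :=
    (Finset.card_union_le _ _).trans (by have := card_stepNbrs_le d p.1; omega)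
  refine (Finset.card_union_le _ _).trans ((add_le_add
    (Finset.card_biUnion_le_card_mul _ _ 2 fun t _ => Finset.card_image_le.trans
      (card_stepNbrs_le d t))
    (Finset.card_biUnion_le_card_mul _ _ 2 fun t _ => Finset.card_image_le.trans
      (card_stepNbrs_le d t))).trans ?_)
  omega

/-- A union of the events of `exists_abs_permProb_sendsTo_avoids_sub_le`. -/
lemma exists_abs_permProb_mem_avoids_sub_le (k : ℕ) : ∃ C : ℝ, 0 ≤ C ∧
    ∀ n d : ℕ, 1 ≤ d → 2 * (k + 2) ≤ n → ∀ E₀ E₁ : Finset (Fin n × Fin n), IsStepSet d E₀ →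
    E₁ ⊆ E₀ → ∀ x : Fin k → Fin n, Function.Injective x →
    (∀ e ∈ E₀, e ∉ E₁ → ∃ i, e.1 = x i ∨ e.2 = x i) →
    ∀ (ι : Type) (Q : Finset ι) (y : ι → Fin k → Fin n) (f : Perm (Fin n) → ι),
    (∀ t ∈ Q, Function.Injective (y t)) →
    (∀ t ∈ Q, ∀ e ∈ E₁, ∀ i j, e.1 = x i → e.2 = x j → ¬ StepAdj d (y t i) (y t j)) →
    (∀ t ∈ Q, ∀ π, f π = t ↔ SendsTo x (y t) π) →
    |permProb (fun π => f π ∈ Q ∧ Avoids d E₁ π) -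
      Q.card * permProb (Avoids d E₀) / (n : ℝ) ^ k| ≤ Q.card * C / (n : ℝ) ^ (k + 1) := by
  obtain ⟨C, hC, h⟩ := exists_abs_permProb_sendsTo_avoids_sub_le k
  refine ⟨C, hC, ?_⟩
  intro n d hd hn E₀ E₁ hE₀ hE x hx hout ι Q y f hy hin hf
  have hfib : permProb (fun π => f π ∈ Q ∧ Avoids d E₁ π) =
      ∑ t ∈ Q, permProb (fun π => SendsTo x (y t) π ∧ Avoids d E₁ π) := by
    rw [permProb_eq_sum_fiber Q f _ fun π hπ => hπ.1]
    refine Finset.sum_congr rfl fun t ht => permProb_congr fun π => ?_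
    rw [← hf t ht]
    constructor
    · rintro ⟨h₁, -, h₂⟩
      exact ⟨h₁, h₂⟩
    · rintro ⟨h₁, h₂⟩
      exact ⟨h₁, h₁ ▸ ht, h₂⟩
  rw [hfib, mul_div_assoc, mul_div_assoc, ← nsmul_eq_mul, ← nsmul_eq_mul, ← Finset.sum_const,
    ← Finset.sum_sub_distrib]
  exact (Finset.abs_sum_le_sum_abs _ _).trans (Finset.sum_le_card_nsmul _ _ _ fun t ht =>
    h n d hd hn E₀ E₁ hE₀ hE x (y t) hx (hy t ht) hout (hin t ht))

end Counting

section Recursion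

open scoped Classical

open Equiv

variable {n : ℕ}

/-- The pairs of `E` not involving `j`. -/
noncomputable def pairsOff (E : Finset (Fin n × Fin n)) (j : Fin n) : Finset (Fin n × Fin n) :=
  E.filter fun e => e.1 ≠ j ∧ e.2 ≠ j

lemma pairsOff_subset (E : Finset (Fin n × Fin n)) (j : Fin n) : pairsOff E j ⊆ E :=
  Finset.filter_subset _ _

lemma avoids_iff_pairsOff {d : ℕ} {E : Finset (Fin n × Fin n)} (j : Fin n) (π : Perm (Fin n)) :
    Avoids d E π ↔ Avoids d (pairsOff E j) π ∧ ¬ ∃ k ∈ pairNbrs E j, StepAdj d (π j) (π k) := by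
  constructor
  · refine fun h => ⟨h.mono (pairsOff_subset E j), ?_⟩
    rintro ⟨k, hk, hadj⟩
    rcases mem_pairNbrs.1 hk with hk | hk
    · exact h _ hk hadj
    · exact h _ hk hadj.symm
  · rintro ⟨h₁, h₂⟩ e he hadj
    by_cases hej : e.1 ≠ j ∧ e.2 ≠ j
    · exact h₁ e (Finset.mem_filter.2 ⟨he, hej⟩) hadj
    · by_cases hj : e.1 = j
      · exact h₂ ⟨e.2, mem_pairNbrs.2 (Or.inl (hj ▸ he)), hj ▸ hadj⟩
      · have hj' : e.2 = j := by tauto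
        exact h₂ ⟨e.1, mem_pairNbrs.2 (Or.inr (hj' ▸ he)), hj' ▸ hadj.symm⟩

lemma ne_of_pairNbrs_eq_empty {E : Finset (Fin n × Fin n)} {b : Fin n} (hb : pairNbrs E b = ∅)
    {e : Fin n × Fin n} (he : e ∈ E) : e.1 ≠ b ∧ e.2 ≠ b := by
  constructor
  · rintro rfl
    have : e.2 ∈ pairNbrs E e.1 := mem_pairNbrs.2 (Or.inl he)
    simp [hb] at this
  · rintro rfl
    have : e.1 ∈ pairNbrs E e.2 := mem_pairNbrs.2 (Or.inr he)
    simp [hb] at this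

/-- Swapping the image of a point `b` not involved in `E` with that of `j` affects only the pairs
of `E` involving `j`. -/
lemma avoids_mul_swap_iff {d : ℕ} (hd : 1 ≤ d) {E : Finset (Fin n × Fin n)} (hE : IsStepSet d E)
    {b : Fin n} (hb : pairNbrs E b = ∅) (j : Fin n) (π : Perm (Fin n)) :
    Avoids d E (π * swap b j) ↔
      Avoids d (pairsOff E j) π ∧ ¬ ∃ k ∈ pairNbrs E j, StepAdj d (π b) (π k) := by
  rw [avoids_iff_pairsOff j]
  refine and_congr (forall₂_congr fun e he => ?_) (not_congr (exists_congr fun k =>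
    and_congr_right fun hk => ?_))
  · obtain ⟨he, h₁, h₂⟩ := Finset.mem_filter.1 he
    rw [Perm.mul_apply, Perm.mul_apply,
      swap_apply_of_ne_of_ne (ne_of_pairNbrs_eq_empty hb he).1 h₁,
      swap_apply_of_ne_of_ne (ne_of_pairNbrs_eq_empty hb he).2 h₂]
  · have h₁ : k ≠ j := ((hE.stepAdj_of_mem_pairNbrs hk).ne hd).symm
    have h₂ : k ≠ b := by
      rcases mem_pairNbrs.1 hk with hk | hk
      · exact (ne_of_pairNbrs_eq_empty hb hk).2
      · exact (ne_of_pairNbrs_eq_empty hb hk).1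
    rw [Perm.mul_apply, Perm.mul_apply, swap_apply_right, swap_apply_of_ne_of_ne h₂ h₁]

/-- The probability that `π` violates the constraint at the pair `(a, b)` only, computed by
resampling the image of `b`. -/
lemma sub_one_mul_permProb_eq {d : ℕ} (hd : 1 ≤ d) {E : Finset (Fin n × Fin n)}
    (hE : IsStepSet d E) {a b : Fin n} (hab : a ≠ b) (hb : pairNbrs E b = ∅) :
    ((n : ℝ) - 1) * permProb (fun π => Avoids d E π ∧ StepAdj d (π a) (π b)) =
      ∑ s : Fin n, (stepNbrs d s).card * permProb (fun π => π a = s ∧ Avoids d E π) +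
      ∑ j ∈ Finset.univ.erase a,
        (permProb (fun π => (StepAdj d (π a) (π j) ∧ Avoids d (pairsOff E j) π) ∧
            ∃ k ∈ pairNbrs E j, StepAdj d (π j) (π k)) -
          permProb (fun π => (StepAdj d (π a) (π j) ∧ Avoids d (pairsOff E j) π) ∧
            ∃ k ∈ pairNbrs E j, StepAdj d (π b) (π k))) := by
  have h₁ : ∑ s : Fin n, (stepNbrs d s).card * permProb (fun π => π a = s ∧ Avoids d E π) =
      ∑ j ∈ Finset.univ.erase a, permProb (fun π => StepAdj d (π a) (π j) ∧ Avoids d E π) := by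
    rw [Finset.sum_erase (f := fun j => permProb fun π => StepAdj d (π a) (π j) ∧ Avoids d E π) _
      (permProb_eq_zero fun π h => h.1.ne hd rfl)]
    have h : ∀ j, permProb (fun π => StepAdj d (π a) (π j) ∧ Avoids d E π) =
        ∑ s, ∑ r ∈ stepNbrs d s, permProb (fun π => π.symm r = j ∧ π a = s ∧ Avoids d E π) := by
      intro j
      rw [permProb_eq_sum_fiber Finset.univ (fun π => π a) _ (by simp)]
      refine Finset.sum_congr rfl fun s _ => ?_
      rw [permProb_eq_sum_fiber (stepNbrs d s) (fun π => π j)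
        (fun π => π a = s ∧ StepAdj d (π a) (π j) ∧ Avoids d E π)
        (fun π hπ => mem_stepNbrs.2 (hπ.1 ▸ hπ.2.1))]
      refine Finset.sum_congr rfl fun r hr => permProb_congr fun π => ?_
      rw [Equiv.symm_apply_eq]
      constructor
      · rintro ⟨rfl, rfl, -, h⟩
        exact ⟨rfl, rfl, h⟩
      · rintro ⟨rfl, rfl, h⟩
        exact ⟨rfl, rfl, mem_stepNbrs.1 hr, h⟩
    rw [Finset.sum_congr rfl fun j _ => h j, Finset.sum_comm]
    refine Finset.sum_congr rfl fun s _ => ?_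
    rw [Finset.sum_comm, ← nsmul_eq_mul, ← Finset.sum_const]
    refine Finset.sum_congr rfl fun r _ => ?_
    exact permProb_eq_sum_fiber Finset.univ (fun π => π.symm r) _ (by simp)
  have h₂ : ∀ j ∈ Finset.univ.erase a,
      permProb (fun π => Avoids d E π ∧ StepAdj d (π a) (π b)) =
      permProb (fun π => StepAdj d (π a) (π j) ∧ Avoids d E π) +
        (permProb (fun π => (StepAdj d (π a) (π j) ∧ Avoids d (pairsOff E j) π) ∧
            ∃ k ∈ pairNbrs E j, StepAdj d (π j) (π k)) -
          permProb (fun π => (StepAdj d (π a) (π j) ∧ Avoids d (pairsOff E j) π) ∧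
            ∃ k ∈ pairNbrs E j, StepAdj d (π b) (π k))) := by
    intro j hj
    have hja : j ≠ a := (Finset.mem_erase.1 hj).1
    rw [← permProb_mul_right (swap b j)]
    have e₁ := permProb_split (fun π => StepAdj d (π a) (π j) ∧ Avoids d (pairsOff E j) π)
      fun π => ∃ k ∈ pairNbrs E j, StepAdj d (π j) (π k)
    have e₂ := permProb_split (fun π => StepAdj d (π a) (π j) ∧ Avoids d (pairsOff E j) π)
      fun π => ∃ k ∈ pairNbrs E j, StepAdj d (π b) (π k)
    have e₃ : permProb (fun π => Avoids d E (π * swap b j) ∧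
        StepAdj d ((π * swap b j) a) ((π * swap b j) b)) =
        permProb (fun π => (StepAdj d (π a) (π j) ∧ Avoids d (pairsOff E j) π) ∧
          ¬ ∃ k ∈ pairNbrs E j, StepAdj d (π b) (π k)) := by
      refine permProb_congr fun π => ?_
      rw [avoids_mul_swap_iff hd hE hb, Perm.mul_apply, Perm.mul_apply, swap_apply_left,
        swap_apply_of_ne_of_ne hab hja.symm]
      tauto
    have e₄ : permProb (fun π => StepAdj d (π a) (π j) ∧ Avoids d E π) =
        permProb (fun π => (StepAdj d (π a) (π j) ∧ Avoids d (pairsOff E j) π) ∧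
          ¬ ∃ k ∈ pairNbrs E j, StepAdj d (π j) (π k)) := by
      refine permProb_congr fun π => ?_
      rw [avoids_iff_pairsOff j]
      tauto
    linarith
  rw [h₁, ← Finset.sum_add_distrib, ← Finset.sum_congr rfl h₂, Finset.sum_const,
    Finset.card_erase_of_mem (Finset.mem_univ a), Finset.card_univ, Fintype.card_fin,
    nsmul_eq_mul, Nat.cast_sub (by have := a.2; omega), Nat.cast_one]

/-- First order term of the recursion. -/
lemma exists_abs_sum_card_stepNbrs_mul_sub_le (d : ℕ) (hd : 1 ≤ d) : ∃ C : ℝ, 0 ≤ C ∧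
    ∀ n : ℕ, 10 ≤ n → d ≤ n → ∀ E : Finset (Fin n × Fin n), IsStepSet d E → ∀ a : Fin n,
    |∑ s : Fin n, (stepNbrs d s).card * permProb (fun π => π a = s ∧ Avoids d E π) -
      (2 - 2 * d / n) * permProb (Avoids d E)| ≤ C / (n : ℝ) ^ 2 := by
  obtain ⟨C, hC, h⟩ := exists_abs_permProb_sendsTo_avoids_sub_le 1
  refine ⟨2 * d * C, by positivity, ?_⟩
  intro n hn hdn E hE a
  have hn0 : (0 : ℝ) < n := by exact_mod_cast (by omega : 0 < n)
  have hs : ∀ s : Fin n, |permProb (fun π => π a = s ∧ Avoids d E π) - permProb (Avoids d E) / n|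
      ≤ C / (n : ℝ) ^ 2 := by
    intro s
    have := h n d hd (by omega) E E hE subset_rfl ![a] ![s] (Function.injective_of_subsingleton _)
      (Function.injective_of_subsingleton _) (fun e he he' => absurd he he') (by
        intro e _ i j _ _ hadj
        exact hadj.ne hd (by rw [Subsingleton.elim i j]))
    simpa [SendsTo, Fin.forall_fin_one] using this
  set p := permProb (Avoids d E)
  have hp : p = ∑ s : Fin n, permProb (fun π => π a = s ∧ Avoids d E π) :=
    permProb_eq_sum_fiber Finset.univ (fun π => π a) _ (by simp)
  have hcard : ∑ s : Fin n, ((2 : ℝ) - (stepNbrs d s).card) = 2 * d := by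
    have := sum_card_stepNbrs (n := n) hd hdn
    have h' : ∑ s : Fin n, ((stepNbrs d s).card : ℝ) = 2 * (n - d) := by
      rw [← Nat.cast_sub hdn]
      exact_mod_cast this
    rw [Finset.sum_sub_distrib, h']
    simp
    ring
  have key : ∑ s : Fin n, (stepNbrs d s).card * permProb (fun π => π a = s ∧ Avoids d E π) -
      (2 - 2 * d / n) * p = - ∑ s : Fin n, ((2 : ℝ) - (stepNbrs d s).card) *
        (permProb (fun π => π a = s ∧ Avoids d E π) - p / n) := by
    simp only [mul_sub, sub_mul, Finset.sum_sub_distrib]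
    rw [← Finset.mul_sum, ← hp]
    have : ∑ s : Fin n, ((2 : ℝ) * (p / n)) - ∑ s : Fin n, ((stepNbrs d s).card : ℝ) * (p / n) =
        2 * d * (p / n) := by
      rw [← hcard, Finset.sum_mul, ← Finset.sum_sub_distrib]
      simp only [sub_mul]
    rw [this]
    ring
  rw [key, abs_neg, mul_div_assoc, ← hcard, Finset.sum_mul]
  refine (Finset.abs_sum_le_sum_abs _ _).trans (Finset.sum_le_sum fun s _ => ?_)
  have h0 : (0 : ℝ) ≤ 2 - (stepNbrs d s).card := by
    have : ((stepNbrs d s).card : ℝ) ≤ 2 := by exact_mod_cast card_stepNbrs_le d s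
    linarith
  rw [abs_mul, abs_of_nonneg h0]
  exact mul_le_mul_of_nonneg_left (hs s) h0

end Recursion

section Resampling

open scoped Classical

open Equiv

variable {n : ℕ}

lemma exists_eq_or_of_notMem_pairsOff {k : ℕ} {E : Finset (Fin n × Fin n)} {x : Fin k → Fin n}
    {i : Fin k} {e : Fin n × Fin n} (he : e ∈ E) (he' : e ∉ pairsOff E (x i)) :
    ∃ i, e.1 = x i ∨ e.2 = x i := by
  refine ⟨i, ?_⟩
  by_contra! h
  exact he' (Finset.mem_filter.2 ⟨he, h⟩)

lemma fst_ne_of_mem_pairsOff {E : Finset (Fin n × Fin n)} {j : Fin n} {e : Fin n × Fin n}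
    (he : e ∈ pairsOff E j) : e.1 ≠ j ∧ e.2 ≠ j :=
  (Finset.mem_filter.1 he).2

/-- Two consecutive adjacencies `π a, π j, π k`. -/
lemma exists_abs_permProb_path_sub_le (d : ℕ) (hd : 1 ≤ d) : ∃ C : ℝ, 0 ≤ C ∧
    ∀ n : ℕ, 12 ≤ n → d ≤ n → ∀ E : Finset (Fin n × Fin n), IsStepSet d E → ∀ a j k : Fin n,
    j ≠ a → a ∉ pairNbrs E j → k ∈ pairNbrs E j →
    |permProb (fun π => (StepAdj d (π a) (π j) ∧ Avoids d (pairsOff E j) π) ∧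
      StepAdj d (π j) (π k)) - 2 * permProb (Avoids d E) / (n : ℝ) ^ 2| ≤ C / (n : ℝ) ^ 3 := by
  obtain ⟨C, hC, h⟩ := exists_abs_permProb_mem_avoids_sub_le 3
  refine ⟨6 * C + 4 * d, by positivity, ?_⟩
  intro n hn hdn E hE a j k hja ha hk
  have hn0 : (0 : ℝ) < n := by exact_mod_cast (by omega : 0 < n)
  have hjk : j ≠ k := (hE.stepAdj_of_mem_pairNbrs hk).ne hd
  have hak : a ≠ k := fun h => ha (h ▸ hk)
  have main := h n d hd (by omega) E (pairsOff E j) hE (pairsOff_subset E j) ![a, j, k]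
    (by
      intro u v
      fin_cases u <;> fin_cases v <;> simp [hja, hja.symm, hjk, hjk.symm, hak, hak.symm])
    (fun e he he' => exists_eq_or_of_notMem_pairsOff (i := 1) he he')
    (Fin n × Fin n × Fin n) (adjTriples n d) (fun z => ![z.1, z.2.1, z.2.2])
    (fun π => (π a, π j, π k))
    (by
      rintro ⟨s, r, q⟩ hz
      obtain ⟨h₁, h₂, h₃⟩ := mem_adjTriples.1 hz
      have h₁ := h₁.ne hd
      have h₂ := h₂.ne hd
      simp only at h₁ h₂ h₃
      intro u v
      fin_cases u <;> fin_cases v <;> simp [h₁, h₁.symm, h₂, h₂.symm, h₃, h₃.symm])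
    (by
      rintro ⟨s, r, q⟩ hz e he u v hu hv hadj
      obtain ⟨h₁, h₂, h₃⟩ := mem_adjTriples.1 hz
      obtain ⟨e₁, e₂⟩ := fst_ne_of_mem_pairsOff he
      have h₄ := h₁.symm.not_triangle hd h₂
      have h₅ : ∀ w : Fin n, ¬ StepAdj d w w := fun w hw => hw.ne hd rfl
      rw [hu] at e₁
      rw [hv] at e₂
      fin_cases u <;> fin_cases v <;> simp at e₁ e₂ hadj
      · exact h₅ _ hadj
      · exact h₄ hadj
      · exact h₄ hadj.symm
      · exact h₅ _ hadj)
    (by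
      rintro ⟨s, r, q⟩ hz π
      simp [SendsTo, Fin.forall_fin_succ])
  have hev : permProb (fun π => (StepAdj d (π a) (π j) ∧ Avoids d (pairsOff E j) π) ∧
      StepAdj d (π j) (π k)) = permProb (fun π => (π a, π j, π k) ∈ adjTriples n d ∧
        Avoids d (pairsOff E j) π) := by
    refine permProb_congr fun π => ?_
    rw [mem_adjTriples]
    have : π a ≠ π k := fun h => hak (π.injective h)
    constructor
    · rintro ⟨⟨h₁, h₂⟩, h₃⟩
      exact ⟨⟨h₁.symm, h₃, this⟩, h₂⟩
    · rintro ⟨⟨h₁, h₃, -⟩, h₂⟩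
      exact ⟨⟨h₁.symm, h₂⟩, h₃⟩
  rw [hev]
  have hcard := abs_card_adjTriples_sub_le hd hdn
  set p := permProb (Avoids d E)
  have hp0 : 0 ≤ p := permProb_nonneg _
  have hp1 : p ≤ 1 := permProb_le_one _
  have hdn' : (d : ℝ) ≤ n := by exact_mod_cast hdn
  have hT : ((adjTriples n d).card : ℝ) ≤ 6 * n := by
    have := (abs_le.1 hcard).2
    linarith
  have e₁ : (adjTriples n d).card * C / (n : ℝ) ^ (3 + 1) ≤ 6 * C / (n : ℝ) ^ 3 := by
    rw [div_le_div_iff₀ (by positivity) (by positivity)]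
    calc (adjTriples n d).card * C * (n : ℝ) ^ 3 ≤ 6 * n * C * (n : ℝ) ^ 3 := by gcongr
      _ = _ := by ring
  have e₂ : |(adjTriples n d).card * p / (n : ℝ) ^ 3 - 2 * p / (n : ℝ) ^ 2| ≤
      4 * d / (n : ℝ) ^ 3 := by
    rw [show (adjTriples n d).card * p / (n : ℝ) ^ 3 - 2 * p / (n : ℝ) ^ 2 =
      ((adjTriples n d).card - 2 * n) * p / (n : ℝ) ^ 3 by field_simp, abs_div, abs_mul,
      abs_of_nonneg hp0, abs_of_pos (by positivity : (0 : ℝ) < (n : ℝ) ^ 3)]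
    refine div_le_div_of_nonneg_right ?_ (by positivity)
    exact (mul_le_of_le_one_right (abs_nonneg _) hp1).trans hcard
  refine (abs_sub_le _ _ _).trans ((add_le_add (main.trans e₁) e₂).trans_eq (by ring))

lemma abs_permProb_exists_path_sub_le {d : ℕ} {E : Finset (Fin n × Fin n)} {a j : Fin n}
    (ha : a ∉ pairNbrs E j) {p B : ℝ}
    (h : ∀ k ∈ pairNbrs E j,
      |permProb (fun π => (StepAdj d (π a) (π j) ∧ Avoids d (pairsOff E j) π) ∧
        StepAdj d (π j) (π k)) - p| ≤ B) :
    |permProb (fun π => (StepAdj d (π a) (π j) ∧ Avoids d (pairsOff E j) π) ∧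
      ∃ k ∈ pairNbrs E j, StepAdj d (π j) (π k)) - (pairNbrs E j).card * p| ≤
      (pairNbrs E j).card * B := by
  have h₁ := abs_permProb_exists_sub_sum_le (pairNbrs E j)
    (fun π => StepAdj d (π a) (π j) ∧ Avoids d (pairsOff E j) π)
    (fun k π => StepAdj d (π j) (π k))
  have h₂ : ∑ k ∈ pairNbrs E j, ∑ l ∈ (pairNbrs E j).erase k,
      permProb (fun π => (StepAdj d (π a) (π j) ∧ Avoids d (pairsOff E j) π) ∧
        StepAdj d (π j) (π k) ∧ StepAdj d (π j) (π l)) = 0 := by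
    refine Finset.sum_eq_zero fun k hk => Finset.sum_eq_zero fun l hl => permProb_eq_zero ?_
    rintro π ⟨⟨h₁, -⟩, h₂, h₃⟩
    obtain ⟨hlk, hl⟩ := Finset.mem_erase.1 hl
    have hne : ∀ k ∈ pairNbrs E j, π a ≠ π k := by
      intro k hk he
      exact ha (π.injective he ▸ hk)
    exact hlk (π.injective (h₁.symm.eq_of_ne h₂ h₃ (hne k hk) (hne l hl))).symm
  rw [h₂] at h₁
  have h₃ := sub_eq_zero.1 (abs_nonpos_iff.1 h₁)
  rw [h₃, ← nsmul_eq_mul, ← nsmul_eq_mul, ← Finset.sum_const, ← Finset.sum_sub_distrib]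
  exact (Finset.abs_sum_le_sum_abs _ _).trans (Finset.sum_le_card_nsmul _ _ _ h)

/-- Two disjoint adjacencies `π a, π j` and `π b, π k`. -/
lemma exists_abs_permProb_pairs_sub_le (d : ℕ) (hd : 1 ≤ d) : ∃ C : ℝ, 0 ≤ C ∧
    ∀ n : ℕ, 12 ≤ n → d ≤ n → ∀ E : Finset (Fin n × Fin n), IsStepSet d E → ∀ a b j k : Fin n,
    a ≠ b → pairNbrs E b = ∅ → j ≠ a → a ∉ pairNbrs E j → k ∈ pairNbrs E j →
    |permProb (fun π => (StepAdj d (π a) (π j) ∧ Avoids d (pairsOff E j) π) ∧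
      StepAdj d (π b) (π k)) - 4 * permProb (Avoids d E) / (n : ℝ) ^ 2| ≤ C / (n : ℝ) ^ 3 := by
  obtain ⟨C, hC, h⟩ := exists_abs_permProb_mem_avoids_sub_le 4
  refine ⟨4 * C + (8 * d + 24) + 384, by positivity, ?_⟩
  intro n hn hdn E hE a b j k hab hb hja ha hk
  have hn0 : (0 : ℝ) < n := by exact_mod_cast (by omega : 0 < n)
  have hjk : j ≠ k := (hE.stepAdj_of_mem_pairNbrs hk).ne hd
  have hak : a ≠ k := fun h => ha (h ▸ hk)
  have hbj : b ≠ j := by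
    rintro rfl
    simp [hb] at hk
  have hbk : b ≠ k := by
    rintro rfl
    rw [mem_pairNbrs_comm] at hk
    simp [hb] at hk
  have hx : Function.Injective ![a, j, b, k] := by
    intro u v
    fin_cases u <;> fin_cases v <;>
      simp [hja, hja.symm, hjk, hjk.symm, hak, hak.symm, hab, hab.symm, hbj, hbj.symm, hbk,
        hbk.symm]
  set Q := (adjPairs n d ×ˢ adjPairs n d).filter (GenericPairs d) with hQ
  set R := (adjPairs n d ×ˢ adjPairs n d).filter (fun z => ¬ GenericPairs d z) with hR
  have main := h n d hd (by omega) E (pairsOff E j) hE (pairsOff_subset E j) ![a, j, b, k] hx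
    (fun e he he' => exists_eq_or_of_notMem_pairsOff (i := 1) he he')
    ((Fin n × Fin n) × (Fin n × Fin n)) Q (fun z => ![z.1.1, z.1.2, z.2.1, z.2.2])
    (fun π => ((π a, π j), (π b, π k)))
    (by
      rintro ⟨⟨s, r⟩, ⟨t, q⟩⟩ hz
      obtain ⟨hz, h₁, h₂, h₃, h₄, -⟩ := Finset.mem_filter.1 hz
      have h₅ := (mem_adjPairs.1 (Finset.mem_product.1 hz).1).ne hd
      have h₆ := (mem_adjPairs.1 (Finset.mem_product.1 hz).2).ne hd
      simp only at h₁ h₂ h₃ h₄ h₅ h₆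
      intro u v
      fin_cases u <;> fin_cases v <;>
        simp [h₁, h₁.symm, h₂, h₂.symm, h₃, h₃.symm, h₄, h₄.symm, h₅, h₅.symm, h₆, h₆.symm])
    (by
      rintro ⟨⟨s, r⟩, ⟨t, q⟩⟩ hz e he u v hu hv hadj
      obtain ⟨hz, -, -, -, -, h₄⟩ := Finset.mem_filter.1 hz
      obtain ⟨e₁, e₂⟩ := fst_ne_of_mem_pairsOff he
      obtain ⟨e₃, e₄⟩ := ne_of_pairNbrs_eq_empty hb (pairsOff_subset E j he)
      have h₅ : ∀ w : Fin n, ¬ StepAdj d w w := fun w hw => hw.ne hd rfl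
      rw [hu] at e₁ e₃
      rw [hv] at e₂ e₄
      fin_cases u <;> fin_cases v <;> simp at e₁ e₂ e₃ e₄ hadj
      · exact h₅ _ hadj
      · exact h₄ hadj
      · exact h₄ hadj.symm
      · exact h₅ _ hadj)
    (by
      rintro ⟨⟨s, r⟩, ⟨t, q⟩⟩ hz π
      simp [SendsTo, Fin.forall_fin_succ, and_assoc])
  have hmem : ∀ π : Perm (Fin n), ((π a, π j), (π b, π k)) ∈ adjPairs n d ×ˢ adjPairs n d ↔
      StepAdj d (π a) (π j) ∧ StepAdj d (π b) (π k) := by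
    intro π
    rw [Finset.mem_product, mem_adjPairs, mem_adjPairs]
  have hev := permProb_split (fun π => (StepAdj d (π a) (π j) ∧ Avoids d (pairsOff E j) π) ∧
      StepAdj d (π b) (π k)) fun π => GenericPairs d ((π a, π j), (π b, π k))
  have hev₁ : permProb (fun π => ((StepAdj d (π a) (π j) ∧ Avoids d (pairsOff E j) π) ∧
      StepAdj d (π b) (π k)) ∧ GenericPairs d ((π a, π j), (π b, π k))) =
      permProb (fun π => ((π a, π j), (π b, π k)) ∈ Q ∧ Avoids d (pairsOff E j) π) := by
    refine permProb_congr fun π => ?_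
    rw [hQ, Finset.mem_filter, hmem]
    tauto
  have hcard := card_adjPairs hd hdn
  have hRcard : (R.card : ℝ) ≤ 24 * n := by
    have h₁ : R.card ≤ (adjPairs n d).card * 12 := by
      rw [hR]
      convert card_filter_not_genericPairs_le (n := n) (d := d)
    rw [hcard] at h₁
    exact_mod_cast (by omega : R.card ≤ 24 * n)
  have hev₂ : permProb (fun π => ((StepAdj d (π a) (π j) ∧ Avoids d (pairsOff E j) π) ∧
      StepAdj d (π b) (π k)) ∧ ¬ GenericPairs d ((π a, π j), (π b, π k))) ≤
      384 / (n : ℝ) ^ 3 := by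
    calc _ ≤ permProb (fun π => ∃ z ∈ R, SendsTo ![a, j, b, k]
          ![z.1.1, z.1.2, z.2.1, z.2.2] π) := by
          refine permProb_mono fun π hπ => ⟨((π a, π j), (π b, π k)), ?_, ?_⟩
          · rw [hR, Finset.mem_filter, hmem]
            tauto
          · simp [SendsTo, Fin.forall_fin_succ]
      _ ≤ 24 * n * (2 / (n : ℝ)) ^ 4 :=
          permProb_exists_le_card_mul _ _ hRcard (by positivity) fun z _ =>
            permProb_sendsTo_le hx _ (by omega)
      _ = _ := by
          field_simp
          norm_num
  have hsum : (Q.card : ℝ) + R.card = (2 * ((n : ℝ) - d)) ^ 2 := by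
    have h₁ := Finset.card_filter_add_card_filter_not (s := adjPairs n d ×ˢ adjPairs n d)
      (GenericPairs d)
    rw [Finset.card_product, hcard] at h₁
    rw [← Nat.cast_sub hdn, sq]
    exact_mod_cast h₁
  set p := permProb (Avoids d E)
  have hp0 : 0 ≤ p := permProb_nonneg _
  have hp1 : p ≤ 1 := permProb_le_one _
  have hdn' : (d : ℝ) ≤ n := by exact_mod_cast hdn
  have hd0 : (0 : ℝ) ≤ d := by positivity
  have hR0 : (0 : ℝ) ≤ R.card := by positivity
  have hQ' : |(Q.card : ℝ) - 4 * (n : ℝ) ^ 2| ≤ (8 * d + 24) * (n : ℝ) := by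
    rw [abs_le]
    constructor <;> nlinarith
  have hQ'' : (Q.card : ℝ) ≤ 4 * (n : ℝ) ^ 2 := by nlinarith
  have e₁ : Q.card * C / (n : ℝ) ^ (4 + 1) ≤ 4 * C / (n : ℝ) ^ 3 := by
    rw [div_le_div_iff₀ (by positivity) (by positivity)]
    calc Q.card * C * (n : ℝ) ^ 3 ≤ 4 * n ^ 2 * C * (n : ℝ) ^ 3 := by gcongr
      _ = _ := by ring
  have e₂ : |Q.card * p / (n : ℝ) ^ 4 - 4 * p / (n : ℝ) ^ 2| ≤ (8 * d + 24) / (n : ℝ) ^ 3 := by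
    rw [show Q.card * p / (n : ℝ) ^ 4 - 4 * p / (n : ℝ) ^ 2 =
      (Q.card - 4 * n ^ 2) * p / (n : ℝ) ^ 4 by field_simp, abs_div, abs_mul,
      abs_of_nonneg hp0, abs_of_pos (by positivity : (0 : ℝ) < (n : ℝ) ^ 4),
      div_le_div_iff₀ (by positivity) (by positivity)]
    calc _ ≤ (8 * d + 24) * (n : ℝ) * (n : ℝ) ^ 3 :=
          mul_le_mul_of_nonneg_right ((mul_le_of_le_one_right (abs_nonneg _) hp1).trans hQ')
            (by positivity)
      _ = _ := by ring
  have h₀ := permProb_nonneg (fun π => ((StepAdj d (π a) (π j) ∧ Avoids d (pairsOff E j) π) ∧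
      StepAdj d (π b) (π k)) ∧ ¬ GenericPairs d ((π a, π j), (π b, π k)))
  rw [hev, hev₁, add_div, add_div]
  have h₁ := main.trans e₁
  rw [abs_le] at h₁ e₂ ⊢
  constructor <;> linarith [h₁.1, h₁.2, e₂.1, e₂.2]

lemma permProb_pairs_and_le {d : ℕ} (hn : 12 ≤ n) {a b j k l : Fin n}
    (hx : Function.Injective ![a, j, b, k, l]) :
    permProb (fun π => StepAdj d (π a) (π j) ∧ StepAdj d (π b) (π k) ∧ StepAdj d (π b) (π l)) ≤
      256 / (n : ℝ) ^ 3 := by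
  have hn0 : (0 : ℝ) < n := by exact_mod_cast (by omega : 0 < n)
  have hc : ∀ s : Fin n, ((stepNbrs d s).card : ℝ) ≤ 2 := fun s => by
    exact_mod_cast card_stepNbrs_le d s
  calc _ ≤ permProb (fun π => ∃ s ∈ Finset.univ, ∃ r ∈ stepNbrs d s, ∃ t ∈ Finset.univ,
        ∃ q ∈ stepNbrs d t, ∃ q' ∈ stepNbrs d t, SendsTo ![a, j, b, k, l] ![s, r, t, q, q'] π) :=
        permProb_mono fun π hπ => ⟨π a, Finset.mem_univ _, π j, mem_stepNbrs.2 hπ.1, π b,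
          Finset.mem_univ _, π k, mem_stepNbrs.2 hπ.2.1, π l, mem_stepNbrs.2 hπ.2.2, by
            simp [SendsTo, Fin.forall_fin_succ]⟩
    _ ≤ n * (2 * (n * (2 * (2 * (2 / (n : ℝ)) ^ 5)))) :=
        permProb_exists_le_card_mul _ _ (by simp) (by positivity) fun s _ =>
        permProb_exists_le_card_mul _ _ (hc s) (by positivity) fun r _ =>
        permProb_exists_le_card_mul _ _ (by simp) (by positivity) fun t _ =>
        permProb_exists_le_card_mul _ _ (hc t) (by positivity) fun q _ =>
        permProb_exists_le_card_mul _ _ (hc t) (by positivity) fun q' _ =>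
        permProb_sendsTo_le hx _ (by omega)
    _ = _ := by
        field_simp
        norm_num

lemma abs_permProb_exists_pairs_sub_le {d : ℕ} (hd : 1 ≤ d) (hn : 12 ≤ n)
    {E : Finset (Fin n × Fin n)} (hE : IsStepSet d E) {a b j : Fin n} (hab : a ≠ b)
    (hb : pairNbrs E b = ∅) (hja : j ≠ a) (ha : a ∉ pairNbrs E j) {p B : ℝ}
    (h : ∀ k ∈ pairNbrs E j,
      |permProb (fun π => (StepAdj d (π a) (π j) ∧ Avoids d (pairsOff E j) π) ∧
        StepAdj d (π b) (π k)) - p| ≤ B) :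
    |permProb (fun π => (StepAdj d (π a) (π j) ∧ Avoids d (pairsOff E j) π) ∧
      ∃ k ∈ pairNbrs E j, StepAdj d (π b) (π k)) - (pairNbrs E j).card * p| ≤
      (pairNbrs E j).card * B + 1024 / (n : ℝ) ^ 3 := by
  have hn0 : (0 : ℝ) < n := by exact_mod_cast (by omega : 0 < n)
  have hN : ((pairNbrs E j).card : ℝ) ≤ 2 := by exact_mod_cast hE.card_pairNbrs_le j
  have h₁ := abs_permProb_exists_sub_sum_le (pairNbrs E j)
    (fun π => StepAdj d (π a) (π j) ∧ Avoids d (pairsOff E j) π)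
    (fun k π => StepAdj d (π b) (π k))
  have h₂ : ∑ k ∈ pairNbrs E j, ∑ l ∈ (pairNbrs E j).erase k,
      permProb (fun π => (StepAdj d (π a) (π j) ∧ Avoids d (pairsOff E j) π) ∧
        StepAdj d (π b) (π k) ∧ StepAdj d (π b) (π l)) ≤ 1024 / (n : ℝ) ^ 3 := by
    have hne : ∀ k ∈ pairNbrs E j, j ≠ k ∧ a ≠ k ∧ b ≠ j ∧ b ≠ k := by
      intro k hk
      refine ⟨(hE.stepAdj_of_mem_pairNbrs hk).ne hd, fun h => ha (h ▸ hk), ?_, ?_⟩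
      · rintro rfl
        simp [hb] at hk
      · rintro rfl
        rw [mem_pairNbrs_comm] at hk
        simp [hb] at hk
    calc _ ≤ (pairNbrs E j).card • ((pairNbrs E j).card • (256 / (n : ℝ) ^ 3)) := by
          refine Finset.sum_le_card_nsmul _ _ _ fun k hk =>
            (Finset.sum_le_card_nsmul _ _ (256 / (n : ℝ) ^ 3) fun l hl => ?_).trans
              (nsmul_le_nsmul_left (by positivity) (Finset.card_erase_le))
          obtain ⟨hlk, hl⟩ := Finset.mem_erase.1 hl
          obtain ⟨h₁, h₂, h₃, h₄⟩ := hne k hk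
          obtain ⟨h₅, h₆, -, h₇⟩ := hne l hl
          refine (permProb_mono fun π hπ => ?_).trans (permProb_pairs_and_le (d := d) hn
            (a := a) (b := b) (j := j) (k := k) (l := l) ?_)
          · exact ⟨hπ.1.1, hπ.2⟩
          · intro u v
            fin_cases u <;> fin_cases v <;>
              simp [hja, hja.symm, hab, hab.symm, hlk, hlk.symm, h₁, h₁.symm, h₂, h₂.symm, h₃,
                h₃.symm, h₄, h₄.symm, h₅, h₅.symm, h₆, h₆.symm, h₇, h₇.symm]
      _ ≤ 2 * (2 * (256 / (n : ℝ) ^ 3)) := by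
          rw [nsmul_eq_mul, nsmul_eq_mul]
          gcongr
      _ = _ := by ring
  have h₃ : |∑ k ∈ pairNbrs E j, permProb (fun π =>
      (StepAdj d (π a) (π j) ∧ Avoids d (pairsOff E j) π) ∧ StepAdj d (π b) (π k)) -
      (pairNbrs E j).card * p| ≤ (pairNbrs E j).card * B := by
    rw [← nsmul_eq_mul, ← nsmul_eq_mul, ← Finset.sum_const, ← Finset.sum_sub_distrib]
    exact (Finset.abs_sum_le_sum_abs _ _).trans (Finset.sum_le_card_nsmul _ _ _ h)
  exact (abs_sub_le _ _ _).trans ((add_le_add (h₁.trans h₂) h₃).trans_eq (add_comm _ _))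

/-- Contribution of a point `j` which is not paired with `a`. -/
lemma exists_abs_resample_sub_le_of_notMem (d : ℕ) (hd : 1 ≤ d) : ∃ C : ℝ, 0 ≤ C ∧
    ∀ n : ℕ, 12 ≤ n → d ≤ n → ∀ E : Finset (Fin n × Fin n), IsStepSet d E → ∀ a b j : Fin n,
    a ≠ b → pairNbrs E b = ∅ → j ≠ a → a ∉ pairNbrs E j →
    |(permProb (fun π => (StepAdj d (π a) (π j) ∧ Avoids d (pairsOff E j) π) ∧
        ∃ k ∈ pairNbrs E j, StepAdj d (π j) (π k)) -
      permProb (fun π => (StepAdj d (π a) (π j) ∧ Avoids d (pairsOff E j) π) ∧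
        ∃ k ∈ pairNbrs E j, StepAdj d (π b) (π k))) +
      (pairNbrs E j).card * (2 * permProb (Avoids d E) / (n : ℝ) ^ 2)| ≤ C / (n : ℝ) ^ 3 := by
  obtain ⟨C₁, hC₁, h₁⟩ := exists_abs_permProb_path_sub_le d hd
  obtain ⟨C₂, hC₂, h₂⟩ := exists_abs_permProb_pairs_sub_le d hd
  refine ⟨2 * C₁ + 2 * C₂ + 1024, by positivity, ?_⟩
  intro n hn hdn E hE a b j hab hb hja ha
  have hn0 : (0 : ℝ) < n := by exact_mod_cast (by omega : 0 < n)
  have hN : ((pairNbrs E j).card : ℝ) ≤ 2 := by exact_mod_cast hE.card_pairNbrs_le j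
  have e₁ := abs_permProb_exists_path_sub_le ha fun k hk => h₁ n hn hdn E hE a j k hja ha hk
  have e₂ := abs_permProb_exists_pairs_sub_le hd hn hE hab hb hja ha fun k hk =>
    h₂ n hn hdn E hE a b j k hab hb hja ha hk
  have e₃ : (pairNbrs E j).card * (C₁ / (n : ℝ) ^ 3) ≤ 2 * (C₁ / (n : ℝ) ^ 3) := by gcongr
  have e₄ : (pairNbrs E j).card * (C₂ / (n : ℝ) ^ 3) ≤ 2 * (C₂ / (n : ℝ) ^ 3) := by gcongr
  have e₅ : (2 * C₁ + 2 * C₂ + 1024) / (n : ℝ) ^ 3 =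
    2 * (C₁ / (n : ℝ) ^ 3) + 2 * (C₂ / (n : ℝ) ^ 3) + 1024 / (n : ℝ) ^ 3 := by ring
  have e₆ : (pairNbrs E j).card * (4 * permProb (Avoids d E) / (n : ℝ) ^ 2) =
    2 * ((pairNbrs E j).card * (2 * permProb (Avoids d E) / (n : ℝ) ^ 2)) := by ring
  rw [e₆] at e₂
  rw [e₅]
  rw [abs_le] at e₁ e₂ ⊢
  constructor <;> linarith [e₁.1, e₁.2, e₂.1, e₂.2]

end Resampling

section StepEstimate

open scoped Classical

open Equiv

variable {n : ℕ}

lemma exists_abs_permProb_adj_sub_le (d : ℕ) (hd : 1 ≤ d) : ∃ C : ℝ, 0 ≤ C ∧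
    ∀ n : ℕ, 12 ≤ n → d ≤ n → ∀ E : Finset (Fin n × Fin n), IsStepSet d E → ∀ a j : Fin n,
    j ≠ a →
    |permProb (fun π => StepAdj d (π a) (π j) ∧ Avoids d (pairsOff E j) π) -
      2 * permProb (Avoids d E) / (n : ℝ)| ≤ C / (n : ℝ) ^ 2 := by
  obtain ⟨C, hC, h⟩ := exists_abs_permProb_mem_avoids_sub_le 2
  refine ⟨2 * C + 2 * d, by positivity, ?_⟩
  intro n hn hdn E hE a j hja
  have hn0 : (0 : ℝ) < n := by exact_mod_cast (by omega : 0 < n)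
  have main := h n d hd (by omega) E (pairsOff E j) hE (pairsOff_subset E j) ![a, j]
    (by
      intro u v
      fin_cases u <;> fin_cases v <;> simp [hja, hja.symm])
    (fun e he he' => exists_eq_or_of_notMem_pairsOff (i := 1) he he')
    (Fin n × Fin n) (adjPairs n d) (fun z => ![z.1, z.2]) (fun π => (π a, π j))
    (by
      rintro ⟨s, r⟩ hz
      have h₁ := (mem_adjPairs.1 hz).ne hd
      simp only at h₁
      intro u v
      fin_cases u <;> fin_cases v <;> simp [h₁, h₁.symm])
    (by
      rintro ⟨s, r⟩ hz e he u v hu hv hadj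
      obtain ⟨e₁, e₂⟩ := fst_ne_of_mem_pairsOff he
      rw [hu] at e₁
      rw [hv] at e₂
      fin_cases u <;> fin_cases v <;> simp at e₁ e₂ hadj
      exact hadj.ne hd rfl)
    (by
      rintro ⟨s, r⟩ hz π
      simp [SendsTo, Fin.forall_fin_succ])
  simp only [mem_adjPairs] at main
  have hcard : ((adjPairs n d).card : ℝ) = 2 * (n - d) := by
    rw [card_adjPairs hd hdn, Nat.cast_mul, Nat.cast_sub hdn, Nat.cast_ofNat]
  set p := permProb (Avoids d E)
  have hp0 : 0 ≤ p := permProb_nonneg _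
  have hp1 : p ≤ 1 := permProb_le_one _
  have hd0 : (0 : ℝ) ≤ d := by positivity
  rw [hcard] at main
  have e₁ : 2 * ((n : ℝ) - d) * C / (n : ℝ) ^ (2 + 1) ≤ 2 * C / (n : ℝ) ^ 2 := by
    rw [div_le_div_iff₀ (by positivity) (by positivity)]
    calc 2 * ((n : ℝ) - d) * C * (n : ℝ) ^ 2 ≤ 2 * n * C * (n : ℝ) ^ 2 := by
          gcongr
          linarith
      _ = _ := by ring
  have e₂ : |2 * ((n : ℝ) - d) * p / (n : ℝ) ^ 2 - 2 * p / n| ≤ 2 * d / (n : ℝ) ^ 2 := by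
    rw [show 2 * ((n : ℝ) - d) * p / (n : ℝ) ^ 2 - 2 * p / n = - (2 * d * p / (n : ℝ) ^ 2) by
      field_simp; ring, abs_neg, abs_of_nonneg (by positivity)]
    refine div_le_div_of_nonneg_right ?_ (by positivity)
    exact mul_le_of_le_one_right (by positivity) hp1
  refine (abs_sub_le _ _ _).trans ((add_le_add (main.trans e₁) e₂).trans_eq (by ring))

lemma permProb_pairs_le {d : ℕ} (hn : 12 ≤ n) {a b j k : Fin n}
    (hx : Function.Injective ![a, j, b]) (hjk : j ≠ k) (hbk : b ≠ k) :
    permProb (fun π => StepAdj d (π a) (π j) ∧ StepAdj d (π b) (π k)) ≤ 64 / (n : ℝ) ^ 2 := by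
  have hn0 : (0 : ℝ) < n := by exact_mod_cast (by omega : 0 < n)
  have hc : ∀ s : Fin n, ((stepNbrs d s).card : ℝ) ≤ 2 := fun s => by
    exact_mod_cast card_stepNbrs_le d s
  by_cases hak : a = k
  · subst hak
    calc _ ≤ permProb (fun π => ∃ s ∈ Finset.univ, ∃ r ∈ stepNbrs d s, ∃ t ∈ stepNbrs d s,
          SendsTo ![a, j, b] ![s, r, t] π) :=
          permProb_mono fun π hπ => ⟨π a, Finset.mem_univ _, π j, mem_stepNbrs.2 hπ.1, π b,
            mem_stepNbrs.2 hπ.2.symm, by simp [SendsTo, Fin.forall_fin_succ]⟩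
      _ ≤ n * (2 * (2 * (2 / (n : ℝ)) ^ 3)) :=
          permProb_exists_le_card_mul _ _ (by simp) (by positivity) fun s _ =>
          permProb_exists_le_card_mul _ _ (hc s) (by positivity) fun r _ =>
          permProb_exists_le_card_mul _ _ (hc s) (by positivity) fun t _ =>
          permProb_sendsTo_le hx _ (by omega)
      _ = 32 / (n : ℝ) ^ 2 := by
          field_simp
          norm_num
      _ ≤ _ := by
          gcongr
          norm_num
  · have hx' : Function.Injective (Fin.cons k ![a, j, b] : Fin 4 → Fin n) := by
      refine Fin.cons_injective_iff.2 ⟨?_, hx⟩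
      rintro ⟨i, hi⟩
      fin_cases i <;> simp at hi
      · exact hak hi
      · exact hjk hi
      · exact hbk hi
    calc _ ≤ permProb (fun π => ∃ s ∈ Finset.univ, ∃ r ∈ stepNbrs d s, ∃ t ∈ Finset.univ,
          ∃ q ∈ stepNbrs d t, SendsTo (Fin.cons k ![a, j, b] : Fin 4 → Fin n) ![q, s, r, t] π) :=
          permProb_mono fun π hπ => ⟨π a, Finset.mem_univ _, π j, mem_stepNbrs.2 hπ.1, π b,
            Finset.mem_univ _, π k, mem_stepNbrs.2 hπ.2, by simp [SendsTo, Fin.forall_fin_succ]⟩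
      _ ≤ n * (2 * (n * (2 * (2 / (n : ℝ)) ^ 4))) :=
          permProb_exists_le_card_mul _ _ (by simp) (by positivity) fun s _ =>
          permProb_exists_le_card_mul _ _ (hc s) (by positivity) fun r _ =>
          permProb_exists_le_card_mul _ _ (by simp) (by positivity) fun t _ =>
          permProb_exists_le_card_mul _ _ (hc t) (by positivity) fun q _ =>
          permProb_sendsTo_le hx' _ (by omega)
      _ = _ := by
          field_simp
          norm_num

/-- Contribution of a point `j` which is paired with `a`. -/
lemma exists_abs_resample_sub_le_of_mem (d : ℕ) (hd : 1 ≤ d) : ∃ C : ℝ, 0 ≤ C ∧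
    ∀ n : ℕ, 12 ≤ n → d ≤ n → ∀ E : Finset (Fin n × Fin n), IsStepSet d E → ∀ a b j : Fin n,
    a ≠ b → pairNbrs E b = ∅ → a ∈ pairNbrs E j →
    |(permProb (fun π => (StepAdj d (π a) (π j) ∧ Avoids d (pairsOff E j) π) ∧
        ∃ k ∈ pairNbrs E j, StepAdj d (π j) (π k)) -
      permProb (fun π => (StepAdj d (π a) (π j) ∧ Avoids d (pairsOff E j) π) ∧
        ∃ k ∈ pairNbrs E j, StepAdj d (π b) (π k))) -
      2 * permProb (Avoids d E) / (n : ℝ)| ≤ C / (n : ℝ) ^ 2 := by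
  obtain ⟨C, hC, h⟩ := exists_abs_permProb_adj_sub_le d hd
  refine ⟨C + 128, by positivity, ?_⟩
  intro n hn hdn E hE a b j hab hb ha
  have hn0 : (0 : ℝ) < n := by exact_mod_cast (by omega : 0 < n)
  have hN : ((pairNbrs E j).card : ℝ) ≤ 2 := by exact_mod_cast hE.card_pairNbrs_le j
  have hja : j ≠ a := (hE.stepAdj_of_mem_pairNbrs ha).ne hd
  have hjb : j ≠ b := by
    rintro rfl
    simp [hb] at ha
  have e₁ : permProb (fun π => (StepAdj d (π a) (π j) ∧ Avoids d (pairsOff E j) π) ∧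
      ∃ k ∈ pairNbrs E j, StepAdj d (π j) (π k)) =
      permProb (fun π => StepAdj d (π a) (π j) ∧ Avoids d (pairsOff E j) π) :=
    permProb_congr fun π => ⟨fun h => h.1, fun h => ⟨h, a, ha, h.1.symm⟩⟩
  have e₂ : permProb (fun π => (StepAdj d (π a) (π j) ∧ Avoids d (pairsOff E j) π) ∧
      ∃ k ∈ pairNbrs E j, StepAdj d (π b) (π k)) ≤ 2 * (64 / (n : ℝ) ^ 2) := by
    refine (permProb_mono (Q := fun π => ∃ k ∈ pairNbrs E j, StepAdj d (π a) (π j) ∧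
      StepAdj d (π b) (π k)) ?_).trans
      (permProb_exists_le_card_mul _ _ hN (by positivity) fun k hk => ?_)
    · rintro π ⟨⟨h₁, -⟩, k, hk, h₂⟩
      exact ⟨k, hk, h₁, h₂⟩
    · refine permProb_pairs_le hn ?_ ((hE.stepAdj_of_mem_pairNbrs hk).ne hd) ?_
      · intro u v
        fin_cases u <;> fin_cases v <;> simp [hja, hja.symm, hab, hab.symm, hjb, hjb.symm]
      · rintro rfl
        rw [mem_pairNbrs_comm] at hk
        simp [hb] at hk
  have e₃ := permProb_nonneg (fun π => (StepAdj d (π a) (π j) ∧ Avoids d (pairsOff E j) π) ∧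
      ∃ k ∈ pairNbrs E j, StepAdj d (π b) (π k))
  have e₄ := h n hn hdn E hE a j hja
  have e₅ : (C + 128) / (n : ℝ) ^ 2 = C / (n : ℝ) ^ 2 + 2 * (64 / (n : ℝ) ^ 2) := by ring
  rw [e₁, e₅]
  rw [abs_le] at e₄ ⊢
  constructor <;> linarith [e₄.1, e₄.2]

lemma abs_mul_sub_le_of_add_eq {g s c m p N : ℝ} (h : g + s + c = 2 * m) (hs₀ : 0 ≤ s)
    (hs : s ≤ 4) (hc₀ : 0 ≤ c) (hc : c ≤ 2) (hp₀ : 0 ≤ p) (hp : p ≤ 1) (hN : 0 < N) :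
    |g * (2 * p / N) - 4 * m * p / N| ≤ 12 / N := by
  have e : g * (2 * p / N) - 4 * m * p / N = -(2 * (s + c) * p / N) := by
    linear_combination (2 * p / N) * h
  have h₀ : 0 ≤ 2 * (s + c) * p / N := by positivity
  rw [e, abs_neg, abs_of_nonneg h₀]
  refine div_le_div_of_nonneg_right ?_ hN.le
  refine (mul_le_of_le_one_right (by positivity) hp).trans ?_
  linarith

/-- The probability of violating exactly the constraint at a new pair `(a, b)`. -/
lemma exists_abs_sub_one_mul_permProb_sub_le (d : ℕ) (hd : 1 ≤ d) : ∃ K : ℝ, 0 ≤ K ∧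
    ∀ n : ℕ, 12 ≤ n → d ≤ n → ∀ E : Finset (Fin n × Fin n), IsStepSet d E → ∀ a b : Fin n,
    a ≠ b → pairNbrs E b = ∅ →
    |((n : ℝ) - 1) * permProb (fun π => Avoids d E π ∧ StepAdj d (π a) (π b)) -
      permProb (Avoids d E) * (2 - 2 * d / n + 2 * (pairNbrs E a).card / n -
        4 * E.card / (n : ℝ) ^ 2)| ≤ K / (n : ℝ) ^ 2 := by
  obtain ⟨C₁, hC₁, h₁⟩ := exists_abs_sum_card_stepNbrs_mul_sub_le d hd
  obtain ⟨C₂, hC₂, h₂⟩ := exists_abs_resample_sub_le_of_mem d hd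
  obtain ⟨C₃, hC₃, h₃⟩ := exists_abs_resample_sub_le_of_notMem d hd
  refine ⟨C₁ + 2 * C₂ + C₃ + 12, by positivity, ?_⟩
  intro n hn hdn E hE a b hab hb
  have hn0 : (0 : ℝ) < n := by exact_mod_cast (by omega : 0 < n)
  rw [sub_one_mul_permProb_eq hd hE hab hb]
  have g₁ := h₁ n (by omega) hdn E hE a
  set F : Fin n → ℝ := fun j =>
    permProb (fun π => (StepAdj d (π a) (π j) ∧ Avoids d (pairsOff E j) π) ∧
        ∃ k ∈ pairNbrs E j, StepAdj d (π j) (π k)) -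
      permProb (fun π => (StepAdj d (π a) (π j) ∧ Avoids d (pairsOff E j) π) ∧
        ∃ k ∈ pairNbrs E j, StepAdj d (π b) (π k)) with hF
  set p := permProb (Avoids d E)
  have hp0 : 0 ≤ p := permProb_nonneg _
  have hp1 : p ≤ 1 := permProb_le_one _
  have ha : a ∉ pairNbrs E a := fun h => (hE.stepAdj_of_mem_pairNbrs h).ne hd rfl
  have hsub : pairNbrs E a ⊆ Finset.univ.erase a := fun j hj =>
    Finset.mem_erase.2 ⟨fun h => ha (h ▸ hj), Finset.mem_univ _⟩
  set G := Finset.univ.erase a \ pairNbrs E a with hG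
  have hmemG : ∀ j ∈ G, j ≠ a ∧ a ∉ pairNbrs E j := by
    intro j hj
    obtain ⟨hj₁, hj₂⟩ := Finset.mem_sdiff.1 hj
    exact ⟨(Finset.mem_erase.1 hj₁).1, fun h => hj₂ (mem_pairNbrs_comm.1 h)⟩
  have hN : ∀ j, ((pairNbrs E j).card : ℝ) ≤ 2 := fun j => by
    exact_mod_cast hE.card_pairNbrs_le j
  have g₂ : |∑ j ∈ pairNbrs E a, F j - (pairNbrs E a).card * (2 * p / n)| ≤
      2 * (C₂ / (n : ℝ) ^ 2) := by
    rw [← nsmul_eq_mul, ← Finset.sum_const, ← Finset.sum_sub_distrib]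
    refine (Finset.abs_sum_le_sum_abs _ _).trans ((Finset.sum_le_card_nsmul _ _ _ fun j hj =>
      h₂ n hn hdn E hE a b j hab hb (mem_pairNbrs_comm.1 hj)).trans ?_)
    rw [nsmul_eq_mul]
    gcongr
    exact hN a
  have g₃ : |∑ j ∈ G, F j + (∑ j ∈ G, ((pairNbrs E j).card : ℝ)) * (2 * p / (n : ℝ) ^ 2)| ≤
      C₃ / (n : ℝ) ^ 2 := by
    rw [Finset.sum_mul, ← Finset.sum_add_distrib]
    refine (Finset.abs_sum_le_sum_abs _ _).trans ((Finset.sum_le_card_nsmul _ _ _ fun j hj =>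
      h₃ n hn hdn E hE a b j hab hb (hmemG j hj).1 (hmemG j hj).2).trans ?_)
    rw [nsmul_eq_mul]
    calc (G.card : ℝ) * (C₃ / (n : ℝ) ^ 3) ≤ n * (C₃ / (n : ℝ) ^ 3) := by
          gcongr
          exact (Finset.card_le_univ G).trans_eq (Fintype.card_fin n)
      _ = _ := by field_simp
  have g₄ : ∑ j ∈ Finset.univ.erase a, F j = ∑ j ∈ G, F j + ∑ j ∈ pairNbrs E a, F j :=
    (Finset.sum_sdiff hsub).symm
  have hcount : ∑ j ∈ G, ((pairNbrs E j).card : ℝ) + ∑ j ∈ pairNbrs E a,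
      ((pairNbrs E j).card : ℝ) + (pairNbrs E a).card = 2 * E.card := by
    rw [Finset.sum_sdiff hsub, Finset.sum_erase_add _ _ (Finset.mem_univ a)]
    exact_mod_cast hE.sum_card_pairNbrs hd
  have hnear : ∑ j ∈ pairNbrs E a, ((pairNbrs E j).card : ℝ) ≤ 4 := by
    refine (Finset.sum_le_card_nsmul _ _ _ fun j _ => hN j).trans ?_
    rw [nsmul_eq_mul]
    linarith [hN a]
  have hnear0 : (0 : ℝ) ≤ ∑ j ∈ pairNbrs E a, ((pairNbrs E j).card : ℝ) :=
    Finset.sum_nonneg fun _ _ => by positivity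
  have ha0 : (0 : ℝ) ≤ (pairNbrs E a).card := by positivity
  have g₅ : |(∑ j ∈ G, ((pairNbrs E j).card : ℝ)) * (2 * p / (n : ℝ) ^ 2) -
      4 * E.card * p / (n : ℝ) ^ 2| ≤ 12 / (n : ℝ) ^ 2 := by
    exact abs_mul_sub_le_of_add_eq hcount hnear0 hnear ha0 (hN a) hp0 hp1 (by positivity)
  rw [show (∑ j ∈ Finset.univ.erase a, (permProb (fun π => (StepAdj d (π a) (π j) ∧
    Avoids d (pairsOff E j) π) ∧ ∃ k ∈ pairNbrs E j, StepAdj d (π j) (π k)) -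
      permProb (fun π => (StepAdj d (π a) (π j) ∧ Avoids d (pairsOff E j) π) ∧
        ∃ k ∈ pairNbrs E j, StepAdj d (π b) (π k)))) = ∑ j ∈ Finset.univ.erase a, F j from rfl, g₄]
  have e₁ : (C₁ + 2 * C₂ + C₃ + 12) / (n : ℝ) ^ 2 = C₁ / (n : ℝ) ^ 2 +
    2 * (C₂ / (n : ℝ) ^ 2) + C₃ / (n : ℝ) ^ 2 + 12 / (n : ℝ) ^ 2 := by ring
  have e₂ : p * (2 - 2 * d / n + 2 * (pairNbrs E a).card / n - 4 * E.card / (n : ℝ) ^ 2) =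
    (2 - 2 * d / n) * p + (pairNbrs E a).card * (2 * p / n) - 4 * E.card * p / (n : ℝ) ^ 2 := by
    ring
  rw [e₁, e₂]
  rw [abs_le] at g₁ g₂ g₃ g₅ ⊢
  constructor <;> linarith [g₁.1, g₁.2, g₂.1, g₂.2, g₃.1, g₃.2, g₅.1, g₅.2]

end StepEstimate

section Asymptotics

open scoped Classical

open Equiv

/-- The logarithmic decay of the probability when the pair `(m, m + d)` is added. -/
noncomputable def decayRate (n d m : ℕ) : ℝ :=
  2 / n + (6 - 2 * d) / (n : ℝ) ^ 2 - 4 * m / (n : ℝ) ^ 3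

lemma decayRate_nonneg {n d m : ℕ} (hm : m + d < n) : 0 ≤ decayRate n d m := by
  have hn : (0 : ℝ) < n := by exact_mod_cast (by omega : 0 < n)
  have hm' : (m : ℝ) + d ≤ n := by exact_mod_cast hm.le
  have hd : (0 : ℝ) ≤ d := by positivity
  have hm0 : (0 : ℝ) ≤ m := by positivity
  rw [decayRate, show 2 / (n : ℝ) + (6 - 2 * d) / (n : ℝ) ^ 2 - 4 * m / (n : ℝ) ^ 3 =
    (2 * n * (n - d) + 6 * n - 4 * m) / (n : ℝ) ^ 3 by field_simp; ring]
  refine div_nonneg ?_ (by positivity)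
  nlinarith [mul_nonneg hn.le (by linarith : (0 : ℝ) ≤ n - d)]

lemma decayRate_le {n d m : ℕ} (hn : 0 < n) : decayRate n d m ≤ 8 / n := by
  have hn1 : (1 : ℝ) ≤ n := by exact_mod_cast hn
  have hn : (0 : ℝ) < n := by linarith
  have h₁ : (6 - 2 * (d : ℝ)) / (n : ℝ) ^ 2 ≤ 6 / n := by
    rw [div_le_div_iff₀ (by positivity) hn]
    have : (0 : ℝ) ≤ d := by positivity
    nlinarith [mul_nonneg this hn.le]
  have h₂ : 0 ≤ 4 * (m : ℝ) / (n : ℝ) ^ 3 := by positivity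
  rw [decayRate, show 8 / (n : ℝ) = 2 / n + 6 / n by ring]
  linarith

lemma abs_one_sub_exp_neg_sub_le {x : ℝ} (h₀ : 0 ≤ x) (h₁ : x ≤ 1) :
    |(1 - Real.exp (-x)) - (x - x ^ 2 / 2)| ≤ x ^ 3 := by
  have h := Real.exp_bound (x := -x) (n := 3) (by rwa [abs_neg, abs_of_nonneg h₀]) (by norm_num)
  rw [abs_neg, abs_of_nonneg h₀] at h
  norm_num [Finset.sum_range_succ, Nat.factorial] at h
  have hx : 0 ≤ x ^ 3 := by positivity
  rw [abs_le] at h ⊢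
  constructor <;> linarith [h.1, h.2]

lemma abs_sub_one_mul_decayRate_sub_le {n d m : ℕ} (hm : m + d < n) :
    |((n : ℝ) - 1) * (decayRate n d m - decayRate n d m ^ 2 / 2) -
      (2 - 2 * d / n + 2 / n - 4 * m / (n : ℝ) ^ 2)| ≤
      (5 * (2 * d + 10) + 2 + (2 * d + 10) ^ 2) / (n : ℝ) ^ 2 := by
  have hn : (0 : ℝ) < n := by exact_mod_cast (by omega : 0 < n)
  have hn1 : (1 : ℝ) ≤ n := by exact_mod_cast (by omega : 1 ≤ n)
  have hm' : (m : ℝ) ≤ n := by exact_mod_cast (by omega : m ≤ n)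
  have hd : (0 : ℝ) ≤ d := by positivity
  obtain ⟨t, ht⟩ : ∃ t : ℝ, t = 1 / n := ⟨_, rfl⟩
  obtain ⟨γ, hγ⟩ : ∃ γ : ℝ, γ = 6 - 2 * d - 4 * m / n := ⟨_, rfl⟩
  have ht0 : 0 ≤ t := by rw [ht]; positivity
  have ht1 : t ≤ 1 := by rw [ht, div_le_one hn]; exact hn1
  have hμ : (m : ℝ) / n ≤ 1 := (div_le_one hn).2 hm'
  have hμ0 : 0 ≤ (m : ℝ) / n := by positivity
  have hγ' : |γ| ≤ 2 * d + 10 := by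
    rw [hγ, mul_div_assoc, abs_le]
    constructor <;> linarith
  have e : ((n : ℝ) - 1) * (decayRate n d m - decayRate n d m ^ 2 / 2) -
      (2 - 2 * d / n + 2 / n - 4 * m / (n : ℝ) ^ 2) =
      (-(3 * γ) + 2 - γ ^ 2 * t / 2 + 2 * γ * t + γ ^ 2 * t ^ 2 / 2) / (n : ℝ) ^ 2 := by
    rw [decayRate, ht, hγ]
    field_simp
    ring
  rw [e, abs_div, abs_of_pos (by positivity : (0 : ℝ) < (n : ℝ) ^ 2)]
  refine div_le_div_of_nonneg_right ?_ (by positivity)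
  have hsq : γ ^ 2 ≤ (2 * d + 10) ^ 2 := sq_le_sq' (abs_le.1 hγ').1 (abs_le.1 hγ').2
  have h₁ : γ ^ 2 * t ≤ γ ^ 2 := mul_le_of_le_one_right (sq_nonneg γ) ht1
  have h₂ : γ ^ 2 * t ^ 2 ≤ γ ^ 2 := mul_le_of_le_one_right (sq_nonneg γ) (by nlinarith)
  have h₃ : |γ * t| ≤ 2 * d + 10 := by
    rw [abs_mul, abs_of_nonneg ht0]
    exact (mul_le_of_le_one_right (abs_nonneg γ) ht1).trans hγ'
  have h₄ : 0 ≤ γ ^ 2 * t := by positivity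
  have h₅ : 0 ≤ γ ^ 2 * t ^ 2 := by positivity
  rw [abs_le] at hγ' h₃ ⊢
  constructor <;> linarith [hγ'.1, hγ'.2, h₃.1, h₃.2]

lemma pairNbrs_stepPairs_add {n d m : ℕ} (h : m + d < n) :
    pairNbrs (stepPairs n d m) ⟨m + d, h⟩ = ∅ := by
  refine Finset.eq_empty_of_forall_notMem fun k hk => ?_
  simp only [mem_pairNbrs, mem_stepPairs] at hk
  omega

lemma card_pairNbrs_stepPairs_le {n d m : ℕ} (h : m < n) :
    (pairNbrs (stepPairs n d m) ⟨m, h⟩).card ≤ 1 := by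
  refine Finset.card_le_one.2 fun k hk l hl => Fin.ext ?_
  simp only [mem_pairNbrs, mem_stepPairs] at hk hl
  omega

lemma card_pairNbrs_stepPairs {n d m : ℕ} (h : m < n) (hd : 1 ≤ d) (hdm : d ≤ m) :
    (pairNbrs (stepPairs n d m) ⟨m, h⟩).card = 1 := by
  refine le_antisymm (card_pairNbrs_stepPairs_le h) (Finset.card_pos.2 ⟨⟨m - d, by omega⟩, ?_⟩)
  simp only [mem_pairNbrs, mem_stepPairs]
  omega

/-- The probability that the pairs `(i, i + d)` with `i < m` are all avoided. -/
noncomputable def avoidProb (n d m : ℕ) : ℝ := permProb (Avoids d (stepPairs n d m))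

lemma avoidProb_zero (n d : ℕ) : avoidProb n d 0 = 1 := by
  rw [avoidProb, ← permProb_true (n := n)]
  refine permProb_congr fun π => iff_true_intro fun e he => ?_
  exact absurd (mem_stepPairs.1 he).2 (Nat.not_lt_zero _)

lemma avoids_stepPairs_succ_iff {n d m : ℕ} (h : m + d < n) (π : Perm (Fin n)) :
    Avoids d (stepPairs n d (m + 1)) π ↔ Avoids d (stepPairs n d m) π ∧
      ¬ StepAdj d (π ⟨m, by omega⟩) (π ⟨m + d, h⟩) := by
  constructor
  · refine fun hπ => ⟨hπ.mono fun e he => ?_, hπ (⟨m, by omega⟩, ⟨m + d, h⟩) ?_⟩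
    · rw [mem_stepPairs] at he ⊢
      omega
    · rw [mem_stepPairs]
      exact ⟨rfl, Nat.lt_succ_self m⟩
  · rintro ⟨h₁, h₂⟩ ⟨u, v⟩ he
    obtain ⟨he₁, he₂⟩ := mem_stepPairs.1 he
    simp only at he₁ he₂
    by_cases hu : (u : ℕ) = m
    · have hu' : u = ⟨m, by omega⟩ := Fin.ext hu
      have hv' : v = ⟨m + d, h⟩ := Fin.ext (by rw [he₁, hu])
      rwa [hu', hv']
    · exact h₁ (u, v) (mem_stepPairs.2 ⟨he₁, by simp only; omega⟩)

lemma avoidProb_sub {n d m : ℕ} (h : m + d < n) :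
    avoidProb n d m - avoidProb n d (m + 1) =
      permProb (fun π : Perm (Fin n) => Avoids d (stepPairs n d m) π ∧
        StepAdj d (π ⟨m, by omega⟩) (π ⟨m + d, h⟩)) := by
  rw [avoidProb, avoidProb, permProb_congr (avoids_stepPairs_succ_iff h),
    permProb_split (Avoids d (stepPairs n d m)) fun π =>
      StepAdj d (π ⟨m, by omega⟩) (π ⟨m + d, h⟩)]
  ring

lemma exists_abs_avoidProb_step_le (d : ℕ) (hd : 1 ≤ d) : ∃ K : ℝ, 0 ≤ K ∧
    ∀ n m : ℕ, 12 ≤ n → m + d < n →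
    |avoidProb n d m * (1 - Real.exp (-decayRate n d m)) -
      (avoidProb n d m - avoidProb n d (m + 1))| ≤
      K / (n : ℝ) ^ 3 + if m < d then 4 / (n : ℝ) ^ 2 else 0 := by
  obtain ⟨K, hK, h⟩ := exists_abs_sub_one_mul_permProb_sub_le d hd
  refine ⟨2 * (K + (5 * (2 * d + 10) + 2 + (2 * d + 10) ^ 2)) + 512, by positivity, ?_⟩
  intro n m hn hm
  have hn0 : (0 : ℝ) < n := by exact_mod_cast (by omega : 0 < n)
  have hn12 : (12 : ℝ) ≤ n := by exact_mod_cast hn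
  have hstep := h n hn (by omega) (stepPairs n d m) (isStepSet_stepPairs n d m)
    ⟨m, by omega⟩ ⟨m + d, hm⟩ (by rw [Ne, Fin.ext_iff]; simp only; omega)
    (pairNbrs_stepPairs_add hm)
  rw [card_stepPairs hm.le, ← avoidProb_sub hm] at hstep
  change |_ - avoidProb n d m * _| ≤ _ at hstep
  have hrate := abs_sub_one_mul_decayRate_sub_le hm
  have hl0 := decayRate_nonneg hm
  have hl := decayRate_le (d := d) (m := m) (by omega : 0 < n)
  have hl1 : decayRate n d m ≤ 1 := hl.trans ((div_le_one hn0).2 (by linarith))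
  have hexp := (abs_one_sub_exp_neg_sub_le hl0 hl1).trans (pow_le_pow_left₀ hl0 hl 3)
  set p := avoidProb n d m with hp
  have hp0 : 0 ≤ p := permProb_nonneg _
  have hp1 : p ≤ 1 := permProb_le_one _
  set q := p - avoidProb n d (m + 1)
  set w := decayRate n d m - decayRate n d m ^ 2 / 2
  set M : ℝ := 5 * (2 * d + 10) + 2 + (2 * d + 10) ^ 2
  have hmul : ∀ x y : ℝ, |x| ≤ y → |p * x| ≤ y := fun x y hx => by
    rw [abs_mul, abs_of_nonneg hp0]
    exact (mul_le_of_le_one_left (abs_nonneg x) hp1).trans hx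
  have hcard : |p * (2 * ((pairNbrs (stepPairs n d m) ⟨m, by omega⟩).card : ℝ) / n - 2 / n)| ≤
      if m < d then 2 / (n : ℝ) else 0 := by
    refine hmul _ _ ?_
    split_ifs with hmd
    · have hc : ((pairNbrs (stepPairs n d m) ⟨m, by omega⟩).card : ℝ) ≤ 1 := by
        exact_mod_cast card_pairNbrs_stepPairs_le (by omega)
      rw [← sub_div, abs_div, abs_of_pos hn0]
      refine div_le_div_of_nonneg_right ?_ hn0.le
      have : (0 : ℝ) ≤ (pairNbrs (stepPairs n d m) ⟨m, by omega⟩).card := by positivity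
      rw [abs_le]
      constructor <;> linarith
    · rw [card_pairNbrs_stepPairs (by omega) hd (by omega)]
      simp
  have hmain : |((n : ℝ) - 1) * (p * w - q)| ≤
      (K + M) / (n : ℝ) ^ 2 + if m < d then 2 / (n : ℝ) else 0 := by
    have h₁ := hmul _ _ hrate
    rw [add_div]
    rw [abs_le] at h₁ hstep hcard ⊢
    constructor <;> linarith [h₁.1, h₁.2, hstep.1, hstep.2, hcard.1, hcard.2]
  have hdiv : |p * w - q| ≤ 2 * (K + M) / (n : ℝ) ^ 3 + if m < d then 4 / (n : ℝ) ^ 2 else 0 := by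
    rw [abs_mul, abs_of_nonneg (by linarith)] at hmain
    have h₁ : (n : ℝ) / 2 * |p * w - q| ≤ ((n : ℝ) - 1) * |p * w - q| :=
      mul_le_mul_of_nonneg_right (by linarith) (abs_nonneg _)
    have h₂ := h₁.trans hmain
    have h₃ : |p * w - q| ≤ 2 / (n : ℝ) *
        ((K + M) / (n : ℝ) ^ 2 + if m < d then 2 / (n : ℝ) else 0) := by
      calc |p * w - q| = 2 / (n : ℝ) * ((n : ℝ) / 2 * |p * w - q|) := by field_simp
        _ ≤ _ := mul_le_mul_of_nonneg_left h₂ (by positivity)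
    refine h₃.trans_eq ?_
    split_ifs
    · field_simp
      ring
    · field_simp
      ring
  have hfin := hmul _ _ hexp
  have e : (2 * (K + M) + 512) / (n : ℝ) ^ 3 = 2 * (K + M) / (n : ℝ) ^ 3 + (8 / (n : ℝ)) ^ 3 := by
    field_simp
    norm_num
  rw [e]
  rw [abs_le] at hfin hdiv ⊢
  constructor <;> linarith [hfin.1, hfin.2, hdiv.1, hdiv.2]

lemma exists_abs_avoidProb_sub_exp_le (d : ℕ) (hd : 1 ≤ d) : ∃ K : ℝ, 0 ≤ K ∧
    ∀ n m : ℕ, 12 ≤ n → m + d ≤ n →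
    |avoidProb n d m - Real.exp (-∑ i ∈ Finset.range m, decayRate n d i)| ≤ K / (n : ℝ) ^ 2 := by
  obtain ⟨K, hK, h⟩ := exists_abs_avoidProb_step_le d hd
  refine ⟨K + 4 * d, by positivity, ?_⟩
  intro n m hn hm
  have hn0 : (0 : ℝ) < n := by exact_mod_cast (by omega : 0 < n)
  have key : ∀ m, m + d ≤ n →
      |avoidProb n d m - Real.exp (-∑ i ∈ Finset.range m, decayRate n d i)| ≤
        m * (K / (n : ℝ) ^ 3) + (min m d : ℕ) * (4 / (n : ℝ) ^ 2) := by
    intro m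
    induction m with
    | zero => simp [avoidProb_zero]
    | succ m ih =>
      intro hm
      have ih := ih (by omega)
      have hstep := h n m hn (by omega)
      have hl0 := decayRate_nonneg (by omega : m + d < n)
      rw [Finset.sum_range_succ, neg_add, Real.exp_add]
      set G := Real.exp (-∑ i ∈ Finset.range m, decayRate n d i)
      set x := Real.exp (-decayRate n d m)
      have hx0 : 0 ≤ x := (Real.exp_pos _).le
      have hx1 : x ≤ 1 := Real.exp_le_one_iff.2 (by linarith)
      have e₁ : avoidProb n d (m + 1) - G * x = x * (avoidProb n d m - G) +
          (avoidProb n d m * (1 - x) - (avoidProb n d m - avoidProb n d (m + 1))) := by ring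
      have e₂ : |x * (avoidProb n d m - G)| ≤ |avoidProb n d m - G| := by
        rw [abs_mul, abs_of_nonneg hx0]
        exact mul_le_of_le_one_left (abs_nonneg _) hx1
      have e₃ : ((min (m + 1) d : ℕ) : ℝ) * (4 / (n : ℝ) ^ 2) =
          (min m d : ℕ) * (4 / (n : ℝ) ^ 2) + if m < d then 4 / (n : ℝ) ^ 2 else 0 := by
        split_ifs with hmd
        · rw [min_eq_left (by omega : m + 1 ≤ d), min_eq_left (by omega : m ≤ d)]
          push_cast
          ring
        · rw [min_eq_right (by omega : d ≤ m + 1), min_eq_right (by omega : d ≤ m), add_zero]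
      rw [e₁, e₃, Nat.cast_succ]
      have := abs_add_le (x * (avoidProb n d m - G))
        (avoidProb n d m * (1 - x) - (avoidProb n d m - avoidProb n d (m + 1)))
      linarith
  refine (key m hm).trans ?_
  have h₁ : (m : ℝ) * (K / (n : ℝ) ^ 3) ≤ K / (n : ℝ) ^ 2 := by
    calc (m : ℝ) * (K / (n : ℝ) ^ 3) ≤ n * (K / (n : ℝ) ^ 3) := by
          gcongr
          omega
      _ = _ := by field_simp
  have h₂ : ((min m d : ℕ) : ℝ) * (4 / (n : ℝ) ^ 2) ≤ 4 * d / (n : ℝ) ^ 2 := by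
    calc ((min m d : ℕ) : ℝ) * (4 / (n : ℝ) ^ 2) ≤ d * (4 / (n : ℝ) ^ 2) := by
          gcongr
          exact min_le_right _ _
      _ = _ := by ring
  rw [add_div]
  linarith

lemma sum_decayRate (n d m : ℕ) : ∑ i ∈ Finset.range m, decayRate n d i =
    m * (2 / n + (6 - 2 * d) / (n : ℝ) ^ 2) - 2 * m * (m - 1) / (n : ℝ) ^ 3 := by
  induction m with
  | zero => simp
  | succ m ih =>
    rw [Finset.sum_range_succ, ih, decayRate]
    push_cast
    ring

lemma exists_abs_exp_sum_decayRate_sub_le (d : ℕ) : ∃ K : ℝ, ∃ N : ℕ, ∀ n : ℕ, N ≤ n →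
    |Real.exp (-∑ i ∈ Finset.range (n - d), decayRate n d i) -
      Real.exp (-2) * (1 + 4 * ((d : ℝ) - 1) / n)| ≤ K / (n : ℝ) ^ 2 := by
  obtain ⟨M, hM⟩ : ∃ M : ℝ, M = |(6 - 2 * (d : ℝ)) * d - 2 * (2 * d + 1)| + 2 * d * (d + 1) :=
    ⟨_, rfl⟩
  have hM0 : 0 ≤ M := by rw [hM]; positivity
  obtain ⟨B, hB⟩ : ∃ B : ℝ, B = |4 * ((d : ℝ) - 1)| + M := ⟨_, rfl⟩
  obtain ⟨N, hN⟩ := exists_nat_ge B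
  refine ⟨B ^ 2 + M, N + d + 1, ?_⟩
  intro n hn
  have hdn : d ≤ n := by omega
  have hn0 : (0 : ℝ) < n := by exact_mod_cast (by omega : 0 < n)
  have hn1 : (1 : ℝ) ≤ n := by exact_mod_cast (by omega : 1 ≤ n)
  have hBn : B ≤ n := hN.trans (by exact_mod_cast (by omega : N ≤ n))
  set L := ∑ i ∈ Finset.range (n - d), decayRate n d i with hL
  have e₁ : 2 - L - 4 * ((d : ℝ) - 1) / n =
      ((6 - 2 * (d : ℝ)) * d - 2 * (2 * d + 1) + 2 * d * (d + 1) / n) / (n : ℝ) ^ 2 := by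
    rw [hL, sum_decayRate, Nat.cast_sub hdn]
    field_simp
    ring
  have h₁ : |2 - L - 4 * ((d : ℝ) - 1) / n| ≤ M / (n : ℝ) ^ 2 := by
    rw [e₁, abs_div, abs_of_pos (by positivity : (0 : ℝ) < (n : ℝ) ^ 2), hM]
    refine div_le_div_of_nonneg_right ((abs_add_le _ _).trans (add_le_add_right ?_ _))
      (by positivity)
    rw [abs_of_nonneg (by positivity)]
    exact div_le_self (by positivity) hn1
  have h₂ : |2 - L| ≤ B / n := by
    have h₃ : M / (n : ℝ) ^ 2 ≤ M / n :=
      div_le_div_of_nonneg_left hM0 hn0 (by nlinarith)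
    have h₄ : |4 * ((d : ℝ) - 1) / n| = |4 * ((d : ℝ) - 1)| / n := by
      rw [abs_div, abs_of_pos hn0]
    have h₅ := abs_add_le (2 - L - 4 * ((d : ℝ) - 1) / n) (4 * ((d : ℝ) - 1) / n)
    rw [sub_add_cancel, h₄] at h₅
    rw [hB, add_div]
    linarith
  have h₃ := Real.abs_exp_sub_one_sub_id_le (h₂.trans ((div_le_one hn0).2 hBn))
  have h₄ : (2 - L) ^ 2 ≤ B ^ 2 / (n : ℝ) ^ 2 := by
    rw [← div_pow, ← sq_abs]
    exact pow_le_pow_left₀ (abs_nonneg _) h₂ 2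
  have e₂ : Real.exp (-L) - Real.exp (-2) * (1 + 4 * ((d : ℝ) - 1) / n) =
      Real.exp (-2) * ((Real.exp (2 - L) - 1 - (2 - L)) +
        (2 - L - 4 * ((d : ℝ) - 1) / n)) := by
    rw [show -L = -2 + (2 - L) by ring, Real.exp_add]
    ring
  rw [e₂, abs_mul, abs_of_pos (Real.exp_pos _), add_div]
  refine (mul_le_of_le_one_left (abs_nonneg _) (Real.exp_le_one_iff.2 (by norm_num))).trans ?_
  exact (abs_add_le _ _).trans (add_le_add (h₃.trans h₄) h₁)

lemma avoids_stepPairs_iff {n d : ℕ} (π : Perm (Fin n)) :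
    Avoids d (stepPairs n d (n - d)) π ↔ ∀ i : Fin n, ∀ h : (i : ℕ) + d < n,
      (((π ⟨(i : ℕ) + d, h⟩ : Fin n) : ℤ) - ((π i : Fin n) : ℤ)).natAbs ≠ d := by
  constructor
  · intro hπ i h heq
    refine hπ (i, ⟨i + d, h⟩) (mem_stepPairs.2 ⟨rfl, by simp only; omega⟩) ?_
    simp only [StepAdj]
    omega
  · rintro hπ ⟨u, v⟩ he hadj
    obtain ⟨he₁, he₂⟩ := mem_stepPairs.1 he
    simp only at he₁ he₂
    have h : (u : ℕ) + d < n := he₁ ▸ v.2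
    obtain rfl : v = ⟨u + d, h⟩ := Fin.ext he₁
    refine hπ u h ?_
    simp only [StepAdj] at hadj
    omega

lemma A_div_factorial_eq (n d : ℕ) :
    (A n d : ℝ) / (n.factorial : ℝ) = avoidProb n d (n - d) := by
  rw [avoidProb, permProb, Finset.sum_boole, A]
  congr 2
  rw [Set.ncard_eq_toFinset_card', Set.toFinset_ofPred]
  congr 1
  ext π
  simp only [Finset.mem_filter, Finset.mem_univ, true_and]
  exact (avoids_stepPairs_iff π).symm

end Asymptotics

/-- For fixed `d ≥ 1`,
`a_{n,d}/n! = e^{−2}·(1 + 4(d−1)/n) + O(1/n²)` as `n → ∞`. -/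
theorem a_nd_asymptotics (d : ℕ) (hd : 1 ≤ d) :
    (fun n : ℕ => (A n d : ℝ) / (Nat.factorial n : ℝ) -
        Real.exp (-2) * (1 + 4 * ((d : ℝ) - 1) / (n : ℝ))) =O[atTop]
      (fun n : ℕ => 1 / (n : ℝ) ^ 2) := by
  obtain ⟨K, -, hK⟩ := exists_abs_avoidProb_sub_exp_le d hd
  obtain ⟨M, N, hM⟩ := exists_abs_exp_sum_decayRate_sub_le d
  refine IsBigO.of_bound (K + M) (eventually_atTop.2 ⟨N + d + 12, fun n hn => ?_⟩)
  rw [Real.norm_eq_abs, Real.norm_of_nonneg (by positivity), A_div_factorial_eq, mul_one_div,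
    add_div]
  exact (abs_sub_le _ _ _).trans (add_le_add (hK n (n - d) (by omega) (by omega))
    (hM n (by omega)))
end

section
/- For every fixed integer d ≥ 1, the probability that a uniformly random permutation of {1,2,…,n} satisfies |π(i+d) − π(i)| ≠ d for all 1 ≤ i ≤ n−d tends to e^{−2} as n → ∞; that is, a_{n,d}/n! → e^{−2}. -/
open Filter Asymptotics

section CommonDarts

open Finset Equiv

variable {V : Type*} [Fintype V] (G : SimpleGraph V) [DecidableRel G.Adj]

/-- The ordered pairs of adjacent vertices. -/
def dartPairs : Finset (V × V) := univ.filter fun e => G.Adj e.1 e.2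

/-- The ordered pairs of adjacent vertices which `π` maps to adjacent vertices. -/
def commonDarts (π : Perm V) : Finset (V × V) :=
  univ.filter fun e => G.Adj e.1 e.2 ∧ G.Adj (π e.1) (π e.2)

/-- The neighbours `v` of `u` such that `π v` is a neighbour of `π u`. -/
def commonNbrs (π : Perm V) (u : V) : Finset V :=
  univ.filter fun v => G.Adj u v ∧ G.Adj (π u) (π v)

variable {G}

@[simp] lemma mem_dartPairs {e : V × V} : e ∈ dartPairs G ↔ G.Adj e.1 e.2 := by
  simp [dartPairs]

@[simp] lemma mem_commonDarts {π : Perm V} {e : V × V} :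
    e ∈ commonDarts G π ↔ G.Adj e.1 e.2 ∧ G.Adj (π e.1) (π e.2) := by
  simp [commonDarts]

@[simp] lemma mem_commonNbrs {π : Perm V} {u v : V} :
    v ∈ commonNbrs G π u ↔ G.Adj u v ∧ G.Adj (π u) (π v) := by
  simp [commonNbrs]

lemma sum_commonDarts_fst {M : Type*} [AddCommMonoid M] (π : Perm V) (F : V → M) :
    ∑ e ∈ commonDarts G π, F e.1 = ∑ u, #(commonNbrs G π u) • F u := by
  simp only [commonDarts, commonNbrs, sum_filter, Fintype.sum_prod_type, ← sum_const]

lemma sum_dartPairs_fst {M : Type*} [AddCommMonoid M] (F : V → M) :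
    ∑ e ∈ dartPairs G, F e.1 = ∑ u, G.degree u • F u := by
  simp only [dartPairs, sum_filter, Fintype.sum_prod_type, ← sum_const,
    ← SimpleGraph.card_neighborFinset_eq_degree, SimpleGraph.neighborFinset_eq_filter]

lemma sum_commonDarts_swap {M : Type*} [AddCommMonoid M] (π : Perm V) (F : V × V → M) :
    ∑ e ∈ commonDarts G π, F e.swap = ∑ e ∈ commonDarts G π, F e :=
  Finset.sum_bij' (fun e _ => e.swap) (fun e _ => e.swap) (by simp +contextual [G.adj_comm])
    (by simp +contextual [G.adj_comm]) (by simp) (by simp) (by simp)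

lemma sum_dartPairs_swap {M : Type*} [AddCommMonoid M] (F : V × V → M) :
    ∑ e ∈ dartPairs G, F e.swap = ∑ e ∈ dartPairs G, F e :=
  Finset.sum_bij' (fun e _ => e.swap) (fun e _ => e.swap) (by simp +contextual [G.adj_comm])
    (by simp +contextual [G.adj_comm]) (by simp) (by simp) (by simp)

lemma card_commonDarts_eq_sum (π : Perm V) :
    #(commonDarts G π) = ∑ u, #(commonNbrs G π u) := by
  simpa only [sum_const, smul_eq_mul, mul_one] using
    sum_commonDarts_fst (G := G) π (fun _ => (1 : ℕ))

variable [DecidableEq V]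

/-- A permutation sending `a` to `x` and `b` to `y`, provided `a ≠ b` and `x ≠ y`. -/
def pairPerm (a b x y : V) : Perm V := swap a x * swap b (swap a x y)

omit [Fintype V] in
lemma pairPerm_fst {a b x y : V} (hab : a ≠ b) (hxy : x ≠ y) : pairPerm a b x y a = x := by
  have h : a ≠ swap a x y := fun h => hxy (by simpa using congrArg (swap a x) h)
  rw [pairPerm, Perm.mul_apply, swap_apply_of_ne_of_ne hab h, swap_apply_left]

omit [Fintype V] in
lemma pairPerm_snd (a b x y : V) : pairPerm a b x y b = y := by
  simp [pairPerm]

omit [Fintype V] in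
lemma pairPerm_of_ne {a b x y z : V} (ha : z ≠ a) (hb : z ≠ b) (hx : z ≠ x) (hy : z ≠ y) :
    pairPerm a b x y z = z := by
  have h : z ≠ swap a x y := by
    rw [swap_apply_def]; split_ifs <;> assumption
  rw [pairPerm, Perm.mul_apply, swap_apply_of_ne_of_ne hb h, swap_apply_of_ne_of_ne ha hx]

/-- The permutation `π` modified so that it sends the pair `e` to the pair `f`. -/
def redirect (π : Perm V) (e f : V × V) : Perm V :=
  (pairPerm f.1 f.2 (π e.1) (π e.2))⁻¹ * π

lemma sum_redirect {M : Type*} [AddCommMonoid M] {e f : V × V} (he : e.1 ≠ e.2)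
    (hf : f.1 ≠ f.2) (F : Perm V → V × V → M) :
    ∑ π, F (redirect π e f) (π e.1, π e.2) =
      ∑ σ with (σ e.1, σ e.2) = f, ∑ p ∈ univ.offDiag, F σ p := by
  rw [← Finset.sum_product']
  refine Finset.sum_bij' (fun π _ => (redirect π e f, (π e.1, π e.2)))
    (fun q _ => pairPerm f.1 f.2 q.2.1 q.2.2 * q.1) ?_ ?_ ?_ ?_ ?_
  · intro π _
    have hπ : π e.1 ≠ π e.2 := π.injective.ne he
    simp only [mem_product, mem_filter, mem_univ, true_and, mem_offDiag]
    refine ⟨?_, hπ⟩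
    ext
    · simp only [redirect, Perm.mul_apply]
      rw [Perm.inv_eq_iff_eq, pairPerm_fst hf hπ]
    · simp only [redirect, Perm.mul_apply]
      rw [Perm.inv_eq_iff_eq, pairPerm_snd]
  · intros; exact mem_univ _
  · intro π _
    simp [redirect]
  · rintro ⟨σ, x, y⟩ hq
    simp only [mem_product, mem_filter, mem_univ, true_and, mem_offDiag] at hq
    obtain ⟨rfl, hxy⟩ := hq
    simp only [ne_eq] at hxy hf
    simp [redirect, pairPerm_fst hf hxy, pairPerm_snd]
  · intros; rfl

lemma sum_redirect_dartPairs {M : Type*} [AddCommMonoid M]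
    (F : Perm V → V × V → V × V → M) :
    ∑ π, ∑ e ∈ dartPairs G, ∑ f ∈ dartPairs G, F (redirect π e f) e (π e.1, π e.2) =
      ∑ σ, ∑ e ∈ commonDarts G σ, ∑ p ∈ univ.offDiag, F σ e p := by
  have h1 : ∀ e ∈ dartPairs G, ∀ f ∈ dartPairs G,
      ∑ π, F (redirect π e f) e (π e.1, π e.2) =
        ∑ σ : Perm V, if (σ e.1, σ e.2) = f then ∑ p ∈ univ.offDiag, F σ e p else 0 := by
    intro e he f hf
    rw [sum_redirect (mem_dartPairs.1 he).ne (mem_dartPairs.1 hf).ne (fun σ p => F σ e p),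
      sum_filter]
  rw [sum_comm]
  simp_rw [sum_comm (s := (univ : Finset (Perm V))) (t := dartPairs G)]
  rw [sum_congr rfl fun e he => sum_congr rfl fun f hf => h1 e he f hf]
  simp_rw [sum_comm (s := dartPairs G) (t := (univ : Finset (Perm V)))]
  refine sum_congr rfl fun σ _ => ?_
  have : commonDarts G σ = (dartPairs G).filter fun e => (σ e.1, σ e.2) ∈ dartPairs G := by
    ext; simp
  rw [this, sum_filter]
  simp only [Finset.sum_ite_eq]

lemma card_mul_sum_card_commonDarts :
    (Fintype.card V * (Fintype.card V - 1)) * ∑ σ : Perm V, #(commonDarts G σ) =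
      #(dartPairs G) ^ 2 * (Fintype.card V).factorial := by
  have h := sum_redirect_dartPairs (G := G) (fun _ _ _ => 1)
  simp only [sum_const, smul_eq_mul, mul_one, card_univ, offDiag_card, Fintype.card_perm,
    ← sum_mul] at h
  rw [Nat.mul_sub, mul_one, mul_comm, ← h]; ring

omit [Fintype V] in
lemma pairPerm_inv_mem {a b x y z : V} (hz : z ∈ ({a, b, x, y} : Finset V)) :
    (pairPerm a b x y)⁻¹ z ∈ ({a, b, x, y} : Finset V) := by
  by_contra hw
  have := hw
  simp only [mem_insert, mem_singleton, not_or] at this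
  obtain ⟨ha, hb, hx, hy⟩ := this
  have h := pairPerm_of_ne ha hb hx hy
  rw [← Perm.mul_apply, mul_inv_cancel, Perm.one_apply] at h
  exact hw (h ▸ hz)

omit [Fintype V] in
lemma redirect_apply_fst {π : Perm V} {e f : V × V} (he : e.1 ≠ e.2) (hf : f.1 ≠ f.2) :
    redirect π e f e.1 = f.1 := by
  rw [redirect, Perm.mul_apply, Perm.inv_eq_iff_eq, pairPerm_fst hf (π.injective.ne he)]

omit [Fintype V] in
lemma redirect_apply_snd (π : Perm V) (e f : V × V) :
    redirect π e f e.2 = f.2 := by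
  rw [redirect, Perm.mul_apply, Perm.inv_eq_iff_eq, pairPerm_snd]

/-- The positions at which `redirect π e f` may differ from `π`. -/
def touched (π : Perm V) (e f : V × V) : Finset V := {e.1, e.2, π⁻¹ f.1, π⁻¹ f.2}

omit [Fintype V] in
lemma redirect_apply_of_notMem {π : Perm V} {e f : V × V} {u : V} (hu : u ∉ touched π e f) :
    redirect π e f u = π u := by
  simp only [touched, mem_insert, mem_singleton, not_or, Perm.eq_inv_iff_eq] at hu
  rw [redirect, Perm.mul_apply, Perm.inv_eq_iff_eq, pairPerm_of_ne hu.2.2.1 hu.2.2.2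
    (π.injective.ne hu.1) (π.injective.ne hu.2.1)]

omit [Fintype V] in
lemma redirect_apply_of_mem {π : Perm V} {e f : V × V} (he : e.1 ≠ e.2) (hf : f.1 ≠ f.2) {u : V}
    (hu : u ∈ touched π e f) :
    u = e.1 ∨ u = e.2 ∨ u = (redirect π e f)⁻¹ (π e.1) ∨ u = (redirect π e f)⁻¹ (π e.2) := by
  have h1 : π u ∈ ({f.1, f.2, π e.1, π e.2} : Finset V) := by
    simp only [touched, mem_insert, mem_singleton, Perm.eq_inv_iff_eq] at hu ⊢
    rcases hu with rfl | rfl | h | h <;> simp_all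
  have h2 := pairPerm_inv_mem h1
  change redirect π e f u ∈ _ at h2
  simp only [mem_insert, mem_singleton] at h2
  rw [Perm.eq_inv_iff_eq, Perm.eq_inv_iff_eq]
  rcases h2 with h | h | h | h
  · rw [← redirect_apply_fst he hf] at h
    exact Or.inl ((redirect π e f).injective h)
  · rw [← redirect_apply_snd π e f] at h
    exact Or.inr (Or.inl ((redirect π e f).injective h))
  · simp [h]
  · simp [h]

lemma card_commonDarts_redirect {π : Perm V} {e f : V × V} (he : G.Adj e.1 e.2)
    (hf : G.Adj f.1 f.2) (h0 : ∀ u ∈ touched π e f, commonNbrs G π u = ∅)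
    (h1 : #(commonNbrs G (redirect π e f) e.1) ≤ 1) (h2 : #(commonNbrs G (redirect π e f) e.2) ≤ 1)
    (h3 : commonNbrs G (redirect π e f) ((redirect π e f)⁻¹ (π e.1)) = ∅)
    (h4 : commonNbrs G (redirect π e f) ((redirect π e f)⁻¹ (π e.2)) = ∅) :
    #(commonDarts G (redirect π e f)) = #(commonDarts G π) + 2 := by
  set σ := redirect π e f with hσ
  have hσ1 : σ e.1 = f.1 := redirect_apply_fst he.ne hf.ne
  have hσ2 : σ e.2 = f.2 := redirect_apply_snd π e f
  have hm1 : e.1 ∈ touched π e f := by simp [touched]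
  have hm2 : e.2 ∈ touched π e f := by simp [touched]
  have h0' : ∀ u ∈ touched π e f, ∀ v, G.Adj u v → ¬ G.Adj (π u) (π v) := by
    intro u hu v h h'
    have : v ∈ commonNbrs G π u := by simp [h, h']
    simp [h0 u hu] at this
  have key : ∀ u ∈ touched π e f, ∀ v, G.Adj u v → G.Adj (σ u) (σ v) →
      (u, v) = e ∨ (u, v) = e.swap := by
    intro u hu v h h'
    have hv : v ∈ commonNbrs G σ u := by simp [h, h']
    rcases redirect_apply_of_mem he.ne hf.ne hu with rfl | rfl | rfl | rfl
    · left
      have : e.2 ∈ commonNbrs G σ e.1 := by simp [he, hσ1, hσ2, hf]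
      rw [card_le_one.1 h1 _ hv _ this]
    · right
      have : e.1 ∈ commonNbrs G σ e.2 := by simp [he.symm, hσ1, hσ2, hf.symm]
      rw [card_le_one.1 h2 _ hv _ this]; rfl
    · rw [← hσ, h3] at hv; simp at hv
    · rw [← hσ, h4] at hv; simp at hv
  have hset : commonDarts G σ = insert e (insert e.swap (commonDarts G π)) := by
    ext ⟨u, v⟩
    simp only [mem_insert, mem_commonDarts]
    constructor
    · rintro ⟨h, h'⟩
      by_cases hu : u ∈ touched π e f
      · have := key u hu v h h'; tauto
      by_cases hv : v ∈ touched π e f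
      · rcases key v hv u h.symm h'.symm with h5 | h5
        · right; left; rw [← h5]; rfl
        · left; rw [← Prod.swap_swap e, ← h5]; rfl
      · rw [hσ, redirect_apply_of_notMem hu, redirect_apply_of_notMem hv] at h'
        tauto
    · rintro (rfl | h | ⟨h, h'⟩)
      · exact ⟨he, by simpa [hσ1, hσ2] using hf⟩
      · obtain ⟨rfl, rfl⟩ := Prod.mk.inj h
        exact ⟨he.symm, by simpa [hσ1, hσ2] using hf.symm⟩
      · have hu : u ∉ touched π e f := fun hu => h0' u hu v h h'
        have hv : v ∉ touched π e f := fun hv => h0' v hv u h.symm h'.symm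
        rw [hσ, redirect_apply_of_notMem hu, redirect_apply_of_notMem hv]
        exact ⟨h, h'⟩
  have hs : e.swap ∉ commonDarts G π := by
    simp only [mem_commonDarts, not_and]; exact h0' e.2 hm2 e.1
  have hes : e ∉ insert e.swap (commonDarts G π) := by
    simp only [mem_insert, mem_commonDarts, not_or, not_and]
    exact ⟨fun h => he.ne (congrArg Prod.fst h), h0' e.1 hm1 e.2⟩
  rw [hset, card_insert_of_notMem hes, card_insert_of_notMem hs]

lemma card_commonDarts_redirect_le {D : ℕ} (hG : ∀ u, G.degree u ≤ D) (π : Perm V) (e f : V × V) :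
    #(commonDarts G (redirect π e f)) ≤ #(commonDarts G π) + 8 * D := by
  set U := touched π e f
  have hU : #U ≤ 4 := card_le_four
  set N : Finset (V × V) := U.biUnion fun u => (G.neighborFinset u).image (u, ·) with hN
  have hNc : #N ≤ 4 * D :=
    (card_biUnion_le_card_mul _ _ D fun u _ => card_image_le.trans (by simpa using hG u)).trans
      (by gcongr)
  have hmem : ∀ u v, (u, v) ∈ N ↔ u ∈ U ∧ G.Adj u v := by
    intro u v
    simp [hN]
  have hsub : commonDarts G (redirect π e f) ⊆ commonDarts G π ∪ (N ∪ N.image Prod.swap) := by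
    rintro ⟨u, v⟩ h
    simp only [mem_commonDarts] at h
    obtain ⟨h, h'⟩ := h
    by_cases hu : u ∈ U
    · simp [hmem, hu, h]
    by_cases hv : v ∈ U
    · have : (u, v) ∈ N.image Prod.swap :=
        mem_image.2 ⟨(v, u), (hmem _ _).2 ⟨hv, h.symm⟩, rfl⟩
      simp only [mem_union]; tauto
    · rw [redirect_apply_of_notMem hu, redirect_apply_of_notMem hv] at h'
      simp [h, h']
  calc _ ≤ _ := card_le_card hsub
    _ ≤ #(commonDarts G π) + (#N + #(N.image Prod.swap)) :=
      (card_union_le _ _).trans (by gcongr; exact card_union_le _ _)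
    _ ≤ _ := by have := card_image_le (s := N) (f := Prod.swap); lia

lemma sum_card_commonNbrs_mul_pred_le (hG : ∀ u, G.degree u ≤ 2) :
    (Fintype.card V - 2) * ∑ σ : Perm V, ∑ u, #(commonNbrs G σ u) * (#(commonNbrs G σ u) - 1) ≤
      4 * ∑ σ : Perm V, #(commonDarts G σ) := by
  let S : Finset (Σ _ : Perm V, Σ _ : V, Σ _ : V × V, V) :=
    univ.sigma fun σ => univ.sigma fun u => (commonNbrs G σ u).offDiag.sigma fun q =>
      univ \ {σ u, σ q.1}
  let T : Finset (Σ _ : Perm V, Σ _ : V × V, V × V) :=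
    univ.sigma fun σ => (commonDarts G σ).sigma fun e =>
      G.neighborFinset e.1 ×ˢ G.neighborFinset (σ e.1)
  have hS : (Fintype.card V - 2) * ∑ σ : Perm V, ∑ u,
      #(commonNbrs G σ u) * (#(commonNbrs G σ u) - 1) ≤ #S := by
    simp only [S, card_sigma, mul_sum]
    refine sum_le_sum fun σ _ => sum_le_sum fun u _ => ?_
    rw [Nat.mul_sub, mul_one, ← offDiag_card, mul_comm, ← smul_eq_mul]
    refine card_nsmul_le_sum _ _ _ fun q _ => ?_
    refine le_trans ?_ (le_card_sdiff _ _)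
    rw [card_univ]
    have := card_le_two (a := σ u) (b := σ q.1)
    lia
  have hT : #T ≤ 4 * ∑ σ : Perm V, #(commonDarts G σ) := by
    simp only [T, card_sigma, mul_sum]
    refine sum_le_sum fun σ _ => ?_
    rw [mul_comm, ← smul_eq_mul]
    refine sum_le_card_nsmul _ _ _ fun e _ => ?_
    rw [card_product, SimpleGraph.card_neighborFinset_eq_degree,
      SimpleGraph.card_neighborFinset_eq_degree]
    exact Nat.mul_le_mul (hG _) (hG _)
  refine hS.trans (le_trans ?_ hT)
  refine card_le_card_of_injOn
    (fun x => ⟨swap (x.1 x.2.2.1.2) x.2.2.2 * x.1, (x.2.1, x.2.2.1.1), (x.2.2.1.2, x.1 x.2.2.1.2)⟩)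
    ?_ ?_
  · rintro ⟨σ, u, ⟨v, w⟩, z⟩ h
    simp only [S, mem_coe, mem_sigma, mem_univ, true_and, mem_offDiag, mem_commonNbrs,
      Finset.mem_sdiff, mem_insert, mem_singleton, not_or] at h
    obtain ⟨⟨⟨huv, huv'⟩, ⟨huw, huw'⟩, hvw⟩, hzu, hzv⟩ := h
    have h1 : swap (σ w) z (σ u) = σ u := swap_apply_of_ne_of_ne huw'.ne (Ne.symm hzu)
    have h2 : swap (σ w) z (σ v) = σ v :=
      swap_apply_of_ne_of_ne (σ.injective.ne hvw) (Ne.symm hzv)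
    simp only [T, mem_coe, mem_sigma, mem_univ, true_and, mem_commonDarts, mem_product,
      SimpleGraph.mem_neighborFinset, Perm.mul_apply, h1, h2]
    exact ⟨⟨huv, huv'⟩, huw, (G.mem_neighborFinset _ _).2 (by rwa [h1])⟩
  · rintro ⟨σ, u, ⟨v, w⟩, z⟩ - ⟨σ', u', ⟨v', w'⟩, z'⟩ - h
    simp only [Sigma.mk.injEq, Prod.mk.injEq, heq_eq_eq] at h
    obtain ⟨h, ⟨rfl, rfl⟩, rfl, hw⟩ := h
    have hz : z = z' := by
      have := congrArg (fun τ : Perm V => τ w) h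
      simpa [hw] using this
    subst hz
    rw [hw] at h
    obtain rfl := mul_left_cancel h
    rfl

/-- The deviation of `#(commonDarts G (redirect π e f))` from `#(commonDarts G π) + 2` is
detected on `π` or on `redirect π e f`. -/
lemma abs_indicator_sub_le (hG : ∀ u, G.degree u ≤ 2) (k : ℕ) {π : Perm V} {e f : V × V}
    (he : G.Adj e.1 e.2) (hf : G.Adj f.1 f.2) {σ : Perm V} (hσ : redirect π e f = σ) :
    |(if #(commonDarts G σ) = k + 2 then (1 : ℤ) else 0) -
        (if #(commonDarts G π) = k then 1 else 0)| ≤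
      ((#(commonNbrs G π e.1) + #(commonNbrs G π e.2) + #(commonNbrs G π (π⁻¹ f.1)) +
          #(commonNbrs G π (π⁻¹ f.2)) : ℕ) : ℤ) +
        ((if #(commonDarts G σ) ≤ k + 16 then
          (#(commonNbrs G σ e.1) - 1) + (#(commonNbrs G σ e.2) - 1) +
          #(commonNbrs G σ (σ⁻¹ (π e.1))) + #(commonNbrs G σ (σ⁻¹ (π e.2))) else 0 : ℕ) : ℤ) := by
  have hle := card_commonDarts_redirect_le hG π e f
  rw [hσ] at hle
  by_cases hA : #(commonNbrs G π e.1) + #(commonNbrs G π e.2) + #(commonNbrs G π (π⁻¹ f.1)) +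
      #(commonNbrs G π (π⁻¹ f.2)) = 0
  swap
  · split_ifs <;> simp only [sub_self, sub_zero, zero_sub, abs_neg, abs_zero, abs_one] <;> lia
  by_cases hB : (#(commonNbrs G σ e.1) - 1) + (#(commonNbrs G σ e.2) - 1) +
      #(commonNbrs G σ (σ⁻¹ (π e.1))) + #(commonNbrs G σ (σ⁻¹ (π e.2))) = 0
  swap
  · split_ifs <;> simp only [sub_self, sub_zero, zero_sub, abs_neg, abs_zero, abs_one] <;> lia
  have key : #(commonDarts G σ) = #(commonDarts G π) + 2 := by
    subst hσ
    simp only [Nat.add_eq_zero_iff, card_eq_zero] at hA hB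
    refine card_commonDarts_redirect he hf ?_ (by lia) (by lia) hB.1.2 hB.2
    intro u hu
    simp only [touched, mem_insert, mem_singleton] at hu
    rcases hu with rfl | rfl | rfl | rfl <;> tauto
  have : (#(commonDarts G σ) = k + 2) ↔ #(commonDarts G π) = k := by lia
  simp only [this, sub_self, abs_zero]
  positivity

omit [DecidableEq V] in
lemma sum_dartPairs_fst_le (hG : ∀ u, G.degree u ≤ 2) (F : V → ℕ) :
    ∑ e ∈ dartPairs G, F e.1 ≤ 2 * ∑ u, F u := by
  rw [sum_dartPairs_fst, mul_sum]
  exact sum_le_sum fun u _ => Nat.mul_le_mul_right _ (hG u)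

omit [DecidableEq V] in
lemma sum_dartPairs_snd_le (hG : ∀ u, G.degree u ≤ 2) (F : V → ℕ) :
    ∑ e ∈ dartPairs G, F e.2 ≤ 2 * ∑ u, F u := by
  rw [← sum_dartPairs_swap]
  exact sum_dartPairs_fst_le hG F

omit [DecidableEq V] in
lemma card_dartPairs_le (hG : ∀ u, G.degree u ≤ 2) : #(dartPairs G) ≤ 2 * Fintype.card V := by
  simpa using sum_dartPairs_fst_le hG (fun _ => 1)

omit [DecidableEq V] in
lemma sum_commonNbrs_inv (π : Perm V) :
    ∑ u, #(commonNbrs G π (π⁻¹ u)) = #(commonDarts G π) := by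
  rw [card_commonDarts_eq_sum]
  exact Equiv.sum_comp π⁻¹ fun u => #(commonNbrs G π u)

lemma sum_deviation_source_le (hG : ∀ u, G.degree u ≤ 2) :
    ∑ π : Perm V, ∑ e ∈ dartPairs G, ∑ f ∈ dartPairs G,
      (#(commonNbrs G π e.1) + #(commonNbrs G π e.2) + #(commonNbrs G π (π⁻¹ f.1)) +
          #(commonNbrs G π (π⁻¹ f.2))) ≤
      16 * Fintype.card V * ∑ π : Perm V, #(commonDarts G π) := by
  rw [mul_sum]
  refine sum_le_sum fun π _ => ?_
  have h1 := sum_dartPairs_fst_le hG fun u => #(commonNbrs G π u)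
  have h2 := sum_dartPairs_snd_le hG fun u => #(commonNbrs G π u)
  have h3 := sum_dartPairs_fst_le hG fun u => #(commonNbrs G π (π⁻¹ u))
  have h4 := sum_dartPairs_snd_le hG fun u => #(commonNbrs G π (π⁻¹ u))
  rw [← card_commonDarts_eq_sum] at h1 h2
  rw [sum_commonNbrs_inv] at h3 h4
  have hD := card_dartPairs_le hG
  simp only [sum_add_distrib, sum_const, smul_eq_mul, ← mul_sum]
  calc _ ≤ #(dartPairs G) * (8 * #(commonDarts G π)) := by
        rw [← mul_add, ← mul_add, ← mul_add]; gcongr; lia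
    _ ≤ (2 * Fintype.card V) * (8 * #(commonDarts G π)) := by gcongr
    _ = _ := by ring

lemma sum_deviation_target_le (k : ℕ) :
    ∑ σ : Perm V, ∑ e ∈ commonDarts G σ, ∑ p ∈ univ.offDiag,
      (if #(commonDarts G σ) ≤ k then
          (#(commonNbrs G σ e.1) - 1) + (#(commonNbrs G σ e.2) - 1) +
          #(commonNbrs G σ (σ⁻¹ p.1)) + #(commonNbrs G σ (σ⁻¹ p.2)) else 0) ≤
      2 * Fintype.card V ^ 2 *
          ∑ σ : Perm V, ∑ u, #(commonNbrs G σ u) * (#(commonNbrs G σ u) - 1) +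
        2 * Fintype.card V * k * ∑ σ : Perm V, #(commonDarts G σ) := by
  rw [mul_sum, mul_sum, ← sum_add_distrib]
  refine sum_le_sum fun σ _ => ?_
  split_ifs with hk
  swap
  · simp
  have hsub : (univ : Finset V).offDiag ⊆ univ ×ˢ univ := fun _ _ => by simp
  have h1 := sum_commonDarts_fst (G := G) σ fun u => #(commonNbrs G σ u) - 1
  have h2 := sum_commonDarts_swap (G := G) σ fun e => #(commonNbrs G σ e.1) - 1
  simp only [Prod.fst_swap, smul_eq_mul] at h1 h2
  have h3 := sum_commonNbrs_inv (G := G) σ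
  calc _ ≤ ∑ e ∈ commonDarts G σ, ∑ p ∈ univ ×ˢ univ, _ :=
        sum_le_sum fun e _ => sum_le_sum_of_subset hsub
    _ = 2 * Fintype.card V ^ 2 * ∑ u, #(commonNbrs G σ u) * (#(commonNbrs G σ u) - 1) +
        2 * Fintype.card V * #(commonDarts G σ) * #(commonDarts G σ) := by
      simp only [sum_add_distrib, sum_const, smul_eq_mul, sum_product, card_univ, ← mul_sum, h3,
        card_product, h2, h1]
      ring
    _ ≤ _ := by gcongr

lemma abs_sum_redirect_sub_le (hG : ∀ u, G.degree u ≤ 2) (k : ℕ) :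
    |((Fintype.card V * (Fintype.card V - 1) * ((k + 2) *
        #{σ : Perm V | #(commonDarts G σ) = k + 2}) : ℕ) : ℤ) -
        ((#(dartPairs G) ^ 2 * #{π : Perm V | #(commonDarts G π) = k} : ℕ) : ℤ)| ≤
      ((16 * Fintype.card V * ∑ π : Perm V, #(commonDarts G π) +
        (2 * Fintype.card V ^ 2 *
          ∑ σ : Perm V, ∑ u, #(commonNbrs G σ u) * (#(commonNbrs G σ u) - 1) +
        2 * Fintype.card V * (k + 16) * ∑ σ : Perm V, #(commonDarts G σ)) : ℕ) : ℤ) := by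
  have e1 : ((Fintype.card V * (Fintype.card V - 1) * ((k + 2) *
        #{σ : Perm V | #(commonDarts G σ) = k + 2}) : ℕ) : ℤ) =
      ∑ π, ∑ e ∈ dartPairs G, ∑ f ∈ dartPairs G,
        if #(commonDarts G (redirect π e f)) = k + 2 then (1 : ℤ) else 0 := by
    rw [sum_redirect_dartPairs fun σ _ _ => if #(commonDarts G σ) = k + 2 then (1 : ℤ) else 0]
    have : ∀ (σ : Perm V) (c : ℤ), #(commonDarts G σ) *
        (c * if #(commonDarts G σ) = k + 2 then (1 : ℤ) else 0) =
        c * (k + 2 : ℕ) * if #(commonDarts G σ) = k + 2 then 1 else 0 := by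
      intro σ c; split_ifs with h <;> simp [h, mul_comm]
    simp only [sum_const, nsmul_eq_mul, offDiag_card, card_univ, this, ← mul_sum, sum_boole,
      ← Nat.mul_sub_one]
    push_cast
    ring
  have e2 : ((#(dartPairs G) ^ 2 * #{π : Perm V | #(commonDarts G π) = k} : ℕ) : ℤ) =
      ∑ π : Perm V, ∑ e ∈ dartPairs G, ∑ f ∈ dartPairs G,
        if #(commonDarts G π) = k then (1 : ℤ) else 0 := by
    simp only [sum_const, nsmul_eq_mul, ← mul_sum, sum_boole]
    push_cast; ring
  rw [e1, e2]
  simp only [← sum_sub_distrib]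
  have h1 := sum_deviation_source_le hG
  have h2 := sum_deviation_target_le (G := G) (k + 16)
  rw [← sum_redirect_dartPairs fun σ e p => if #(commonDarts G σ) ≤ k + 16 then
          (#(commonNbrs G σ e.1) - 1) + (#(commonNbrs G σ e.2) - 1) +
          #(commonNbrs G σ (σ⁻¹ p.1)) + #(commonNbrs G σ (σ⁻¹ p.2)) else 0] at h2
  refine le_trans ?_ (Int.ofNat_le.2 (add_le_add h1 h2))
  rw [Nat.cast_add, Nat.cast_sum, Nat.cast_sum, ← sum_add_distrib]
  refine (abs_sum_le_sum_abs _ _).trans (sum_le_sum fun π _ => ?_)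
  rw [Nat.cast_sum, Nat.cast_sum, ← sum_add_distrib]
  refine (abs_sum_le_sum_abs _ _).trans (sum_le_sum fun e he => ?_)
  rw [Nat.cast_sum, Nat.cast_sum, ← sum_add_distrib]
  refine (abs_sum_le_sum_abs _ _).trans (sum_le_sum fun f hf => ?_)
  exact abs_indicator_sub_le hG k (mem_dartPairs.1 he) (mem_dartPairs.1 hf) rfl

omit [DecidableEq V] in
lemma even_card_commonDarts (π : Perm V) : Even #(commonDarts G π) := by
  rw [← ZMod.natCast_eq_zero_iff_even, ← nsmul_one, ← sum_const]
  exact sum_involution (fun e _ => e.swap) (fun _ _ => by decide)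
    (fun e he _ h => (mem_commonDarts.1 he).1.ne (congrArg Prod.snd h))
    (by simp +contextual [G.adj_comm]) (by simp)

lemma sum_card_commonDarts_le (hG : ∀ u, G.degree u ≤ 2) (hV : 2 ≤ Fintype.card V) :
    ∑ σ : Perm V, #(commonDarts G σ) ≤ 8 * (Fintype.card V).factorial := by
  have h := card_mul_sum_card_commonDarts (G := G)
  have hD := card_dartPairs_le hG
  set N := Fintype.card V
  have h1 : N ^ 2 * ∑ σ : Perm V, #(commonDarts G σ) ≤ N ^ 2 * (8 * N.factorial) := by
    calc _ ≤ 2 * ((N * (N - 1)) * ∑ σ : Perm V, #(commonDarts G σ)) := by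
          rw [← mul_assoc, sq, mul_left_comm]
          gcongr
          lia
      _ ≤ 2 * ((2 * N) ^ 2 * N.factorial) := by rw [h]; gcongr
      _ = _ := by ring
  exact Nat.le_of_mul_le_mul_left h1 (by positivity)

lemma abs_card_commonDarts_recurrence_le (hG : ∀ u, G.degree u ≤ 2) (hV : 3 ≤ Fintype.card V)
    (k : ℕ) :
    |(Fintype.card V * (Fintype.card V - 1) * ((k + 2) *
        #{σ : Perm V | #(commonDarts G σ) = k + 2}) : ℝ) -
        #(dartPairs G) ^ 2 * #{π : Perm V | #(commonDarts G π) = k}| ≤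
      (576 + 16 * k) * Fintype.card V * (Fintype.card V).factorial := by
  have h := abs_sum_redirect_sub_le hG k
  have hM := sum_card_commonDarts_le hG (by lia)
  have hQ := sum_card_commonNbrs_mul_pred_le hG
  set N := Fintype.card V
  set M := ∑ σ : Perm V, #(commonDarts G σ)
  set Q := ∑ σ : Perm V, ∑ u, #(commonNbrs G σ u) * (#(commonNbrs G σ u) - 1)
  have hQ' : N * Q ≤ 12 * M := by
    calc N * Q ≤ (3 * (N - 2)) * Q := by gcongr; lia
      _ = 3 * ((N - 2) * Q) := by ring
      _ ≤ 3 * (4 * M) := by gcongr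
      _ = _ := by ring
  have hE : 16 * N * M + (2 * N ^ 2 * Q + 2 * N * (k + 16) * M) ≤
      (576 + 16 * k) * N * N.factorial := by
    calc _ = 2 * N * (N * Q) + (48 + 2 * k) * N * M := by ring
      _ ≤ 2 * N * (12 * M) + (48 + 2 * k) * N * M := by gcongr
      _ = (72 + 2 * k) * N * M := by ring
      _ ≤ (72 + 2 * k) * N * (8 * N.factorial) := by gcongr
      _ = _ := by ring
  have h' := h.trans (Int.ofNat_le.2 hE)
  have h'' := (Int.cast_le (R := ℝ)).2 h'
  push_cast [Nat.cast_sub (show 1 ≤ N by lia)] at h''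
  exact h''

lemma mul_factorial_sub_sum_card_le (K : ℕ) :
    (2 * K * ((Fintype.card V).factorial -
      ∑ k ∈ range K, (#{π : Perm V | #(commonDarts G π) = 2 * k} : ℝ)) : ℝ) ≤
      ∑ σ : Perm V, #(commonDarts G σ) := by
  have h1 : ∑ k ∈ range K, #{π : Perm V | #(commonDarts G π) = 2 * k} =
      #{π : Perm V | #(commonDarts G π) < 2 * K} := by
    rw [card_eq_sum_card_fiberwise (f := fun π => #(commonDarts G π) / 2) (t := range K)]
    · refine sum_congr rfl fun k hk => congrArg card ?_
      ext π
      have := even_card_commonDarts (G := G) π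
      simp only [mem_filter, mem_univ, true_and, mem_range] at hk ⊢
      obtain ⟨m, hm⟩ := this
      lia
    · intro π hπ
      simp only [mem_coe, mem_filter, mem_univ, true_and, mem_range] at hπ ⊢
      lia
  have h2 : #{π : Perm V | #(commonDarts G π) < 2 * K} +
      #{π : Perm V | ¬ #(commonDarts G π) < 2 * K} = (Fintype.card V).factorial := by
    rw [card_filter_add_card_filter_not, card_univ, Fintype.card_perm]
  have h3 : #{π : Perm V | ¬ #(commonDarts G π) < 2 * K} * (2 * K) ≤
      ∑ σ : Perm V, #(commonDarts G σ) := by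
    refine le_trans ?_
      (sum_le_sum_of_subset (filter_subset (fun π => ¬ #(commonDarts G π) < 2 * K) univ))
    rw [← smul_eq_mul]
    exact card_nsmul_le_sum _ _ _ fun π hπ => by simpa using hπ
  rw [← Nat.cast_sum, h1, ← h2]
  push_cast
  rw [add_sub_cancel_left, mul_comm]
  exact_mod_cast h3

lemma sum_card_commonDarts_eq_le (K : ℕ) :
    ∑ k ∈ range K, #{π : Perm V | #(commonDarts G π) = 2 * k} ≤ (Fintype.card V).factorial := by
  rw [← Fintype.card_perm, ← card_univ, ← card_biUnion]
  · exact card_le_card (subset_univ _)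
  · intro i _ j _ hij
    exact disjoint_filter.2 fun π _ h h' => hij (by lia)

end CommonDarts

/-- Nonnegative sequences with uniformly small tails and total mass at most one which
asymptotically satisfy the recurrence of the Poisson distribution converge to it at zero. -/
lemma tendsto_exp_neg_of_recurrence {lam C : ℝ} {p : ℕ → ℕ → ℝ}
    (hrec : ∀ k : ℕ, Tendsto (fun n => (k + 1) * p n (k + 1) - lam * p n k) atTop (nhds 0))
    (hp : ∀ n k, 0 ≤ p n k) (hsum : ∀ n K, ∑ k ∈ Finset.range K, p n k ≤ 1)
    (htail : ∀ᶠ n in atTop, ∀ K : ℕ, K * (1 - ∑ k ∈ Finset.range K, p n k) ≤ C) :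
    Tendsto (fun n => p n 0) atTop (nhds (Real.exp (-lam))) := by
  have h1 : ∀ k : ℕ, Tendsto (fun n => p n k - lam ^ k / k.factorial * p n 0) atTop (nhds 0) := by
    intro k
    induction k with
    | zero => simp
    | succ k ih =>
      have := ((hrec k).add (ih.const_mul lam)).const_mul ((k + 1 : ℝ)⁻¹)
      simp only [mul_zero, add_zero] at this
      refine this.congr fun n => ?_
      rw [Nat.factorial_succ]
      push_cast
      field_simp
      ring
  have h2 : ∀ K : ℕ, Tendsto (fun n => ∑ k ∈ Finset.range K, p n k -
      (∑ k ∈ Finset.range K, lam ^ k / k.factorial) * p n 0) atTop (nhds 0) := by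
    intro K
    have := tendsto_finsetSum (Finset.range K) fun k _ => h1 k
    simpa [Finset.sum_sub_distrib, Finset.sum_mul] using this
  have hexp : Tendsto (fun K => ∑ k ∈ Finset.range K, lam ^ k / k.factorial) atTop
      (nhds (Real.exp lam)) := by
    have := NormedSpace.expSeries_div_hasSum_exp lam
    rw [← Real.exp_eq_exp_ℝ] at this
    exact this.tendsto_sum_nat
  have h3 : Tendsto (fun n => Real.exp lam * p n 0) atTop (nhds 1) := by
    rw [Metric.tendsto_atTop]
    intro ε hε
    obtain ⟨K, hK1, hK2⟩ := ((Metric.tendsto_nhds.1 hexp (ε / 3) (by positivity)).and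
      (eventually_gt_atTop ⌈|C| * 3 / ε⌉₊)).exists
    have hK3 : |C| * 3 / ε < K := (Nat.le_ceil _).trans_lt (by exact_mod_cast hK2)
    have hK0 : (0 : ℝ) < K := lt_of_le_of_lt (by positivity) hK3
    rw [← eventually_atTop (p := fun n => dist (Real.exp lam * p n 0) 1 < ε)]
    filter_upwards [htail, Metric.tendsto_nhds.1 (h2 K) (ε / 3) (by positivity)] with n hn1 hn2
    rw [Real.dist_eq] at hK1 hn2 ⊢
    set S := ∑ k ∈ Finset.range K, lam ^ k / k.factorial
    set T := ∑ k ∈ Finset.range K, p n k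
    have ha : |(Real.exp lam - S) * p n 0| ≤ ε / 3 := by
      have hp1 : p n 0 ≤ 1 := by simpa using hsum n 1
      rw [abs_mul, abs_sub_comm, abs_of_nonneg (hp n 0)]
      nlinarith [hp n 0]
    have hb : |T - 1| < ε / 3 := by
      rw [abs_sub_comm, abs_of_nonneg (sub_nonneg.2 (hsum n K))]
      have h4 : K * (1 - T) ≤ |C| := (hn1 K).trans (le_abs_self C)
      rw [div_lt_iff₀ hε] at hK3
      by_contra! h5
      nlinarith
    rw [sub_zero] at hn2
    rw [abs_le] at ha
    rw [abs_lt] at hb hn2 ⊢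
    constructor <;> linarith
  have h4 := h3.const_mul (Real.exp (-lam))
  rw [mul_one] at h4
  refine h4.congr fun n => ?_
  rw [← mul_assoc, ← Real.exp_add, neg_add_cancel, Real.exp_zero, one_mul]

/-- If `G n` is a graph on `n` vertices with maximal degree at most two and asymptotically `n`
edges, then a random permutation of the vertices preserves no edge with probability tending to
`e⁻²`. -/
theorem tendsto_card_commonDarts_eq_zero (G : ∀ n, SimpleGraph (Fin n))
    [∀ n, DecidableRel (G n).Adj] (hG : ∀ n u, (G n).degree u ≤ 2)
    (hD : Tendsto (fun n : ℕ => ((dartPairs (G n)).card : ℝ) / n) atTop (nhds 2)) :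
    Tendsto (fun n : ℕ => ((Finset.univ.filter fun π : Equiv.Perm (Fin n) =>
      (commonDarts (G n) π).card = 0).card : ℝ) / n.factorial) atTop
      (nhds (Real.exp (-2))) := by
  set c : ℕ → ℕ → ℝ := fun n k => ((Finset.univ.filter fun π : Equiv.Perm (Fin n) =>
      (commonDarts (G n) π).card = k).card : ℝ) with hc
  have hf : ∀ n : ℕ, (0 : ℝ) < n.factorial := fun n => by positivity
  refine tendsto_exp_neg_of_recurrence (C := 4) (p := fun n k => c n (2 * k) / n.factorial)
    ?_ (fun n k => by positivity) ?_ ?_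
  · intro k
    have hratio : Tendsto (fun n : ℕ => ((dartPairs (G n)).card : ℝ) ^ 2 / (n * (n - 1))) atTop
        (nhds 4) := by
      have h1 : Tendsto (fun n : ℕ => 1 - 1 / (n : ℝ)) atTop (nhds (1 - 0)) :=
        tendsto_const_nhds.sub tendsto_one_div_atTop_nhds_zero_nat
      have h2 := (hD.pow 2).div h1 (by norm_num)
      norm_num at h2
      refine h2.congr' ?_
      filter_upwards [eventually_ge_atTop 2] with n hn
      have hn' : (2 : ℝ) ≤ n := by exact_mod_cast hn
      have : (n : ℝ) - 1 ≠ 0 := by linarith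
      simp only [Pi.div_apply]
      field_simp
    have hle : ∀ n : ℕ, c n (2 * k) / n.factorial ≤ 1 := fun n => by
      rw [div_le_one (hf n), hc, Nat.cast_le]
      refine (Finset.card_le_univ _).trans ?_
      rw [Fintype.card_perm, Fintype.card_fin]
    have hA : Tendsto (fun n : ℕ => (2 * k + 2) * (c n (2 * k + 2) / n.factorial) -
        (dartPairs (G n)).card ^ 2 / (n * (n - 1)) * (c n (2 * k) / n.factorial)) atTop
        (nhds 0) := by
      have hlim : Tendsto (fun n : ℕ => (576 + 16 * ((2 * k : ℕ) : ℝ)) / ((n : ℝ) - 1)) atTop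
          (nhds 0) :=
        tendsto_const_nhds.div_atTop
          (tendsto_atTop_add_const_right _ _ tendsto_natCast_atTop_atTop)
      refine squeeze_zero_norm' ?_ hlim
      filter_upwards [eventually_ge_atTop 3] with n hn
      have hn' : (3 : ℝ) ≤ n := by exact_mod_cast hn
      have h := abs_card_commonDarts_recurrence_le (hG n) (by simpa using hn) (2 * k)
      simp only [Fintype.card_fin] at h
      have hpos : (0 : ℝ) < n * (n - 1) * n.factorial :=
        mul_pos (mul_pos (by linarith) (by linarith)) (hf n)
      have hn1 : (n : ℝ) - 1 ≠ 0 := by linarith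
      have e1 : (2 * k + 2) * (c n (2 * k + 2) / n.factorial) -
          (dartPairs (G n)).card ^ 2 / (n * (n - 1)) * (c n (2 * k) / n.factorial) =
          ((n * (n - 1) * (((2 * k : ℕ) + 2) * c n (2 * k + 2)) : ℝ) -
            (dartPairs (G n)).card ^ 2 * c n (2 * k)) / (n * (n - 1) * n.factorial) := by
        have := (hf n).ne'
        push_cast
        field_simp
      rw [e1, Real.norm_eq_abs, abs_div, abs_of_pos hpos, div_le_iff₀ hpos]
      refine h.trans (le_of_eq ?_)
      field_simp
    have hB : Tendsto (fun n : ℕ => ((dartPairs (G n)).card ^ 2 / (n * (n - 1)) - 4) *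
        (c n (2 * k) / n.factorial)) atTop (nhds 0) := by
      have h0 := (hratio.sub_const 4).norm
      norm_num at h0
      refine squeeze_zero_norm (fun n => ?_) h0
      rw [norm_mul, Real.norm_eq_abs, Real.norm_eq_abs,
        abs_of_nonneg (show 0 ≤ c n (2 * k) / n.factorial by positivity)]
      exact mul_le_of_le_one_right (abs_nonneg _) (hle n)
    have := (hA.add hB).const_mul (1 / 2)
    simp only [add_zero, mul_zero] at this
    refine this.congr fun n => ?_
    rw [show 2 * (k + 1) = 2 * k + 2 by ring]
    ring
  · intro n K
    rw [← Finset.sum_div, div_le_one (hf n), hc]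
    have := sum_card_commonDarts_eq_le (G := G n) K
    rw [Fintype.card_fin] at this
    beta_reduce
    exact_mod_cast this
  · filter_upwards [eventually_ge_atTop 2] with n hn K
    have h1 := mul_factorial_sub_sum_card_le (G := G n) K
    have h2 := sum_card_commonDarts_le (hG n) (by simpa using hn)
    rw [Fintype.card_fin] at h1 h2
    have h3 : ((∑ σ, (commonDarts (G n) σ).card : ℕ) : ℝ) ≤ 8 * n.factorial := by
      exact_mod_cast h2
    push_cast at h3
    rw [← Finset.sum_div, ← div_self (hf n).ne', ← sub_div, ← mul_div_assoc, div_le_iff₀ (hf n)]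
    simp only [hc]
    push_cast at h1
    linarith

/-- The graph on `Fin n` in which two vertices are adjacent if they differ by `d`. -/
def distGraph (d : ℕ) (hd : 1 ≤ d) (n : ℕ) : SimpleGraph (Fin n) where
  Adj i j := (i : ℕ) + d = j ∨ (j : ℕ) + d = i
  symm := ⟨fun _ _ => Or.symm⟩
  loopless := ⟨fun i h => by lia⟩

lemma distGraph_adj {d : ℕ} {hd : 1 ≤ d} {n : ℕ} {i j : Fin n} :
    (distGraph d hd n).Adj i j ↔ (i : ℕ) + d = j ∨ (j : ℕ) + d = i :=
  Iff.rfl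

instance (d : ℕ) (hd : 1 ≤ d) (n : ℕ) : DecidableRel (distGraph d hd n).Adj :=
  fun i j => inferInstanceAs (Decidable ((i : ℕ) + d = j ∨ (j : ℕ) + d = i))

lemma degree_distGraph_le (d : ℕ) (hd : 1 ≤ d) (n : ℕ) (u : Fin n) :
    (distGraph d hd n).degree u ≤ 2 := by
  rw [← SimpleGraph.card_neighborFinset_eq_degree]
  refine (Finset.card_le_card_of_injOn (t := {(u : ℕ) + d, (u : ℕ) - d})
    (fun v : Fin n => (v : ℕ)) ?_ (fun _ _ _ _ h => Fin.ext h)).trans Finset.card_le_two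
  intro v hv
  simp only [Finset.mem_coe, SimpleGraph.mem_neighborFinset, distGraph_adj] at hv
  simp only [Finset.coe_insert, Finset.coe_singleton, Set.mem_insert_iff, Set.mem_singleton_iff]
  lia

lemma card_dartPairs_distGraph (d : ℕ) (hd : 1 ≤ d) (n : ℕ) :
    (dartPairs (distGraph d hd n)).card = 2 * (n - d) := by
  have h1 : (Finset.univ.filter fun e : Fin n × Fin n => (e.1 : ℕ) + d = e.2).card = n - d := by
    rw [← Finset.card_range (n - d)]
    refine Finset.card_bij' (fun e _ => (e.1 : ℕ))
      (fun i hi => (⟨i, by rw [Finset.mem_range] at hi; lia⟩,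
        ⟨i + d, by rw [Finset.mem_range] at hi; lia⟩)) ?_ ?_ ?_ ?_
    · rintro ⟨i, j⟩ h
      simp only [Finset.mem_filter, Finset.mem_univ, true_and, Finset.mem_range] at h ⊢
      lia
    · simp
    · rintro ⟨i, j⟩ h
      simp only [Finset.mem_filter, Finset.mem_univ, true_and] at h
      ext <;> simp [h]
    · simp
  have h2 : (Finset.univ.filter fun e : Fin n × Fin n => (e.2 : ℕ) + d = e.1).card = n - d := by
    rw [← h1]
    exact Finset.card_bij' (fun e _ => e.swap) (fun e _ => e.swap) (by simp) (by simp)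
      (by simp) (by simp)
  have h3 : dartPairs (distGraph d hd n) =
      (Finset.univ.filter fun e : Fin n × Fin n => (e.1 : ℕ) + d = e.2) ∪
        (Finset.univ.filter fun e : Fin n × Fin n => (e.2 : ℕ) + d = e.1) := by
    ext e
    simp only [mem_dartPairs, distGraph_adj, Finset.mem_union, Finset.mem_filter, Finset.mem_univ,
      true_and]
  rw [h3, Finset.card_union_of_disjoint, h1, h2, two_mul]
  exact Finset.disjoint_filter.2 fun e _ h h' => by lia

lemma A_eq_card (d : ℕ) (hd : 1 ≤ d) (n : ℕ) :
    A n d = (Finset.univ.filter fun π : Equiv.Perm (Fin n) =>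
      (commonDarts (distGraph d hd n) π).card = 0).card := by
  rw [A, ← Set.ncard_coe_finset]
  congr 1
  ext π
  simp only [Set.mem_ofPred_eq, Finset.coe_filter, Finset.mem_univ, true_and, Finset.card_eq_zero,
    Finset.eq_empty_iff_forall_notMem, mem_commonDarts, Prod.forall, distGraph_adj, not_and]
  constructor
  · rintro h i j (hij | hij) h'
    · have := h i (by lia)
      rw [show (⟨(i : ℕ) + d, by lia⟩ : Fin n) = j from Fin.ext hij] at this
      lia
    · have := h j (by lia)
      rw [show (⟨(j : ℕ) + d, by lia⟩ : Fin n) = i from Fin.ext hij] at this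
      lia
  · intro h i hi h'
    refine h i ⟨i + d, hi⟩ (Or.inl rfl) ?_
    clear h
    omega

/-- For fixed `d ≥ 1`, `a_{n,d}/n! → e^{−2}` as `n → ∞`. -/
theorem a_nd_tendsto (d : ℕ) (hd : 1 ≤ d) :
    Tendsto (fun n : ℕ => (A n d : ℝ) / (Nat.factorial n : ℝ)) atTop
      (nhds (Real.exp (-2))) := by
  simp_rw [A_eq_card d hd]
  refine tendsto_card_commonDarts_eq_zero (distGraph d hd) (degree_distGraph_le d hd) ?_
  have h : Tendsto (fun n : ℕ => 2 - 2 * (d : ℝ) / n) atTop (nhds (2 - 0)) :=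
    tendsto_const_nhds.sub (tendsto_const_div_atTop_nhds_zero_nat _)
  rw [sub_zero] at h
  refine h.congr' ?_
  filter_upwards [eventually_ge_atTop d] with n hn
  have hn0 : (n : ℝ) ≠ 0 := by exact_mod_cast (by lia : n ≠ 0)
  rw [card_dartPairs_distGraph]
  push_cast [Nat.cast_sub hn]
  field_simp
end

section
/- The probability that a uniformly random permutation of {1,2,…,n} satisfies the circular non-adjacency condition tends to e^{−2} as n → ∞; that is, a_{n,0}/n! → e^{−2}. -/
open Filter Asymptotics

/-- `a_{n,0}`: the number of permutations `π` of `{1,…,n}` (realized as permutations of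
`ZMod n`) such that `π(i+1) − π(i) ≢ ±1 (mod n)` for all `i`, indices taken cyclically. -/
noncomputable def A0 (n : ℕ) : ℕ :=
  Set.ncard {π : Equiv.Perm (ZMod n) |
    ∀ i : ZMod n, π (i + 1) - π i ≠ 1 ∧ π (i + 1) - π i ≠ -1}

open Finset Equiv

/-- `x` and `y` are neighbours on the cycle `ZMod n`. -/
def CycAdj {n : ℕ} (x y : ZMod n) : Prop := y - x = 1 ∨ y - x = -1

instance {n : ℕ} (x y : ZMod n) : Decidable (CycAdj x y) :=
  inferInstanceAs (Decidable (_ ∨ _))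

theorem CycAdj.symm {n : ℕ} {x y : ZMod n} (h : CycAdj x y) : CycAdj y x := by
  rcases h with h | h
  · right; rw [← h]; ring
  · left; rw [← neg_sub, h, neg_neg]

theorem cycAdj_comm {n : ℕ} {x y : ZMod n} : CycAdj x y ↔ CycAdj y x :=
  ⟨CycAdj.symm, CycAdj.symm⟩

/-- The positions at which a permutation sends cyclic neighbours to cyclic neighbours. -/
def adjSet {n : ℕ} [NeZero n] (π : Perm (ZMod n)) : Finset (ZMod n) :=
  {i | CycAdj (π i) (π (i + 1))}

/-- The number of permutations with exactly `k` adjacencies. -/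
def adjNum (n : ℕ) [NeZero n] (k : ℕ) : ℕ := #{π : Perm (ZMod n) | #(adjSet π) = k}

section Counting

variable {n : ℕ} [NeZero n]

theorem filter_cycAdj_eq (π : Perm (ZMod n)) (x : ZMod n) :
    ({d | CycAdj x (π d)} : Finset (ZMod n)) = {π.symm (x + 1), π.symm (x - 1)} := by
  ext d
  simp only [mem_filter, mem_univ, true_and, mem_insert, mem_singleton, CycAdj,
    Equiv.eq_symm_apply, sub_eq_iff_eq_add]
  rw [add_comm 1 x, neg_add_eq_sub]

theorem card_filter_cycAdj_le (π : Perm (ZMod n)) (x : ZMod n) :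
    #{d | CycAdj x (π d)} ≤ 2 := by
  rw [filter_cycAdj_eq]
  exact card_le_two

theorem card_filter_cycAdj (hn : 3 ≤ n) (π : Perm (ZMod n)) (x : ZMod n) :
    #{d | CycAdj x (π d)} = 2 := by
  have : Fact (2 < n) := ⟨hn⟩
  rw [filter_cycAdj_eq, card_pair]
  intro h
  have h1 := π.symm.injective h
  rw [sub_eq_add_neg, add_right_inj] at h1
  exact ZMod.neg_one_ne_one h1.symm

/-- If `P` only depends on the values of a permutation on `T`, up to rearranging the others, then
`P` together with adjacency of the values at `c ∈ T` and `d ∉ T` costs a factor `2 / (n - #T)`. -/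
theorem card_and_cycAdj_le (P : Perm (ZMod n) → Prop) [DecidablePred P] (T : Finset (ZMod n))
    {c d : ZMod n} (hc : c ∈ T) (hd : d ∉ T)
    (hP : ∀ π d', d' ∉ T → P π → P (π * swap d d')) :
    (n - #T) * #{π | P π ∧ CycAdj (π c) (π d)} ≤ 2 * #{π | P π} := by
  have h1 : ∀ d' ∈ Tᶜ, #{π | P π ∧ CycAdj (π c) (π d)} ≤ #{π | P π ∧ CycAdj (π c) (π d')} := by
    intro d' hd'
    rw [mem_compl] at hd'
    refine card_le_card_of_injOn (fun π => π * swap d d') ?_ (mul_left_injective _).injOn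
    intro π hπ
    simp only [coe_filter, mem_univ, true_and, Set.mem_ofPred_eq] at hπ ⊢
    refine ⟨hP π d' hd' hπ.1, ?_⟩
    rw [Perm.mul_apply, Perm.mul_apply, swap_apply_right, swap_apply_of_ne_of_ne]
    · exact hπ.2
    · rintro rfl; exact hd hc
    · rintro rfl; exact hd' hc
  have h2 := card_nsmul_le_sum _ _ _ h1
  rw [card_compl, ZMod.card, smul_eq_mul] at h2
  refine h2.trans ?_
  have h3 : ∀ d', #{π | P π ∧ CycAdj (π c) (π d')} =
      ∑ π ∈ ({π | P π} : Finset (Perm (ZMod n))), if CycAdj (π c) (π d') then 1 else 0 := by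
    intro d'
    rw [← card_filter, filter_filter]
  simp_rw [h3]
  rw [sum_comm, mul_comm, ← smul_eq_mul]
  refine sum_le_card_nsmul _ _ _ fun π _ => ?_
  rw [← card_filter]
  exact (card_le_card (filter_subset_filter _ (subset_univ _))).trans
    (card_filter_cycAdj_le π (π c))

theorem card_perm_zmod : #(univ : Finset (Perm (ZMod n))) = n.factorial := by
  rw [card_univ, Fintype.card_perm, ZMod.card]

theorem card_cycAdj_le {a b : ZMod n} (hab : b ≠ a) :
    (n - 1) * #{π : Perm (ZMod n) | CycAdj (π a) (π b)} ≤ 2 * n.factorial := by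
  have h := card_and_cycAdj_le (n := n) (fun _ => True) {a} (c := a) (d := b) (by simp)
    (by simpa using hab) (by simp)
  simpa [card_perm_zmod, Fintype.card_perm, ZMod.card] using h

theorem card_cycAdj_and_cycAdj_le {a b c d : ZMod n} (hda : d ≠ a) (hdb : d ≠ b) (hdc : d ≠ c) :
    (n - 3) * #{π : Perm (ZMod n) | CycAdj (π a) (π b) ∧ CycAdj (π c) (π d)} ≤
      2 * #{π : Perm (ZMod n) | CycAdj (π a) (π b)} := by
  refine le_trans (Nat.mul_le_mul_right _ (Nat.sub_le_sub_left (card_le_three (a := a) (b := b)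
    (c := c)) n)) ?_
  refine card_and_cycAdj_le (fun π => CycAdj (π a) (π b)) {a, b, c} (by simp)
    (by simp [hda, hdb, hdc]) ?_
  intro π d' hd' h
  simp only [mem_insert, mem_singleton, not_or] at hd'
  rw [Perm.mul_apply, Perm.mul_apply, swap_apply_of_ne_of_ne hda.symm (Ne.symm hd'.1),
    swap_apply_of_ne_of_ne hdb.symm (Ne.symm hd'.2.1)]
  exact h

/-- Swapping the values at `i` and `j` removes exactly the adjacency at `i`, unless one of seven
other adjacencies is present. -/
theorem card_adjSet_mul_swap (hn : 3 ≤ n) {π : Perm (ZMod n)} {i j : ZMod n}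
    (hi : CycAdj (π i) (π (i + 1))) (hj0 : j ≠ i) (hj1 : j ≠ i + 1) (hj2 : j ≠ i - 1)
    (h1 : ¬ CycAdj (π i) (π (i - 1))) (h2 : ¬ CycAdj (π (j - 1)) (π j))
    (h3 : ¬ CycAdj (π (j + 1)) (π j)) (h4 : ¬ CycAdj (π (i - 1)) (π j))
    (h5 : ¬ CycAdj (π (i + 1)) (π j)) (h6 : ¬ CycAdj (π i) (π (j - 1)))
    (h7 : ¬ CycAdj (π i) (π (j + 1))) :
    #(adjSet π) = #(adjSet (π * swap i j)) + 1 := by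
  have : Fact (1 < n) := ⟨by omega⟩
  have hs : ∀ x, x ≠ i → x ≠ j → (π * swap i j) x = π x := fun x hx hx' => by
    rw [Perm.mul_apply, swap_apply_of_ne_of_ne hx hx']
  have hsi : (π * swap i j) i = π j := by rw [Perm.mul_apply, swap_apply_left]
  have hsj : (π * swap i j) j = π i := by rw [Perm.mul_apply, swap_apply_right]
  have hi1 : i + 1 ≠ i := by simp
  have hj1' : j + 1 ≠ j := by simp
  have hji : j + 1 ≠ i := fun h => hj2 (by rw [← h]; ring)
  have hnot : i ∉ adjSet (π * swap i j) := by
    simp only [adjSet, mem_filter, mem_univ, true_and]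
    rw [hsi, hs _ hi1 hj1.symm]
    exact fun h => h5 h.symm
  rw [← card_insert_of_notMem hnot]
  congr 1
  ext e
  simp only [adjSet, mem_insert, mem_filter, mem_univ, true_and]
  by_cases e1 : e = i
  · subst e1; simp [hi]
  by_cases e2 : e = j
  · subst e2
    rw [hsj, hs _ hji hj1']
    simp only [e1, false_or]
    exact iff_of_false (fun h => h3 h.symm) h7
  by_cases e3 : e + 1 = i
  · obtain rfl : e = i - 1 := by rw [← e3]; ring
    rw [hs _ e1 e2, e3, hsi]
    simp only [e1, false_or]
    exact iff_of_false (fun h => h1 h.symm) h4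
  by_cases e4 : e + 1 = j
  · obtain rfl : e = j - 1 := by rw [← e4]; ring
    rw [hs _ e1 e2, e4, hsj]
    simp only [e1, false_or]
    exact iff_of_false h2 (fun h => h6 h.symm)
  rw [hs _ e1 e2, hs _ e3 e4]
  simp [e1]

/-- The permutations with an adjacency at `i` for which swapping the values at `i` and `j` changes
the number of adjacencies atypically. -/
def badSet (i j : ZMod n) : Finset (Perm (ZMod n)) :=
  {π | CycAdj (π i) (π (i + 1)) ∧ #(adjSet π) ≠ #(adjSet (π * swap i j)) + 1}

theorem card_badSet_le (hn : 4 ≤ n) {i j : ZMod n} :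
    (n - 1) * #(badSet i j) ≤ 2 * n.factorial := by
  have : Fact (1 < n) := ⟨by omega⟩
  refine le_trans (Nat.mul_le_mul_left _ (card_le_card ?_))
    (card_cycAdj_le (a := i) (b := i + 1) (by simp))
  intro π
  simp only [badSet, mem_filter, mem_univ, true_and]
  exact And.left

theorem card_badSet_le_of_ne (hn : 4 ≤ n) {i j : ZMod n} (hj0 : j ≠ i) (hj1 : j ≠ i + 1)
    (hj2 : j ≠ i - 1) (hj3 : j ≠ i + 2) :
    (n - 1) * ((n - 3) * #(badSet i j)) ≤ 28 * n.factorial := by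
  have : Fact (1 < n) := ⟨by omega⟩
  have : Fact (2 < n) := ⟨by omega⟩
  let E (c d : ZMod n) : Finset (Perm (ZMod n)) :=
    {π | CycAdj (π i) (π (i + 1)) ∧ CycAdj (π c) (π d)}
  have hsub : badSet i j ⊆ E i (i - 1) ∪ (E (j - 1) j ∪ (E (j + 1) j ∪ (E (i - 1) j ∪
      (E (i + 1) j ∪ (E i (j - 1) ∪ E i (j + 1)))))) := by
    intro π hπ
    simp only [badSet, E, mem_filter, mem_univ, true_and, mem_union] at hπ ⊢
    obtain ⟨hi, hne⟩ := hπ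
    by_contra hcon
    simp only [hi, true_and, not_or] at hcon
    obtain ⟨h1, h2, h3, h4, h5, h6, h7⟩ := hcon
    exact hne (card_adjSet_mul_swap (by omega) hi hj0 hj1 hj2 h1 h2 h3 h4 h5 h6 h7)
  have hE : ∀ c d, d ≠ i → d ≠ i + 1 → d ≠ c →
      (n - 1) * ((n - 3) * #(E c d)) ≤ 4 * n.factorial := by
    intro c d hdi hdi' hdc
    have h1 := card_cycAdj_and_cycAdj_le (n := n) hdi hdi' hdc
    have h2 := card_cycAdj_le (n := n) (a := i) (b := i + 1) (by simp)
    calc _ ≤ (n - 1) * (2 * #{π : Perm (ZMod n) | CycAdj (π i) (π (i + 1))}) :=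
          Nat.mul_le_mul_left _ h1
      _ ≤ _ := by linarith
  have hc : #(badSet i j) ≤ #(E i (i - 1)) + (#(E (j - 1) j) + (#(E (j + 1) j) + (#(E (i - 1) j) +
      (#(E (i + 1) j) + (#(E i (j - 1)) + #(E i (j + 1))))))) := by
    refine (card_le_card hsub).trans ?_
    iterate 6 refine (card_union_le _ _).trans (Nat.add_le_add_left ?_ _)
    exact le_rfl
  have hmul := Nat.mul_le_mul_left (n - 1) (Nat.mul_le_mul_left (n - 3) hc)
  have g1 := hE i (i - 1) (by simp) (fun h => ZMod.neg_one_ne_one (n := n) (by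
    rw [sub_eq_add_neg] at h; exact add_left_cancel h)) (by simp)
  have g2 := hE (j - 1) j hj0 hj1 (fun h => one_ne_zero (sub_eq_self.mp h.symm))
  have g3 := hE (j + 1) j hj0 hj1 (by simp)
  have g4 := hE (i - 1) j hj0 hj1 hj2
  have g5 := hE (i + 1) j hj0 hj1 hj1
  have k1 : j - 1 ≠ i := fun h => hj1 (by rw [← h]; ring)
  have k2 : j - 1 ≠ i + 1 := fun h => hj3 (by rw [sub_eq_iff_eq_add] at h; rw [h]; ring)
  have k3 : j + 1 ≠ i := fun h => hj2 (by rw [← h]; ring)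
  have g6 := hE i (j - 1) k1 k2 k1
  have g7 := hE i (j + 1) k3 (fun h => hj0 (add_right_cancel h)) k3
  simp only [mul_add] at hmul
  linarith

theorem sum_card_badSet_le (hn : 4 ≤ n) :
    (n - 1) * ((n - 3) * ∑ i : ZMod n, ∑ j ∈ univ.erase (i + 1), #(badSet i j)) ≤
      (6 * (n - 3) * n + 28 * n ^ 2) * n.factorial := by
  have key : ∀ i : ZMod n, (n - 1) * ((n - 3) * ∑ j ∈ univ.erase (i + 1), #(badSet i j)) ≤
      (6 * (n - 3) + 28 * n) * n.factorial := by
    intro i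
    have h1 : ∀ j ∈ univ.erase (i + 1), (n - 1) * ((n - 3) * #(badSet i j)) ≤
        (if j ∈ ({i, i - 1, i + 2} : Finset (ZMod n)) then (n - 3) * (2 * n.factorial) else 0) +
          28 * n.factorial := by
      intro j hj
      split_ifs with h
      · have := Nat.mul_le_mul_left (n - 3) (card_badSet_le hn (i := i) (j := j))
        rw [mul_left_comm]
        omega
      · simp only [mem_insert, mem_singleton, not_or] at h
        rw [zero_add]
        exact card_badSet_le_of_ne hn h.1 (ne_of_mem_erase hj) h.2.1 h.2.2
    rw [mul_sum, mul_sum]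
    refine (sum_le_sum h1).trans ?_
    refine (sum_le_sum_of_subset (subset_univ _)).trans ?_
    rw [sum_add_distrib, sum_ite_mem, univ_inter, sum_const, sum_const, card_univ, ZMod.card,
      smul_eq_mul, smul_eq_mul]
    have := Nat.mul_le_mul_right ((n - 3) * (2 * n.factorial))
      (card_le_three (a := i) (b := i - 1) (c := i + 2))
    linarith
  rw [mul_sum, mul_sum]
  refine (sum_le_card_nsmul _ _ _ fun i _ => key i).trans (le_of_eq ?_)
  rw [card_univ, ZMod.card, smul_eq_mul]
  ring

/-- An approximate recurrence for the distribution of the number of adjacencies, obtained by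
swapping two values. -/
theorem abs_adjNum_recurrence_le (hn : 4 ≤ n) (k : ℕ) :
    |((n : ℝ) - 1) * ((k + 1) * adjNum n (k + 1)) - 2 * n * adjNum n k| ≤
      (∑ i : ZMod n, ∑ j ∈ univ.erase (i + 1), #(badSet i j) : ℕ) := by
  have : Fact (1 < n) := ⟨by omega⟩
  have hL : ((n : ℝ) - 1) * ((k + 1) * adjNum n (k + 1)) =
      ∑ i : ZMod n, ∑ j ∈ univ.erase (i + 1), ∑ π : Perm (ZMod n),
        if CycAdj (π i) (π (i + 1)) ∧ #(adjSet π) = k + 1 then (1 : ℝ) else 0 := by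
    simp_rw [sum_const]
    simp only [card_erase_of_mem (mem_univ _), card_univ, ZMod.card, nsmul_eq_mul]
    rw [← mul_sum, Nat.cast_sub (by omega), Nat.cast_one]
    congr 1
    rw [sum_comm, adjNum, card_filter]
    push_cast
    rw [mul_sum]
    refine sum_congr rfl fun π _ => ?_
    by_cases h : #(adjSet π) = k + 1
    · simp only [h, and_true, if_true, mul_one]
      rw [sum_boole]
      change _ = ((#(adjSet π) : ℕ) : ℝ)
      rw [h]; push_cast; ring
    · simp [h]
  have hR : 2 * (n : ℝ) * adjNum n k =
      ∑ i : ZMod n, ∑ j ∈ univ.erase (i + 1), ∑ π : Perm (ZMod n),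
        if CycAdj (π i) (π (i + 1)) ∧ #(adjSet (π * swap i j)) = k then (1 : ℝ) else 0 := by
    have h1 : ∀ i : ZMod n, ∑ j ∈ univ.erase (i + 1), ∑ π : Perm (ZMod n),
        (if CycAdj (π i) (π (i + 1)) ∧ #(adjSet (π * swap i j)) = k then (1 : ℝ) else 0) =
        ∑ j : ZMod n, ∑ π : Perm (ZMod n),
          if CycAdj (π (i + 1)) (π j) ∧ #(adjSet π) = k then (1 : ℝ) else 0 := by
      intro i
      rw [← sum_erase (s := univ) (a := i + 1)]
      · refine sum_congr rfl fun j hj => ?_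
        refine Fintype.sum_equiv (Equiv.mulRight (swap i j)) _ _ fun π => ?_
        simp only [Equiv.coe_mulRight, Perm.mul_apply, swap_apply_right,
          swap_apply_of_ne_of_ne (show i + 1 ≠ i by simp) (ne_of_mem_erase hj).symm,
          cycAdj_comm (x := π i)]
      · refine sum_eq_zero fun π _ => if_neg ?_
        simp [CycAdj, eq_comm]
    simp_rw [h1]
    have h2 : ∀ i : ZMod n, ∑ j : ZMod n, ∑ π : Perm (ZMod n),
          (if CycAdj (π (i + 1)) (π j) ∧ #(adjSet π) = k then (1 : ℝ) else 0) =
          2 * adjNum n k := by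
      intro i
      rw [sum_comm, adjNum, card_filter]
      push_cast
      rw [mul_sum]
      refine sum_congr rfl fun π _ => ?_
      by_cases h : #(adjSet π) = k
      · simp only [h, and_true, if_true, mul_one]
        rw [sum_boole, card_filter_cycAdj (by omega)]
        norm_num
      · simp [h]
    simp_rw [h2]
    rw [sum_const, card_univ, ZMod.card, nsmul_eq_mul]
    ring
  rw [hL, hR, ← sum_sub_distrib]
  push_cast
  refine (abs_sum_le_sum_abs _ _).trans (sum_le_sum fun i _ => ?_)
  rw [← sum_sub_distrib]
  refine (abs_sum_le_sum_abs _ _).trans (sum_le_sum fun j _ => ?_)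
  rw [← sum_sub_distrib, badSet, card_filter]
  push_cast
  refine (abs_sum_le_sum_abs _ _).trans (sum_le_sum fun π _ => ?_)
  by_cases h : CycAdj (π i) (π (i + 1))
  · simp only [h, true_and]
    split_ifs <;> first | (exfalso; omega) | simp
  · simp [h]

theorem sum_card_adjSet_le :
    (n - 1) * ∑ π : Perm (ZMod n), #(adjSet π) ≤ 2 * n * n.factorial := by
  rcases Nat.lt_or_ge 1 n with hn | hn
  · have : Fact (1 < n) := ⟨hn⟩
    simp_rw [adjSet, card_filter]
    rw [sum_comm, mul_sum]
    simp_rw [← card_filter]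
    refine (sum_le_card_nsmul _ _ _ fun i _ =>
      card_cycAdj_le (a := i) (b := i + 1) (by simp)).trans (le_of_eq ?_)
    rw [card_univ, ZMod.card, smul_eq_mul]
    ring
  · simp [Nat.sub_eq_zero_of_le hn]

theorem sum_adjNum_add (K : ℕ) :
    ∑ k ∈ range K, adjNum n k + #{π : Perm (ZMod n) | K ≤ #(adjSet π)} = n.factorial := by
  have h : ∑ k ∈ range K, adjNum n k = #{π : Perm (ZMod n) | ¬ K ≤ #(adjSet π)} := by
    rw [card_eq_sum_card_fiberwise (f := fun π => #(adjSet π)) (t := range K)]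
    · refine sum_congr rfl fun k hk => ?_
      rw [adjNum, filter_filter]
      congr 1
      refine filter_congr fun π _ => ?_
      rw [mem_range] at hk
      omega
    · intro π hπ
      simpa using hπ
  rw [h, add_comm, card_filter_add_card_filter_not, card_perm_zmod]

theorem mul_card_le_card_adjSet_le (K : ℕ) :
    (n - 1) * (K * #{π : Perm (ZMod n) | K ≤ #(adjSet π)}) ≤ 2 * n * n.factorial := by
  refine le_trans (Nat.mul_le_mul_left _ ?_) sum_card_adjSet_le
  rw [mul_comm, ← smul_eq_mul]
  refine (card_nsmul_le_sum _ (fun π => #(adjSet π)) _ fun π hπ => ?_).trans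
    (sum_le_sum_of_subset (subset_univ _))
  simpa using hπ

theorem A0_eq_adjNum : A0 n = adjNum n 0 := by
  rw [A0, adjNum, ← Set.ncard_coe_finset]
  congr 1
  ext π
  rw [mem_coe, mem_filter_univ, card_eq_zero, adjSet, filter_eq_empty_iff]
  simp [CycAdj]

theorem adjNum_le (k : ℕ) : adjNum n k ≤ n.factorial := by
  rw [← card_perm_zmod]
  exact card_le_card (filter_subset _ _)

theorem abs_adjNum_div_recurrence_le (hn : 6 ≤ n) (k : ℕ) :
    |((k : ℝ) + 1) * (adjNum n (k + 1) / n.factorial) - 2 * (adjNum n k / n.factorial)| ≤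
      (137 + k) / n := by
  have h1 := abs_adjNum_recurrence_le (n := n) (by omega) k
  have h2 := sum_card_badSet_le (n := n) (by omega)
  set B := ∑ i : ZMod n, ∑ j ∈ univ.erase (i + 1), #(badSet i j)
  have hf : (0 : ℝ) < n.factorial := by exact_mod_cast n.factorial_pos
  have hn' : (6 : ℝ) ≤ n := by exact_mod_cast hn
  have hle : (adjNum n (k + 1) : ℝ) ≤ n.factorial := by exact_mod_cast adjNum_le (k + 1)
  have hB : (B : ℝ) ≤ 136 * n.factorial := by
    have h3 : ((n : ℝ) - 1) * ((n - 3) * B) ≤ (6 * (n - 3) * n + 28 * n ^ 2) * n.factorial := by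
      have := (Nat.cast_le (α := ℝ)).mpr h2
      push_cast [Nat.cast_sub (show 1 ≤ n by omega), Nat.cast_sub (show 3 ≤ n by omega)] at this
      exact this
    have h4 : (0 : ℝ) < (n - 1) * (n - 3) := by nlinarith
    refine le_of_mul_le_mul_left ?_ h4
    calc ((n : ℝ) - 1) * (n - 3) * B ≤ (6 * (n - 3) * n + 28 * n ^ 2) * n.factorial := by linarith
      _ ≤ (((n : ℝ) - 1) * (n - 3) * 136) * n.factorial := by
        refine mul_le_mul_of_nonneg_right ?_ hf.le
        nlinarith
      _ = _ := by ring
  rw [show ((k : ℝ) + 1) * (adjNum n (k + 1) / n.factorial) - 2 * (adjNum n k / n.factorial) =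
    ((n * ((k + 1) * adjNum n (k + 1)) - 2 * n * adjNum n k) / n.factorial) / n by
      field_simp, abs_div, abs_of_pos (show (0 : ℝ) < n by linarith)]
  refine div_le_div_of_nonneg_right ?_ (by linarith)
  rw [abs_div, abs_of_pos hf, div_le_iff₀ hf]
  have h5 : (0 : ℝ) ≤ (k + 1) * adjNum n (k + 1) := by positivity
  have h6 : ((k : ℝ) + 1) * adjNum n (k + 1) ≤ (k + 1) * n.factorial :=
    mul_le_mul_of_nonneg_left hle (by positivity)
  rw [abs_le] at h1 ⊢
  constructor <;> linarith [h1.1, h1.2]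

theorem one_sub_sum_adjNum_div_le (hn : 2 ≤ n) (K : ℕ) :
    (K : ℝ) * (1 - ∑ k ∈ range K, (adjNum n k : ℝ) / n.factorial) ≤ 4 := by
  have h1 := congrArg (Nat.cast (R := ℝ)) (sum_adjNum_add (n := n) K)
  have h2 := (Nat.cast_le (α := ℝ)).mpr (mul_card_le_card_adjSet_le (n := n) K)
  push_cast [Nat.cast_sub (show 1 ≤ n by omega)] at h1 h2
  have hf : (0 : ℝ) < n.factorial := by exact_mod_cast n.factorial_pos
  have hn' : (2 : ℝ) ≤ n := by exact_mod_cast hn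
  rw [← sum_div, one_sub_div hf.ne', ← mul_div_assoc, div_le_iff₀ hf, ← h1, add_sub_cancel_left,
    h1]
  refine le_of_mul_le_mul_left (h2.trans ?_) (show (0 : ℝ) < n - 1 by linarith)
  nlinarith

end Counting

/-- A sequence of distributions on `ℕ` with uniformly small tails that asymptotically satisfies the
recurrence `(k + 1) q (k + 1) = 2 q k` of the Poisson distribution converges to it at `0`. -/
theorem tendsto_exp_neg_two_of_recurrence {q : ℕ → ℕ → ℝ} {C : ℝ} (hq0 : ∀ m, 0 ≤ q m 0)
    (hq1 : ∀ m, q m 0 ≤ 1) (hsum : ∀ m K, ∑ k ∈ range K, q m k ≤ 1)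
    (htail : ∀ K : ℕ, ∀ᶠ m in atTop, (K : ℝ) * (1 - ∑ k ∈ range K, q m k) ≤ C)
    (hrec : ∀ k : ℕ, Tendsto (fun m => ((k : ℝ) + 1) * q m (k + 1) - 2 * q m k) atTop (nhds 0)) :
    Tendsto (fun m => q m 0) atTop (nhds (Real.exp (-2))) := by
  have hpois : ∀ k : ℕ, Tendsto (fun m => q m k - 2 ^ k / k.factorial * q m 0) atTop (nhds 0) := by
    intro k
    induction k with
    | zero => simp
    | succ k ih =>
      have h := ((hrec k).add (ih.const_mul 2)).div_const ((k : ℝ) + 1)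
      simp only [mul_zero, add_zero, zero_div] at h
      refine h.congr fun m => ?_
      rw [Nat.factorial_succ]
      have : (k.factorial : ℝ) ≠ 0 := by exact_mod_cast k.factorial_ne_zero
      push_cast
      field_simp
      ring
  have hS : Tendsto (fun K => ∑ k ∈ range K, (2 : ℝ) ^ k / k.factorial) atTop
      (nhds (Real.exp 2)) := by
    rw [Real.exp_eq_exp_ℝ]
    exact (NormedSpace.expSeries_div_hasSum_exp (2 : ℝ)).tendsto_sum_nat
  have hpartial : ∀ K : ℕ, Tendsto (fun m => ∑ k ∈ range K, q m k -
      (∑ k ∈ range K, (2 : ℝ) ^ k / k.factorial) * q m 0) atTop (nhds 0) := by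
    intro K
    simp_rw [sum_mul, ← sum_sub_distrib]
    simpa using tendsto_finsetSum (range K) fun k _ => hpois k
  have hmain : Tendsto (fun m => Real.exp 2 * q m 0) atTop (nhds 1) := by
    rw [Metric.tendsto_nhds]
    intro ε hε
    have hC : Tendsto (fun K : ℕ => C / K) atTop (nhds 0) := tendsto_const_div_atTop_nhds_zero_nat C
    obtain ⟨K, hK1, hK2, hK3⟩ := ((Metric.tendsto_nhds.mp hS (ε / 3) (by positivity)).and
      ((hC.eventually_lt_const (show (0 : ℝ) < ε / 3 by positivity)).and
        (eventually_gt_atTop 0))).exists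
    filter_upwards [htail K, Metric.tendsto_nhds.mp (hpartial K) (ε / 3) (by positivity)]
      with m hm1 hm2
    rw [Real.dist_eq] at hK1 hm2 ⊢
    rw [sub_zero] at hm2
    have hK : (0 : ℝ) < K := by exact_mod_cast hK3
    have h1 : 1 - ∑ k ∈ range K, q m k < ε / 3 := by
      refine lt_of_le_of_lt ?_ hK2
      rw [le_div_iff₀ hK]
      linarith
    have h2 : |(∑ k ∈ range K, (2 : ℝ) ^ k / k.factorial - Real.exp 2) * q m 0| < ε / 3 := by
      rw [abs_mul, abs_of_nonneg (hq0 m)]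
      exact lt_of_le_of_lt (mul_le_of_le_one_right (abs_nonneg _) (hq1 m)) hK1
    have h3 := hsum m K
    rw [abs_lt] at h2 hm2 ⊢
    constructor <;> linarith [h2.1, h2.2, hm2.1, hm2.2]
  have h := hmain.const_mul (Real.exp (-2))
  simpa [← mul_assoc, ← Real.exp_add] using h

/-- `a_{n,0}/n! → e^{−2}` as `n → ∞`. -/
theorem a_n0_tendsto :
    Tendsto (fun n : ℕ => (A0 n : ℝ) / (Nat.factorial n : ℝ)) atTop
      (nhds (Real.exp (-2))) := by
  rw [← tendsto_add_atTop_iff_nat 1]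
  simp_rw [A0_eq_adjNum]
  have hf : ∀ m : ℕ, (0 : ℝ) < (m + 1).factorial := fun m => by
    exact_mod_cast (m + 1).factorial_pos
  refine tendsto_exp_neg_two_of_recurrence (C := 4)
    (q := fun m k => (adjNum (m + 1) k : ℝ) / (m + 1).factorial) (fun m => by positivity)
    (fun m => ?_) (fun m K => ?_) (fun K => ?_) (fun k => ?_)
  · rw [div_le_one (hf m)]
    exact_mod_cast adjNum_le 0
  · rw [← sum_div, div_le_one (hf m)]
    exact_mod_cast Nat.le.intro (sum_adjNum_add (n := m + 1) K)
  · filter_upwards [eventually_ge_atTop 1] with m hm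
    exact one_sub_sum_adjNum_div_le (by omega) K
  · refine squeeze_zero_norm' (a := fun m : ℕ => (137 + (k : ℝ)) / ((m + 1 : ℕ) : ℝ)) ?_ ?_
    · filter_upwards [eventually_ge_atTop 5] with m hm
      exact abs_adjNum_div_recurrence_le (by omega) k
    · exact (tendsto_add_atTop_iff_nat 1).mpr (tendsto_const_div_atTop_nhds_zero_nat (137 + (k : ℝ)))
end
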